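/- There exists a constant C > 0 depending only on n, λ and Λ such that for every g ∈ M_{λ,Λ}, every ε ∈ (0,1), and every solution u of the Ginzburg–Landau equation −Δ_g u = ε⁻²(1−|u|²)u on B₁, there exists a radius r ∈ (ε^{1/2}, ε^{1/4}) with r^{3−n} ∫_{∂B_r} |∇_r u|² √(det g) dH^{n−1} + r^{2−n} ∫_{B_r} (1−|u|²)²/(2ε²) dvol_g ≤ (C/|log ε|) ∫_{B₁} e_ε(u) dvol_g, where H^{n−1} is the (n−1)-dimensional Hausdorff measure on the sphere ∂B_r and |log ε| = −log ε. -/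

import Mathlib

open MeasureTheory Metric

noncomputable section

/-- `n`-dimensional Euclidean space. -/
abbrev Euc (n : ℕ) : Type := EuclideanSpace ℝ (Fin n)

/-- The real inner product of two complex numbers, viewing `ℂ ≅ ℝ²`. -/
def rdot (v w : ℂ) : ℝ := v.re * w.re + v.im * w.im

/-- The `i`-th partial derivative of a function on Euclidean space. -/
def pd {n : ℕ} (u : Euc n → ℂ) (i : Fin n) (x : Euc n) : ℂ :=
  fderiv ℝ u x (EuclideanSpace.single i 1)

/-- `√(det g)`. -/
def sqrtDet {n : ℕ} (g : Euc n → Matrix (Fin n) (Fin n) ℝ) (x : Euc n) : ℝ :=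
  Real.sqrt (g x).det

/-- `g^{ij} ∂_i u · ∂_j u`, the squared norm of the gradient of `u` with respect to `g`. -/
def gradSq {n : ℕ} (g : Euc n → Matrix (Fin n) (Fin n) ℝ) (u : Euc n → ℂ) (x : Euc n) : ℝ :=
  ∑ i, ∑ j, (g x)⁻¹ i j * rdot (pd u i x) (pd u j x)

/-- The Ginzburg–Landau energy density `e_ε(u)`. -/
def eDen {n : ℕ} (g : Euc n → Matrix (Fin n) (Fin n) ℝ) (ε : ℝ) (u : Euc n → ℂ)
    (x : Euc n) : ℝ :=
  gradSq g u x / 2 + (1 - ‖u x‖ ^ 2) ^ 2 / (4 * ε ^ 2)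

/-- The class `M_{λ,Λ}` of Lipschitz metrics on the unit ball: symmetric positive definite,
equal to the identity at `0`, Lipschitz components, and uniformly elliptic. -/
def MemM (n : ℕ) (lam Lam : ℝ) (g : Euc n → Matrix (Fin n) (Fin n) ℝ) : Prop :=
  g 0 = 1 ∧
  (∀ x ∈ ball (0 : Euc n) 1, (g x).IsSymm ∧ (g x).PosDef) ∧
  (∀ i j : Fin n,
    LipschitzOnWith (Real.toNNReal Lam) (fun x => g x i j) (ball (0 : Euc n) 1)) ∧
  (∀ x ∈ ball (0 : Euc n) 1, ∀ ξ : Fin n → ℝ,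
    lam * ∑ i, ξ i ^ 2 ≤ ∑ i, ∑ j, g x i j * ξ i * ξ j ∧
    ∑ i, ∑ j, g x i j * ξ i * ξ j ≤ lam⁻¹ * ∑ i, ξ i ^ 2)

/-- A weak solution `u ∈ W^{1,2}(B₁; ℂ)`, `|u| ≤ 1`, of the Ginzburg–Landau equation
`−Δ_g u = ε⁻²(1−|u|²)u` on the unit ball. -/
def IsGLSol (n : ℕ) (g : Euc n → Matrix (Fin n) (Fin n) ℝ) (ε : ℝ) (u : Euc n → ℂ) : Prop :=
  DifferentiableOn ℝ u (ball (0 : Euc n) 1) ∧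
  (∀ x ∈ ball (0 : Euc n) 1, ‖u x‖ ≤ 1) ∧
  IntegrableOn (fun x => eDen g ε u x * sqrtDet g x) (ball (0 : Euc n) 1) ∧
  ∀ ζ : Euc n → ℂ, ContDiff ℝ 1 ζ → tsupport ζ ⊆ ball (0 : Euc n) 1 →
    ∫ x in ball (0 : Euc n) 1,
      ((∑ i, ∑ j, (g x)⁻¹ i j * rdot (pd u i x) (pd ζ j x))
        - (1 - ‖u x‖ ^ 2) / ε ^ 2 * rdot (u x) (ζ x)) * sqrtDet g x = 0

/-- The radial derivative `∇_r u(x) = g^{ij}(x) (x_i/|x|) ∂_j u(x)`. -/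
def radD {n : ℕ} (g : Euc n → Matrix (Fin n) (Fin n) ℝ) (u : Euc n → ℂ) (x : Euc n) : ℂ :=
  ∑ i, ∑ j, (((g x)⁻¹ i j * (x i / ‖x‖) : ℝ) : ℂ) * pd u j x

open Filter Topology ENNReal in
/-- Eilenberg's inequality for the level sets of a 1-Lipschitz function, with a measurable
majorant in place of the measure of the slices. -/
theorem exists_measurable_slice_majorant {X : Type*} [MetricSpace X] [MeasurableSpace X]
    [BorelSpace X] {f : X → ℝ} (hf : LipschitzWith 1 f) {d : ℝ} (hd : 0 < d) (A : Set X) :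
    ∃ Φ : ℝ → ℝ≥0∞, Measurable Φ ∧ (∀ r, μH[d] (A ∩ f ⁻¹' {r}) ≤ Φ r) ∧
      ∫⁻ r, Φ r ≤ μH[d + 1] A := by
  rcases eq_or_ne (μH[d + 1] A) ∞ with hA | hA
  · exact ⟨fun _ => ∞, measurable_const, fun _ => le_top, by rw [hA]; exact le_top⟩
  set δ : ℕ → ℝ≥0∞ := fun k => ((k : ℝ≥0∞) + 1)⁻¹ with hδ
  have hδ0 : ∀ k, 0 < δ k := fun k => by simp [hδ]
  have hδlim : Tendsto δ atTop (𝓝 0) := by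
    have := (tendsto_add_atTop_iff_nat 1).2 ENNReal.tendsto_inv_nat_nhds_zero
    simpa [hδ] using this
  have hcov : ∀ k, ∃ t : ℕ → Set X, A ⊆ ⋃ i, t i ∧ (∀ i, ediam (t i) ≤ δ k) ∧
      ∑' i, (⨆ _ : (t i).Nonempty, ediam (t i) ^ (d + 1)) ≤ μH[d + 1] A + δ k := by
    intro k
    have h1 : (⨅ (t : ℕ → Set X) (_ : A ⊆ ⋃ n, t n) (_ : ∀ n, ediam (t n) ≤ δ k),
          ∑' n, ⨆ _ : (t n).Nonempty, ediam (t n) ^ (d + 1)) < μH[d + 1] A + δ k := by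
      refine lt_of_le_of_lt ?_ (ENNReal.lt_add_right hA (hδ0 k).ne')
      conv_rhs => rw [Measure.hausdorffMeasure_apply]
      exact le_iSup₂_of_le (δ k) (hδ0 k) le_rfl
    simp only [iInf_lt_iff] at h1
    obtain ⟨t, h1, h2, h3⟩ := h1
    exact ⟨t, h1, h2, h3.le⟩
  choose t ht1 ht2 ht3 using hcov
  set φ : ℕ → ℝ → ℝ≥0∞ := fun k r =>
    ∑' i, (closure (f '' t k i)).indicator (fun _ => ediam (t k i) ^ d) r with hφ
  have hφm : ∀ k, Measurable (φ k) := fun k =>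
    Measurable.tsum fun i => measurable_const.indicator isClosed_closure.measurableSet
  refine ⟨fun r => liminf (fun k => φ k r) atTop, Measurable.liminf hφm, fun r => ?_, ?_⟩
  · refine (Measure.hausdorffMeasure_le_liminf_tsum d _ δ hδlim
      (fun k i => t k i ∩ f ⁻¹' {r}) (.of_forall fun k i => ?_) (.of_forall fun k => ?_)).trans ?_
    · exact (ediam_mono Set.inter_subset_left).trans (ht2 k i)
    · rw [← Set.iUnion_inter]
      exact Set.inter_subset_inter_left _ (ht1 k)
    · refine liminf_le_liminf (.of_forall fun k => ?_)
      refine ENNReal.tsum_le_tsum fun i => ?_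
      by_cases hr : r ∈ closure (f '' t k i)
      · rw [Set.indicator_of_mem hr]
        exact ENNReal.rpow_le_rpow (ediam_mono Set.inter_subset_left) hd.le
      · have : t k i ∩ f ⁻¹' {r} = ∅ := by
          refine Set.eq_empty_of_forall_notMem fun x hx => hr (subset_closure ⟨x, hx.1, hx.2⟩)
        simp [this, hd]
  · refine (lintegral_liminf_le hφm).trans ?_
    have h2 : ∀ k, ∫⁻ r, φ k r ≤ μH[d + 1] A + δ k := by
      intro k
      refine le_trans ?_ (ht3 k)
      rw [lintegral_tsum fun i =>
        (measurable_const.indicator isClosed_closure.measurableSet).aemeasurable]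
      refine ENNReal.tsum_le_tsum fun i => ?_
      rw [lintegral_indicator_const isClosed_closure.measurableSet]
      rcases (t k i).eq_empty_or_nonempty with h0 | h0
      · simp [h0]
      refine le_trans ?_ (le_iSup_of_le h0 le_rfl)
      have h3 : volume (closure (f '' t k i)) ≤ ediam (t k i) := by
        refine (Real.volume_le_diam _).trans ?_
        rw [ediam_closure]
        simpa using hf.ediam_image_le (t k i)
      rw [ENNReal.rpow_add_of_nonneg _ _ hd.le zero_le_one, ENNReal.rpow_one]
      gcongr
    calc liminf (fun k => ∫⁻ r, φ k r) atTop ≤ liminf (fun k => μH[d + 1] A + δ k) atTop :=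
          liminf_le_liminf (.of_forall h2)
      _ = μH[d + 1] A := by
          have : Tendsto (fun k => μH[d + 1] A + δ k) atTop (𝓝 (μH[d + 1] A + 0)) :=
            tendsto_const_nhds.add hδlim
          rw [this.liminf_eq, add_zero]

open ENNReal in
/-- The integral version of Eilenberg's inequality. -/
theorem exists_measurable_slice_majorant_lintegral {X : Type*} [MetricSpace X]
    [MeasurableSpace X] [BorelSpace X] {f : X → ℝ} (hf : LipschitzWith 1 f) {d : ℝ}
    (hd : 0 < d) {F : X → ℝ≥0∞} (hF : Measurable F) :
    ∃ Φ : ℝ → ℝ≥0∞, Measurable Φ ∧ (∀ r, ∫⁻ x in f ⁻¹' {r}, F x ∂(μH[d]) ≤ Φ r) ∧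
      ∫⁻ r, Φ r ≤ ∫⁻ x, F x ∂(μH[d + 1]) := by
  refine hF.ennreal_induction (motive := fun F => ∃ Φ : ℝ → ℝ≥0∞, Measurable Φ ∧
      (∀ r, ∫⁻ x in f ⁻¹' {r}, F x ∂(μH[d]) ≤ Φ r) ∧
      ∫⁻ r, Φ r ≤ ∫⁻ x, F x ∂(μH[d + 1])) ?_ ?_ ?_
  · intro c A hA
    obtain ⟨Φ, h1, h2, h3⟩ := exists_measurable_slice_majorant hf hd A
    refine ⟨fun r => c * Φ r, h1.const_mul c, fun r => ?_, ?_⟩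
    · rw [lintegral_indicator_const hA, Measure.restrict_apply hA]
      exact mul_le_mul_right (h2 r) c
    · rw [lintegral_const_mul _ h1, lintegral_indicator_const hA]
      exact mul_le_mul_right h3 c
  · intro F G _ hF hG hΦ hΨ
    obtain ⟨Φ, h1, h2, h3⟩ := hΦ
    obtain ⟨Ψ, k1, k2, k3⟩ := hΨ
    refine ⟨fun r => Φ r + Ψ r, h1.add k1, fun r => ?_, ?_⟩
    · simp only [Pi.add_apply]
      rw [lintegral_add_left hF]
      exact add_le_add (h2 r) (k2 r)
    · simp only [Pi.add_apply]
      rw [lintegral_add_left h1, lintegral_add_left hF]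
      exact add_le_add h3 k3
  · intro F hF hmono h
    choose Φ h1 h2 h3 using h
    refine ⟨fun r => Filter.liminf (fun k => Φ k r) Filter.atTop, Measurable.liminf h1,
      fun r => ?_, ?_⟩
    · rw [lintegral_iSup hF hmono]
      have hm : Monotone fun k => ∫⁻ x in f ⁻¹' {r}, F k x ∂(μH[d]) :=
        fun i j hij => lintegral_mono (hmono hij)
      rw [← (tendsto_atTop_iSup hm).liminf_eq]
      exact Filter.liminf_le_liminf (.of_forall fun k => h2 k r)
    · refine (lintegral_liminf_le h1).trans ?_
      refine (Filter.liminf_le_liminf (.of_forall h3)).trans ?_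
      refine Filter.liminf_le_of_le (by isBoundedDefault) fun b hb => ?_
      obtain ⟨k, hk⟩ := hb.exists
      exact hk.trans (lintegral_mono fun x => by simpa using le_iSup (fun i => F i x) k)

/-- On Euclidean space the Hausdorff measure is dominated by a multiple of Lebesgue measure. -/
theorem exists_hausdorffMeasure_le_volume (n : ℕ) :
    ∃ C : ENNReal, C ≠ ⊤ ∧ (μH[(n : ℝ)] : Measure (Euc n)) ≤ C • volume := by
  have h2 : LipschitzWith ((Fintype.card (Fin n) : NNReal) ^ (1 / (2 : ENNReal)).toReal)
      (WithLp.toLp 2 : (Fin n → ℝ) → Euc n) := PiLp.lipschitzWith_toLp 2 _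
  set K : NNReal := (Fintype.card (Fin n) : NNReal) ^ (1 / (2 : ENNReal)).toReal with hK
  refine ⟨(K : ENNReal) ^ (n : ℝ), by simp, ?_⟩
  refine Measure.le_iff.2 fun s hs => ?_
  have h3 := h2.hausdorffMeasure_image_le (d := n) (Nat.cast_nonneg n) (WithLp.ofLp '' s)
  have h4 : (WithLp.toLp 2 : (Fin n → ℝ) → Euc n) '' (WithLp.ofLp '' s) = s := by
    rw [Set.image_image]; simp
  rw [h4] at h3
  have h5 : (μH[(n : ℝ)] : Measure (Fin n → ℝ)) = volume := by
    simpa using (hausdorffMeasure_pi_real (ι := Fin n))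
  rw [h5] at h3
  refine h3.trans (le_of_eq ?_)
  rw [Measure.smul_apply, smul_eq_mul]
  congr 1
  have h6 : (WithLp.ofLp '' s : Set (Fin n → ℝ)) = WithLp.toLp 2 ⁻¹' s := by
    ext x
    constructor
    · rintro ⟨y, hy, rfl⟩; exact hy
    · intro hx; exact ⟨_, hx, rfl⟩
  rw [h6]
  exact (PiLp.volume_preserving_toLp (Fin n)).measure_preimage hs.nullMeasurableSet

theorem rdot_eq_inner (v w : ℂ) : rdot v w = inner ℝ v w := by
  simp [rdot, Complex.inner, Complex.mul_re]
  ring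

open Filter Topology in
/-- The pairing of two `L²` functions depends continuously on a translation of one of them. -/
theorem continuous_integral_rdot_translate {n : ℕ} {b F : Euc n → ℂ} (hb : MemLp b 2)
    (hF : MemLp F 2) : Continuous fun y => ∫ x, rdot (b x) (F (x + y)) := by
  have hG : Continuous fun y : Euc n => (⟨fun x => x + y, by fun_prop⟩ : C(Euc n, Euc n)) :=
    ContinuousMap.continuous_of_continuous_uncurry _ (by
      simp only [Function.uncurry_def, ContinuousMap.coe_mk]; fun_prop)
  have hmp : ∀ y : Euc n, MeasurePreserving (⟨fun x => x + y, by fun_prop⟩ : C(Euc n, Euc n)) :=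
    fun y => measurePreserving_add_right volume y
  have h1 := Continuous.compMeasurePreservingLp (E := ℂ) (p := 2)
    (continuous_const (y := hF.toLp F)) hG hmp (by simp)
  have h2 : Continuous fun y => (inner ℝ (hb.toLp b)
      (Lp.compMeasurePreserving _ (hmp y) (hF.toLp F)) : ℝ) := by fun_prop
  refine h2.congr fun y => ?_
  rw [L2.inner_def]
  refine integral_congr_ae ?_
  have h3 : Lp.compMeasurePreserving _ (hmp y) (hF.toLp F) =ᵐ[volume] fun x => F (x + y) := by
    rw [Lp.toLp_compMeasurePreserving]
    exact MemLp.coeFn_toLp _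
  filter_upwards [hb.coeFn_toLp, h3] with x hx1 hx2
  rw [hx1, hx2, rdot_eq_inner]

theorem abs_rdot_le (v w : ℂ) : |rdot v w| ≤ ‖v‖ * ‖w‖ := by
  rw [rdot_eq_inner]; exact abs_real_inner_le_norm v w

open Filter Topology Convolution ContinuousLinearMap in
/-- Mollification is weakly continuous in `L²`. -/
theorem tendsto_integral_rdot_convolution {n : ℕ} {b F : Euc n → ℂ} (hb : MemLp b 2)
    (hF : MemLp F 2) {φ : ℕ → ContDiffBump (0 : Euc n)}
    (hφ : Tendsto (fun k => (φ k).rOut) atTop (𝓝 0)) :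
    Tendsto (fun k => ∫ x, rdot (b x) (((φ k).normed volume ⋆[lsmul ℝ ℝ, volume] F) x)) atTop
      (𝓝 (∫ x, rdot (b x) (F x))) := by
  have h1 := ContDiffBump.convolution_tendsto_right_of_continuous (μ := volume) hφ
    (continuous_integral_rdot_translate hb hF) 0
  simp only [add_zero] at h1
  refine h1.congr fun k => ?_
  set ψ := (φ k).normed volume with hψ
  have hψi : Integrable ψ := (φ k).integrable_normed
  have hψc : HasCompactSupport ψ := (φ k).hasCompactSupport_normed
  have hFl : LocallyIntegrable F := hF.locallyIntegrable (by norm_num)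
  have hex : ConvolutionExists ψ F (lsmul ℝ ℝ) volume :=
    hψc.convolutionExists_left _ (φ k).continuous_normed hFl
  have hint : Integrable (fun p : Euc n × Euc n => ψ p.2 * rdot (b p.1) (F (p.1 - p.2)))
      (volume.prod volume) := by
    have e1 : Integrable (fun p : Euc n × Euc n => ‖b p.1‖ ^ 2 * ψ p.2) (volume.prod volume) :=
      ((memLp_two_iff_integrable_sq_norm hb.1).1 hb).mul_prod hψi
    have e2 : Integrable (fun p : Euc n × Euc n => (ψ p.2) * ‖F (p.1 - p.2)‖ ^ 2)
        (volume.prod volume) :=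
      hψi.convolution_integrand (lsmul ℝ ℝ) ((memLp_two_iff_integrable_sq_norm hF.1).1 hF)
    refine (e1.add e2).mono' ?_ (.of_forall fun p => ?_)
    · have m1 : AEStronglyMeasurable (fun p : Euc n × Euc n => ψ p.2 • F (p.1 - p.2))
          (volume.prod volume) :=
        hψi.1.convolution_integrand (lsmul ℝ ℝ) hF.1
      have m2 : AEStronglyMeasurable (fun p : Euc n × Euc n => b p.1) (volume.prod volume) :=
        hb.1.comp_fst
      refine (m2.inner (𝕜 := ℝ) m1).congr (.of_forall fun p => ?_)
      simp only [inner_smul_right, rdot_eq_inner]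
    · have h0 : 0 ≤ ψ p.2 := (φ k).nonneg_normed _
      rw [Real.norm_eq_abs, abs_mul, abs_of_nonneg h0]
      simp only [Pi.add_apply]
      have := abs_rdot_le (b p.1) (F (p.1 - p.2))
      nlinarith [mul_le_mul_of_nonneg_left this h0, mul_nonneg h0
        (sq_nonneg (‖b p.1‖ - ‖F (p.1 - p.2)‖)), mul_nonneg h0 (sq_nonneg ‖b p.1‖),
        mul_nonneg h0 (sq_nonneg ‖F (p.1 - p.2)‖)]
  rw [convolution_def]
  simp only [lsmul_apply, smul_eq_mul, zero_sub, ← sub_eq_add_neg]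
  simp_rw [← integral_const_mul]
  rw [← integral_integral_swap hint]
  refine integral_congr_ae (.of_forall fun x => ?_)
  simp only [rdot_eq_inner, convolution_def, lsmul_apply]
  have := integral_inner (𝕜 := ℝ) (hex x) (b x)
  simp only [lsmul_apply, inner_smul_right] at this
  exact this

open Filter Topology Convolution ContinuousLinearMap in
/-- Mollification commutes with partial derivatives of everywhere differentiable functions with
locally integrable derivative. -/
theorem pd_convolution {n : ℕ} (φ : ContDiffBump (0 : Euc n)) {ζ : Euc n → ℂ}
    (hζ : Differentiable ℝ ζ) {j : Fin n} (hl : LocallyIntegrable (pd ζ j)) (x : Euc n) :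
    pd (φ.normed volume ⋆[lsmul ℝ ℝ, volume] ζ) j x =
      (φ.normed volume ⋆[lsmul ℝ ℝ, volume] (pd ζ j)) x := by
  set ψ := φ.normed volume with hψ
  have hψc : HasCompactSupport ψ := φ.hasCompactSupport_normed
  have hψ1 : ContDiff ℝ 1 ψ := φ.contDiff_normed
  have hζl : LocallyIntegrable ζ := hζ.continuous.locallyIntegrable
  have h1 := hψc.hasFDerivAt_convolution_left (lsmul ℝ ℝ) hψ1 hζl x
  have hex : ConvolutionExists (fderiv ℝ ψ) ζ ((lsmul ℝ ℝ).precompL (Euc n)) volume :=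
    (hψc.fderiv ℝ).convolutionExists_left _ (hψ1.continuous_fderiv one_ne_zero) hζl
  rw [pd, h1.fderiv, convolution_def, ContinuousLinearMap.integral_apply (hex x), convolution_def]
  simp only [precompL_apply, lsmul_apply]
  have hd : ∀ t, HasFDerivAt (fun t => ζ (x - t)) (-(fderiv ℝ ζ (x - t))) t := fun t => by
    have := (hζ (x - t)).hasFDerivAt.comp t ((hasFDerivAt_id t).const_sub x)
    refine this.congr_fderiv ?_
    ext v; simp
  have hψd : ∀ t, HasFDerivAt ψ (fderiv ℝ ψ t) t :=
    fun t => (hψ1.differentiable one_ne_zero t).hasFDerivAt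
  have hc1 : HasCompactSupport fun t => fderiv ℝ ψ t (EuclideanSpace.single j 1) :=
    hψc.fderiv_apply ℝ _
  have i1 : Integrable fun t => (lsmul ℝ ℝ : ℝ →L[ℝ] ℂ →L[ℝ] ℂ)
      (fderiv ℝ ψ t (EuclideanSpace.single j 1)) (ζ (x - t)) :=
    (hc1.convolutionExists_left (lsmul ℝ ℝ)
      ((hψ1.continuous_fderiv one_ne_zero).clm_apply continuous_const) hζl) x
  have i2 : Integrable fun t => (lsmul ℝ ℝ : ℝ →L[ℝ] ℂ →L[ℝ] ℂ) (ψ t)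
      ((-(fderiv ℝ ζ (x - t))) (EuclideanSpace.single j 1)) := by
    have := ((hψc.convolutionExists_left (lsmul ℝ ℝ) hψ1.continuous hl) x).neg
    refine this.congr (.of_forall fun t => ?_)
    simp [pd]
  have i3 : Integrable fun t => (lsmul ℝ ℝ : ℝ →L[ℝ] ℂ →L[ℝ] ℂ) (ψ t) (ζ (x - t)) :=
    (hψc.convolutionExists_left (lsmul ℝ ℝ) hψ1.continuous hζl) x
  have key := integral_bilinear_hasFDerivAt_right_eq_neg_left_of_integrable i1 i2 i3
    (fun t _ => hψd t) (fun t _ => hd t)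
  simp only [lsmul_apply] at key
  have key' := congrArg Neg.neg key
  rw [neg_neg, ← integral_neg] at key'
  rw [← key']
  refine integral_congr_ae (.of_forall fun t => ?_)
  simp [pd]

open Filter Topology Convolution ContinuousLinearMap in
/-- A weak formulation tested against `C¹` functions may be tested against differentiable
functions which are square integrable with their gradient. -/
theorem weak_form_extend {n : ℕ} {b : Fin n → Euc n → ℂ} {c : Euc n → ℂ}
    (hb : ∀ j, MemLp (b j) 2) (hc : MemLp c 2) {R ρ : ℝ} (hρ : ρ < R)
    (hweak : ∀ ζ : Euc n → ℂ, ContDiff ℝ 1 ζ → tsupport ζ ⊆ ball 0 R →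
      ∫ x, ((∑ j, rdot (b j x) (pd ζ j x)) + rdot (c x) (ζ x)) = 0)
    {ζ : Euc n → ℂ} (hζ : Differentiable ℝ ζ) (hs : tsupport ζ ⊆ closedBall 0 ρ)
    (h2 : MemLp ζ 2) (h3 : ∀ j, MemLp (pd ζ j) 2) :
    ∫ x, ((∑ j, rdot (b j x) (pd ζ j x)) + rdot (c x) (ζ x)) = 0 := by
  have hrd : ∀ {f h : Euc n → ℂ}, MemLp f 2 → MemLp h 2 →
      Integrable fun x => rdot (f x) (h x) := by
    intro f h hf hh
    simp only [rdot_eq_inner]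
    refine (L2.integrable_inner (𝕜 := ℝ) (hf.toLp f) (hh.toLp h)).congr ?_
    filter_upwards [hf.coeFn_toLp, hh.coeFn_toLp] with x h1 h2
    rw [h1, h2]
  have hsplit : ∀ {f : Fin n → Euc n → ℂ} {h : Euc n → ℂ}, (∀ j, MemLp (f j) 2) → MemLp h 2 →
      ∫ x, ((∑ j, rdot (b j x) (f j x)) + rdot (c x) (h x)) =
        (∑ j, ∫ x, rdot (b j x) (f j x)) + ∫ x, rdot (c x) (h x) := by
    intro f h hf hh
    rw [integral_add (integrable_finsetSum _ fun j _ => hrd (hb j) (hf j)) (hrd hc hh),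
      integral_finsetSum _ fun j _ => hrd (hb j) (hf j)]
  set r : ℕ → ℝ := fun k => (R - ρ) / 2 / ((k : ℝ) + 1) with hr
  have hr0 : ∀ k, 0 < r k := fun k => by
    have : 0 < R - ρ := by linarith
    positivity
  have hrlt : ∀ k, r k < R - ρ := fun k => by
    have h0 : 0 < R - ρ := by linarith
    have h1 : r k ≤ (R - ρ) / 2 := div_le_self (by linarith) (by linarith [k.cast_nonneg (α := ℝ)])
    linarith
  set φ : ℕ → ContDiffBump (0 : Euc n) := fun k =>
    ⟨r k / 2, r k, by linarith [hr0 k], by linarith [hr0 k]⟩ with hφd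
  have hφ : Tendsto (fun k => (φ k).rOut) atTop (𝓝 0) := by
    simpa [hφd, hr, div_eq_mul_inv] using
      (tendsto_one_div_add_atTop_nhds_zero_nat (𝕜 := ℝ)).const_mul ((R - ρ) / 2)
  have hlim : Tendsto (fun k => (∑ j, ∫ x, rdot (b j x)
      (((φ k).normed volume ⋆[lsmul ℝ ℝ, volume] (pd ζ j)) x)) +
      ∫ x, rdot (c x) (((φ k).normed volume ⋆[lsmul ℝ ℝ, volume] ζ) x)) atTop
      (𝓝 ((∑ j, ∫ x, rdot (b j x) (pd ζ j x)) + ∫ x, rdot (c x) (ζ x))) :=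
    (tendsto_finsetSum _ fun j _ => tendsto_integral_rdot_convolution (hb j) (h3 j) hφ).add
      (tendsto_integral_rdot_convolution hc h2 hφ)
  rw [hsplit h3 h2]
  refine tendsto_nhds_unique hlim (tendsto_const_nhds.congr fun k => ?_)
  set ψ := (φ k).normed volume with hψ
  have hψc : HasCompactSupport ψ := (φ k).hasCompactSupport_normed
  have hζl : LocallyIntegrable ζ := hζ.continuous.locallyIntegrable
  set ζk : Euc n → ℂ := ψ ⋆[lsmul ℝ ℝ, volume] ζ with hζk
  have hpd : ∀ j, pd ζk j = ψ ⋆[lsmul ℝ ℝ, volume] (pd ζ j) := fun j =>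
    funext fun x => pd_convolution (φ k) hζ ((h3 j).locallyIntegrable (by norm_num)) x
  have hk1 : ContDiff ℝ 1 ζk :=
    hψc.contDiff_convolution_left (n := 1) _ (φ k).contDiff_normed hζl
  have hksupp : tsupport ζk ⊆ closedBall 0 (ρ + r k) := by
    refine closure_minimal (fun x hx => ?_) isClosed_closedBall
    obtain ⟨y, hy, z, hz, rfl⟩ := Set.mem_add.1 (support_convolution_subset (lsmul ℝ ℝ) hx)
    have hy' : ‖y‖ < r k := by
      rw [(φ k).support_normed_eq] at hy
      simpa using hy
    have hz' : ‖z‖ ≤ ρ := by simpa using hs (subset_tsupport _ hz)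
    rw [mem_closedBall_zero_iff]
    linarith [norm_add_le y z]
  have hkc : HasCompactSupport ζk :=
    HasCompactSupport.of_support_subset_isCompact (isCompact_closedBall 0 (ρ + r k))
      ((subset_tsupport _).trans hksupp)
  have hw := hweak ζk hk1 (hksupp.trans (closedBall_subset_ball (by linarith [hrlt k])))
  have m1 : MemLp ζk 2 := hk1.continuous.memLp_of_hasCompactSupport hkc
  have m2 : ∀ j, MemLp (pd ζk j) 2 := fun j =>
    ((hk1.continuous_fderiv one_ne_zero).clm_apply continuous_const).memLp_of_hasCompactSupport
      (hkc.fderiv_apply ℝ _)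
  rw [hsplit m2 m1] at hw
  rw [← hw]
  simp only [hpd]

/-- The symmetric matrices with spectrum in `[lam, lam⁻¹]`. -/
def ellMat (n : ℕ) (lam : ℝ) : Set (Fin n → Fin n → ℝ) :=
  {m | (∀ i j, m i j = m j i) ∧ ∀ ξ : Fin n → ℝ,
    lam * ∑ i, ξ i ^ 2 ≤ ∑ i, ∑ j, m i j * ξ i * ξ j ∧
    ∑ i, ∑ j, m i j * ξ i * ξ j ≤ lam⁻¹ * ∑ i, ξ i ^ 2}

theorem isClosed_ellMat (n : ℕ) (lam : ℝ) : IsClosed (ellMat n lam) := by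
  simp only [ellMat, Set.ofPred_and, Set.ofPred_forall]
  refine IsClosed.inter ?_ (isClosed_iInter fun ξ => IsClosed.inter ?_ ?_)
  · exact isClosed_iInter fun i => isClosed_iInter fun j =>
      isClosed_eq (by fun_prop) (by fun_prop)
  · exact isClosed_le (by fun_prop) (by fun_prop)
  · exact isClosed_le (by fun_prop) (by fun_prop)

theorem abs_entry_le_of_mem_ellMat {n : ℕ} {lam : ℝ} (hlam : 0 < lam) {m : Fin n → Fin n → ℝ}
    (hm : m ∈ ellMat n lam) (i j : Fin n) : |m i j| ≤ 2 * lam⁻¹ := by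
  have hl : 0 < lam⁻¹ := inv_pos.2 hlam
  have key : ∀ s : ℝ, ∑ k, ∑ l, m k l * (Pi.single i 1 + s • Pi.single j 1 : Fin n → ℝ) k *
      (Pi.single i 1 + s • Pi.single j 1 : Fin n → ℝ) l =
      m i i + 2 * s * m i j + s ^ 2 * m j j := by
    intro s
    simp only [Pi.add_apply, Pi.smul_apply, smul_eq_mul, mul_add, add_mul, Finset.sum_add_distrib,
      Pi.single_apply, mul_ite, ite_mul, mul_one, mul_zero, zero_mul, Finset.sum_ite_eq',
      Finset.mem_univ, if_true]
    rw [hm.1 j i]; ring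
  have hn : ∀ s : ℝ, s ^ 2 = 1 →
      ∑ k, (Pi.single i 1 + s • Pi.single j 1 : Fin n → ℝ) k ^ 2 ≤ 4 := by
    intro s hs
    calc ∑ k, (Pi.single i 1 + s • Pi.single j 1 : Fin n → ℝ) k ^ 2
        ≤ ∑ k, (2 * (Pi.single i 1 : Fin n → ℝ) k + 2 * (Pi.single j 1 : Fin n → ℝ) k) := by
          refine Finset.sum_le_sum fun k _ => ?_
          simp only [Pi.add_apply, Pi.smul_apply, smul_eq_mul, Pi.single_apply]
          split_ifs <;> nlinarith [sq_nonneg (s - 1)]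
      _ = 4 := by
          simp [Finset.sum_add_distrib, ← Finset.mul_sum]; norm_num
  have h1 := (hm.2 (Pi.single i 1 + (1 : ℝ) • Pi.single j 1))
  have h2 := (hm.2 (Pi.single i 1 + (-1 : ℝ) • Pi.single j 1))
  have p1 := hn 1 (by norm_num)
  have p2 := hn (-1) (by norm_num)
  have q : ∀ s : ℝ, 0 ≤ ∑ k, (Pi.single i 1 + s • Pi.single j 1 : Fin n → ℝ) k ^ 2 :=
    fun s => Finset.sum_nonneg fun k _ => sq_nonneg _
  rw [key] at h1 h2
  have r1 := mul_le_mul_of_nonneg_left p1 hl.le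
  have r2 := mul_le_mul_of_nonneg_left p2 hl.le
  have r3 := mul_nonneg hlam.le (q 1)
  have r4 := mul_nonneg hlam.le (q (-1))
  rw [abs_le]
  constructor <;> linarith

theorem isCompact_ellMat (n : ℕ) {lam : ℝ} (hlam : 0 < lam) : IsCompact (ellMat n lam) := by
  refine Metric.isCompact_of_isClosed_isBounded (isClosed_ellMat n lam)
    ((isBounded_closedBall (x := (0 : Fin n → Fin n → ℝ)) (r := 2 * lam⁻¹)).subset fun m hm => ?_)
  have : 0 < lam⁻¹ := inv_pos.2 hlam
  rw [mem_closedBall_zero_iff, pi_norm_le_iff_of_nonneg (by positivity)]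
  refine fun i => (pi_norm_le_iff_of_nonneg (by positivity)).2 fun j => ?_
  exact abs_entry_le_of_mem_ellMat hlam hm i j

theorem posDef_of_mem_ellMat {n : ℕ} {lam : ℝ} (hlam : 0 < lam) {m : Fin n → Fin n → ℝ}
    (hm : m ∈ ellMat n lam) : (Matrix.of m).PosDef := by
  refine Matrix.PosDef.of_dotProduct_mulVec_pos (Matrix.ext fun i j => ?_) fun ξ hξ => ?_
  · simpa using hm.1 j i
  · have h1 : 0 < ∑ i, ξ i ^ 2 := by
      obtain ⟨i, hi⟩ := Function.ne_iff.1 hξ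
      exact Finset.sum_pos' (fun i _ => sq_nonneg _) ⟨i, Finset.mem_univ i, pow_pos_of_ne hi⟩
    have h2 := (hm.2 ξ).1
    refine lt_of_lt_of_le (mul_pos hlam h1) (h2.trans_eq ?_)
    simp only [dotProduct, Matrix.mulVec, Finset.mul_sum, Matrix.of_apply, star_trivial]
    exact Finset.sum_congr rfl fun i _ => Finset.sum_congr rfl fun j _ => by ring
  where pow_pos_of_ne {a : ℝ} (h : a ≠ 0) : 0 < a ^ 2 := by positivity

theorem contDiff_det_of {n : ℕ} : ContDiff ℝ 1 fun m : Fin n → Fin n → ℝ => (Matrix.of m).det := by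
  simp only [Matrix.det_apply', Matrix.of_apply]
  refine ContDiff.sum fun σ _ => contDiff_const.mul (contDiff_prod fun i _ => by fun_prop)

theorem contDiff_adjugate_of {n : ℕ} (i j : Fin n) :
    ContDiff ℝ 1 fun m : Fin n → Fin n → ℝ => (Matrix.of m).adjugate i j := by
  simp only [Matrix.adjugate_apply, Matrix.det_apply', Matrix.updateRow_apply]
  refine ContDiff.sum fun σ _ => contDiff_const.mul (contDiff_prod fun k _ => ?_)
  split_ifs
  · exact contDiff_const
  · simp only [Matrix.of_apply]; fun_prop

theorem contDiffAt_sqrt_det_of {n : ℕ} {lam : ℝ} (hlam : 0 < lam) {m : Fin n → Fin n → ℝ}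
    (hm : m ∈ ellMat n lam) :
    ContDiffAt ℝ 1 (fun m : Fin n → Fin n → ℝ => √(Matrix.of m).det) m :=
  contDiff_det_of.contDiffAt.sqrt (posDef_of_mem_ellMat hlam hm).det_pos.ne'

theorem contDiffAt_inv_of {n : ℕ} {lam : ℝ} (hlam : 0 < lam) {m : Fin n → Fin n → ℝ}
    (hm : m ∈ ellMat n lam) (i j : Fin n) :
    ContDiffAt ℝ 1 (fun m : Fin n → Fin n → ℝ => (Matrix.of m)⁻¹ i j) m := by
  simp only [Matrix.inv_def, Ring.inverse_eq_inv', Matrix.smul_apply, smul_eq_mul]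
  exact (contDiff_det_of.contDiffAt.inv (posDef_of_mem_ellMat hlam hm).det_pos.ne').mul
    (contDiff_adjugate_of i j).contDiffAt

theorem exists_lipschitz_bound_of_contDiffAt {n : ℕ} {lam : ℝ} (hlam : 0 < lam)
    {f : (Fin n → Fin n → ℝ) → ℝ} (hf : ∀ m ∈ ellMat n lam, ContDiffAt ℝ 1 f m) :
    ∃ K : ℝ, 0 ≤ K ∧ (∀ m ∈ ellMat n lam, |f m| ≤ K) ∧
      ∀ m ∈ ellMat n lam, ∀ m' ∈ ellMat n lam, |f m - f m'| ≤ K * dist m m' := by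
  have hl : LocallyLipschitzOn (ellMat n lam) f := fun m hm => by
    obtain ⟨K, t, ht, h⟩ := (hf m hm).exists_lipschitzOnWith
    exact ⟨K, t, mem_nhdsWithin_of_mem_nhds ht, h⟩
  obtain ⟨K, hK⟩ := hl.exists_lipschitzOnWith_of_compact (isCompact_ellMat n hlam)
  obtain ⟨K', hK'⟩ := (isCompact_ellMat n hlam).exists_bound_of_continuousOn hl.continuousOn
  refine ⟨max K K', le_max_of_le_left K.2, fun m hm => (hK' m hm).trans (le_max_right _ _),
    fun m hm m' hm' => ?_⟩
  refine (hK.dist_le_mul m hm m' hm').trans ?_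
  gcongr
  exact le_max_left _ _

/-- The bilinear form on differentials `Euc n →L[ℝ] ℂ` with coefficient matrix `a`. -/
def qf {n : ℕ} (a : Matrix (Fin n) (Fin n) ℝ) (L L' : Euc n →L[ℝ] ℂ) : ℝ :=
  ∑ i, ∑ j, a i j * rdot (L (EuclideanSpace.single i 1)) (L' (EuclideanSpace.single j 1))

/-- Uniform ellipticity, boundedness and Lipschitz continuity of the coefficients `a`, `w` of the
energy on the unit ball. -/
structure Coeff {n : ℕ} (c₀ C₀ : ℝ) (a : Euc n → Matrix (Fin n) (Fin n) ℝ) (w : Euc n → ℝ) :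
    Prop where
  pos : 0 < c₀
  pos' : 0 < C₀
  symm : ∀ x ∈ ball (0 : Euc n) 1, (a x).IsSymm
  lower : ∀ x ∈ ball (0 : Euc n) 1, ∀ L, c₀ * ‖L‖ ^ 2 ≤ qf (a x) L L
  upper : ∀ x ∈ ball (0 : Euc n) 1, ∀ L L', |qf (a x) L L'| ≤ C₀ * ‖L‖ * ‖L'‖
  lip : ∀ x ∈ ball (0 : Euc n) 1, ∀ y ∈ ball (0 : Euc n) 1, ∀ L,
    |qf (a x) L L - qf (a y) L L| ≤ C₀ * ‖x - y‖ * ‖L‖ ^ 2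
  cont : ∀ i j, ContinuousOn (fun x => a x i j) (ball (0 : Euc n) 1)
  bound : ∀ x ∈ ball (0 : Euc n) 1, ∀ i j, |a x i j| ≤ C₀
  w_lower : ∀ x ∈ ball (0 : Euc n) 1, c₀ ≤ w x
  w_upper : ∀ x ∈ ball (0 : Euc n) 1, w x ≤ C₀
  w_lip : ∀ x ∈ ball (0 : Euc n) 1, ∀ y ∈ ball (0 : Euc n) 1, |w x - w y| ≤ C₀ * ‖x - y‖

theorem norm_single_apply_le {n : ℕ} (L : Euc n →L[ℝ] ℂ) (i : Fin n) :
    ‖L (EuclideanSpace.single i 1)‖ ≤ ‖L‖ := by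
  simpa using L.le_opNorm (EuclideanSpace.single i (1 : ℝ))

theorem eq_sum_single {n : ℕ} (v : Euc n) :
    v = ∑ i, v i • EuclideanSpace.single i (1 : ℝ) := by
  ext j
  simp [Pi.single_apply]

theorem norm_sq_le_sum {n : ℕ} (L : Euc n →L[ℝ] ℂ) :
    ‖L‖ ^ 2 ≤ ∑ i, ‖L (EuclideanSpace.single i 1)‖ ^ 2 := by
  have h0 : (0 : ℝ) ≤ ∑ i, ‖L (EuclideanSpace.single i 1)‖ ^ 2 := by positivity
  rw [← Real.le_sqrt (norm_nonneg _) h0]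
  refine L.opNorm_le_bound (Real.sqrt_nonneg _) fun v => ?_
  have h1 : ‖L v‖ ≤ ∑ i, ‖L (EuclideanSpace.single i 1)‖ * |v i| := by
    conv_lhs => rw [eq_sum_single v]
    rw [map_sum]
    refine (norm_sum_le _ _).trans (Finset.sum_le_sum fun i _ => ?_)
    rw [map_smul, norm_smul, mul_comm, Real.norm_eq_abs]
  refine h1.trans ((Real.sum_mul_le_sqrt_mul_sqrt _ _ _).trans_eq ?_)
  rw [EuclideanSpace.norm_eq]; simp

theorem gradSq_eq_qf {n : ℕ} (g : Euc n → Matrix (Fin n) (Fin n) ℝ) (u : Euc n → ℂ) (x : Euc n) :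
    gradSq g u x = qf (g x)⁻¹ (fderiv ℝ u x) (fderiv ℝ u x) := rfl

theorem qf_smul {n : ℕ} (s : ℝ) (a : Matrix (Fin n) (Fin n) ℝ) (L L' : Euc n →L[ℝ] ℂ) :
    qf (s • a) L L' = s * qf a L L' := by
  simp [qf, Finset.mul_sum, mul_assoc]

theorem abs_qf_le {n : ℕ} {a : Matrix (Fin n) (Fin n) ℝ} {K : ℝ} (ha : ∀ i j, |a i j| ≤ K)
    (L L' : Euc n →L[ℝ] ℂ) : |qf a L L'| ≤ n * n * K * ‖L‖ * ‖L'‖ := by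
  refine (Finset.abs_sum_le_sum_abs _ _).trans ((Finset.sum_le_sum fun i _ =>
    (Finset.abs_sum_le_sum_abs _ _).trans (Finset.sum_le_sum fun j _ =>
      show _ ≤ K * (‖L‖ * ‖L'‖) from ?_)).trans_eq ?_)
  · rw [abs_mul]
    exact mul_le_mul (ha i j) ((abs_rdot_le _ _).trans (mul_le_mul (norm_single_apply_le L i)
      (norm_single_apply_le L' j) (norm_nonneg _) (norm_nonneg _))) (abs_nonneg _)
      ((abs_nonneg _).trans (ha i j))
  · simp; ring

theorem dotProduct_inv_ge {n : ℕ} {lam : ℝ} (hlam : 0 < lam) {m : Fin n → Fin n → ℝ}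
    (hm : m ∈ ellMat n lam) (ξ : Fin n → ℝ) :
    lam * ∑ i, ξ i ^ 2 ≤ ∑ i, ∑ j, (Matrix.of m)⁻¹ i j * ξ i * ξ j := by
  have hP := posDef_of_mem_ellMat hlam hm
  set A := Matrix.of m with hA
  have hsymm : A.transpose = A := by ext i j; exact hm.1 j i
  set y := A⁻¹.mulVec ξ with hy
  have hAy : A.mulVec y = ξ := by
    rw [hy, Matrix.mulVec_mulVec, Matrix.mul_nonsing_inv _ hP.det_pos.ne'.isUnit,
      Matrix.one_mulVec]
  have h0 : 0 ≤ (lam • ξ - y) ⬝ᵥ A.mulVec (lam • ξ - y) := by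
    simpa using hP.posSemidef.dotProduct_mulVec_nonneg (lam • ξ - y)
  have h1 : y ⬝ᵥ A.mulVec ξ = ξ ⬝ᵥ ξ := by
    rw [Matrix.dotProduct_mulVec, ← Matrix.mulVec_transpose, hsymm, hAy]
  have h2 : ξ ⬝ᵥ A.mulVec ξ ≤ lam⁻¹ * ∑ i, ξ i ^ 2 := by
    refine le_trans (le_of_eq ?_) (hm.2 ξ).2
    simp only [dotProduct, Matrix.mulVec, Finset.mul_sum]
    exact Finset.sum_congr rfl fun i _ => Finset.sum_congr rfl fun j _ => by
      rw [hA, Matrix.of_apply]; ring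
  have h3 : ξ ⬝ᵥ y = ∑ i, ∑ j, A⁻¹ i j * ξ i * ξ j := by
    simp only [hy, dotProduct, Matrix.mulVec, Finset.mul_sum]
    exact Finset.sum_congr rfl fun i _ => Finset.sum_congr rfl fun j _ => by ring
  have h4 : ξ ⬝ᵥ ξ = ∑ i, ξ i ^ 2 := by simp [dotProduct, sq]
  rw [Matrix.mulVec_sub, Matrix.mulVec_smul, hAy, sub_dotProduct, dotProduct_sub, dotProduct_sub,
    smul_dotProduct, smul_dotProduct, dotProduct_smul, dotProduct_smul, h1, h4,
    dotProduct_comm y, h3] at h0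
  simp only [smul_eq_mul] at h0
  have h5 : lam * (lam * (ξ ⬝ᵥ A.mulVec ξ)) ≤ lam * ∑ i, ξ i ^ 2 := by
    refine mul_le_mul_of_nonneg_left ?_ hlam.le
    calc _ ≤ lam * (lam⁻¹ * ∑ i, ξ i ^ 2) := mul_le_mul_of_nonneg_left h2 hlam.le
      _ = _ := by field_simp
  linarith

theorem qf_inv_ge {n : ℕ} {lam : ℝ} (hlam : 0 < lam) {m : Fin n → Fin n → ℝ}
    (hm : m ∈ ellMat n lam) (L : Euc n →L[ℝ] ℂ) :
    lam * ‖L‖ ^ 2 ≤ qf (Matrix.of m)⁻¹ L L := by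
  have h1 := dotProduct_inv_ge hlam hm fun i => (L (EuclideanSpace.single i 1)).re
  have h2 := dotProduct_inv_ge hlam hm fun i => (L (EuclideanSpace.single i 1)).im
  calc lam * ‖L‖ ^ 2 ≤ lam * ∑ i, ‖L (EuclideanSpace.single i 1)‖ ^ 2 :=
        mul_le_mul_of_nonneg_left (norm_sq_le_sum L) hlam.le
    _ = lam * ∑ i, (L (EuclideanSpace.single i 1)).re ^ 2 +
        lam * ∑ i, (L (EuclideanSpace.single i 1)).im ^ 2 := by
      rw [← mul_add, ← Finset.sum_add_distrib]
      congr 1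
      refine Finset.sum_congr rfl fun i _ => ?_
      rw [Complex.sq_norm, Complex.normSq_apply]; ring
    _ ≤ _ := add_le_add h1 h2
    _ = _ := by
      simp only [qf, ← Finset.sum_add_distrib]
      exact Finset.sum_congr rfl fun i _ => Finset.sum_congr rfl fun j _ => by
        rw [rdot]; ring

theorem MemM.mem_ellMat {n : ℕ} {lam Lam : ℝ} {g : Euc n → Matrix (Fin n) (Fin n) ℝ}
    (hg : MemM n lam Lam g) {x : Euc n} (hx : x ∈ ball (0 : Euc n) 1) :
    (fun i j => g x i j) ∈ ellMat n lam :=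
  ⟨fun i j => (hg.2.1 x hx).1.apply j i, fun ξ => hg.2.2.2 x hx ξ⟩

theorem MemM.dist_le {n : ℕ} {lam Lam : ℝ} (hLam : 0 < Lam)
    {g : Euc n → Matrix (Fin n) (Fin n) ℝ}
    (hg : MemM n lam Lam g) {x y : Euc n} (hx : x ∈ ball (0 : Euc n) 1)
    (hy : y ∈ ball (0 : Euc n) 1) :
    dist (fun i j => g x i j) (fun i j => g y i j) ≤ Lam * ‖x - y‖ := by
  refine (dist_pi_le_iff (by positivity)).2 fun i => (dist_pi_le_iff (by positivity)).2 fun j => ?_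
  have := (hg.2.2.1 i j).dist_le_mul x hx y hy
  rwa [Real.coe_toNNReal _ hLam.le, dist_eq_norm x y] at this

theorem exists_coeff (n : ℕ) {lam Lam : ℝ} (hlam : 0 < lam) (hLam : 0 < Lam) :
    ∃ c₀ C₀ : ℝ, 0 < c₀ ∧ 0 < C₀ ∧ ∀ g : Euc n → Matrix (Fin n) (Fin n) ℝ, MemM n lam Lam g →
      Coeff c₀ C₀ (fun x => sqrtDet g x • (g x)⁻¹) (sqrtDet g) ∧
      ∀ x ∈ ball (0 : Euc n) 1,
        ‖(WithLp.toLp 2 ((g x)⁻¹.mulVec x) : Euc n) - x‖ ≤ C₀ * ‖x‖ ^ 2 := by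
  choose Ki hKi0 hKi1 hKi2 using fun i j : Fin n => exists_lipschitz_bound_of_contDiffAt hlam
    fun m hm => contDiffAt_inv_of hlam hm i j
  choose Ka hKa0 hKa1 hKa2 using fun i j : Fin n => exists_lipschitz_bound_of_contDiffAt hlam
    fun m hm => (contDiffAt_sqrt_det_of hlam hm).mul (contDiffAt_inv_of hlam hm i j)
  obtain ⟨Kw, hKw0, hKw1, hKw2⟩ := exists_lipschitz_bound_of_contDiffAt hlam
    fun m hm => contDiffAt_sqrt_det_of (n := n) hlam hm
  obtain ⟨δ, hδ0, hδ⟩ : ∃ δ > 0, ∀ m ∈ ellMat n lam, δ ≤ √(Matrix.of m).det := by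
    rcases (ellMat n lam).eq_empty_or_nonempty with h | h
    · exact ⟨1, one_pos, by simp [h]⟩
    · obtain ⟨m, hm, hmin⟩ := (isCompact_ellMat n hlam).exists_isMinOn h fun m hm =>
        (contDiffAt_sqrt_det_of hlam hm).continuousAt.continuousWithinAt
      exact ⟨_, Real.sqrt_pos.2 (posDef_of_mem_ellMat hlam hm).det_pos, fun m' hm' => hmin hm'⟩
  set Si := ∑ i, ∑ j, Ki i j with hSi
  set Sa := ∑ i, ∑ j, Ka i j with hSa
  have lei : ∀ i j, Ki i j ≤ Si := fun i j =>
    (Finset.single_le_sum (fun j _ => hKi0 i j) (Finset.mem_univ j)).trans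
      (Finset.single_le_sum (f := fun i => ∑ j, Ki i j)
        (fun i _ => Finset.sum_nonneg fun j _ => hKi0 i j) (Finset.mem_univ i))
  have lea : ∀ i j, Ka i j ≤ Sa := fun i j =>
    (Finset.single_le_sum (fun j _ => hKa0 i j) (Finset.mem_univ j)).trans
      (Finset.single_le_sum (f := fun i => ∑ j, Ka i j)
        (fun i _ => Finset.sum_nonneg fun j _ => hKa0 i j) (Finset.mem_univ i))
  have Si0 : 0 ≤ Si := Finset.sum_nonneg fun i _ => Finset.sum_nonneg fun j _ => hKi0 i j
  have Sa0 : 0 ≤ Sa := Finset.sum_nonneg fun i _ => Finset.sum_nonneg fun j _ => hKa0 i j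
  set C₀ := n * n * Si * Lam + n * n * Sa + n * n * (Sa * Lam) + Sa + Kw + Kw * Lam + 1 with hC
  have t1 : 0 ≤ n * n * Si * Lam := by positivity
  have t2 : 0 ≤ n * n * Sa := by positivity
  have t3 : 0 ≤ n * n * (Sa * Lam) := by positivity
  have t4 : 0 ≤ Kw * Lam := by positivity
  have hC0 : 0 < C₀ := by positivity
  refine ⟨min δ (δ * lam), C₀, by positivity, hC0, fun g hg => ?_⟩
  have hab : ∀ x ∈ ball (0 : Euc n) 1, ∀ i j, |(sqrtDet g x • (g x)⁻¹) i j| ≤ Sa := fun x hx i j =>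
    (hKa1 i j _ (hg.mem_ellMat hx)).trans (lea i j)
  have hal : ∀ x ∈ ball (0 : Euc n) 1, ∀ y ∈ ball (0 : Euc n) 1, ∀ i j,
      |(sqrtDet g x • (g x)⁻¹ - sqrtDet g y • (g y)⁻¹) i j| ≤ Sa * (Lam * ‖x - y‖) :=
    fun x hx y hy i j => (hKa2 i j _ (hg.mem_ellMat hx) _ (hg.mem_ellMat hy)).trans
      (mul_le_mul (lea i j) (hg.dist_le hLam hx hy) dist_nonneg Sa0)
  have hwl : ∀ x ∈ ball (0 : Euc n) 1, δ ≤ sqrtDet g x := fun x hx => hδ _ (hg.mem_ellMat hx)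
  refine ⟨⟨by positivity, hC0, fun x hx => ?_, fun x hx L => ?_, fun x hx L L' => ?_,
    fun x hx y hy L => ?_, fun i j => ?_, fun x hx i j => (hab x hx i j).trans (by linarith),
    fun x hx => (min_le_left _ _).trans (hwl x hx),
    fun x hx => ((le_abs_self _).trans (hKw1 _ (hg.mem_ellMat hx))).trans (by linarith),
    fun x hx y hy => ?_⟩, fun x hx => ?_⟩
  · have := (hg.2.1 x hx).1
    rw [Matrix.IsSymm, Matrix.transpose_smul, Matrix.transpose_nonsing_inv, this.eq]
  · rw [qf_smul]
    calc min δ (δ * lam) * ‖L‖ ^ 2 ≤ δ * lam * ‖L‖ ^ 2 := by gcongr; exact min_le_right _ _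
      _ = δ * (lam * ‖L‖ ^ 2) := by ring
      _ ≤ _ := mul_le_mul (hwl x hx) (qf_inv_ge hlam (hg.mem_ellMat hx) L) (by positivity)
        (hδ0.le.trans (hwl x hx))
  · refine (abs_qf_le (hab x hx) L L').trans ?_
    gcongr
    linarith
  · have e : qf (sqrtDet g x • (g x)⁻¹) L L - qf (sqrtDet g y • (g y)⁻¹) L L =
        qf (sqrtDet g x • (g x)⁻¹ - sqrtDet g y • (g y)⁻¹) L L := by
      simp only [qf, ← Finset.sum_sub_distrib]
      exact Finset.sum_congr rfl fun i _ => Finset.sum_congr rfl fun j _ => by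
        rw [Matrix.sub_apply]; ring
    rw [e]
    refine (abs_qf_le (hal x hx y hy) L L).trans ?_
    calc _ = n * n * (Sa * Lam) * (‖x - y‖ * ‖L‖ ^ 2) := by ring
      _ ≤ C₀ * (‖x - y‖ * ‖L‖ ^ 2) := by gcongr; linarith
      _ = _ := by ring
  · refine LipschitzOnWith.continuousOn (K := Real.toNNReal (Sa * Lam))
      (LipschitzOnWith.of_dist_le_mul fun x hx y hy => ?_)
    rw [Real.coe_toNNReal _ (by positivity), Real.dist_eq, dist_eq_norm, mul_assoc]
    exact hal x hx y hy i j
  · refine (hKw2 _ (hg.mem_ellMat hx) _ (hg.mem_ellMat hy)).trans ?_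
    calc _ ≤ Kw * (Lam * ‖x - y‖) := by gcongr; exact hg.dist_le hLam hx hy
      _ = Kw * Lam * ‖x - y‖ := by ring
      _ ≤ _ := by gcongr; linarith
  · have h0 : (0 : Euc n) ∈ ball (0 : Euc n) 1 := mem_ball_self one_pos
    have hd : ∀ i j, |((g x)⁻¹ - 1) i j| ≤ Si * (Lam * ‖x‖) := fun i j => by
      have h1 := hKi2 i j _ (hg.mem_ellMat hx) _ (hg.mem_ellMat h0)
      have h2 := hg.dist_le hLam hx h0
      have h3 : (Matrix.of fun i j => g 0 i j)⁻¹ i j = (1 : Matrix (Fin n) (Fin n) ℝ) i j := by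
        rw [show (Matrix.of fun i j => g 0 i j) = 1 from hg.1, inv_one]
      rw [sub_zero] at h2
      rw [h3] at h1
      exact h1.trans (mul_le_mul (lei i j) h2 dist_nonneg Si0)
    have e : (WithLp.toLp 2 ((g x)⁻¹.mulVec x) : Euc n) - x =
        WithLp.toLp 2 (((g x)⁻¹ - 1).mulVec x) := by
      ext i; simp [Matrix.sub_mulVec]
    rw [e]
    have hx1 : ∀ j, |x j| ≤ ‖x‖ := fun j => by
      simpa using PiLp.norm_apply_le x j
    have hcomp : ∀ i, |(((g x)⁻¹ - 1).mulVec x) i| ≤ n * (Si * (Lam * ‖x‖) * ‖x‖) := fun i => by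
      rw [Matrix.mulVec, dotProduct]
      refine (Finset.abs_sum_le_sum_abs _ _).trans ((Finset.sum_le_card_nsmul _ _
        (Si * (Lam * ‖x‖) * ‖x‖) fun j _ => ?_).trans_eq (by simp))
      rw [abs_mul]
      exact mul_le_mul (hd i j) (hx1 j) (abs_nonneg _) (by positivity)
    rw [eq_sum_single (WithLp.toLp 2 (((g x)⁻¹ - 1).mulVec x) : Euc n)]
    refine (norm_sum_le _ _).trans ((Finset.sum_le_card_nsmul _ _
      (n * (Si * (Lam * ‖x‖) * ‖x‖)) fun i _ => ?_).trans ?_)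
    · rw [norm_smul]; simpa using hcomp i
    · simp only [Finset.card_univ, Fintype.card_fin, nsmul_eq_mul]
      calc _ = n * n * Si * Lam * ‖x‖ ^ 2 := by ring
        _ ≤ _ := by gcongr; linarith

/-- A weak solution with abstract coefficients `a`, `w` in place of `√(det g) g⁻¹`, `√(det g)`. -/
structure WeakSol {n : ℕ} (c₀ C₀ ε : ℝ) (a : Euc n → Matrix (Fin n) (Fin n) ℝ) (w : Euc n → ℝ)
    (u : Euc n → ℂ) : Prop where
  coeff : Coeff c₀ C₀ a w
  eps_pos : 0 < ε
  diff : DifferentiableOn ℝ u (ball 0 1)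
  le_one : ∀ x ∈ ball (0 : Euc n) 1, ‖u x‖ ≤ 1
  memLp : MemLp (fderiv ℝ u) 2 (volume.restrict (ball 0 1))
  weak : ∀ ζ : Euc n → ℂ, ContDiff ℝ 1 ζ → tsupport ζ ⊆ ball (0 : Euc n) 1 →
    ∫ x in ball (0 : Euc n) 1, (qf (a x) (fderiv ℝ u x) (fderiv ℝ ζ x) -
      (1 - ‖u x‖ ^ 2) / ε ^ 2 * rdot (u x) (ζ x) * w x) = 0

theorem Coeff.w_continuousOn {n : ℕ} {c₀ C₀ : ℝ} {a : Euc n → Matrix (Fin n) (Fin n) ℝ}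
    {w : Euc n → ℝ} (h : Coeff c₀ C₀ a w) : ContinuousOn w (ball 0 1) := by
  refine LipschitzOnWith.continuousOn (K := Real.toNNReal C₀)
    (LipschitzOnWith.of_dist_le_mul fun x hx y hy => ?_)
  rw [Real.coe_toNNReal _ h.pos'.le, Real.dist_eq, dist_eq_norm]
  exact h.w_lip x hx y hy

theorem rdot_smul_left (s : ℝ) (v z : ℂ) : rdot ((s : ℂ) * v) z = s * rdot v z := by
  simp [rdot]; ring

theorem rdot_sum_left {ι : Type*} (s : Finset ι) (f : ι → ℂ) (z : ℂ) :
    rdot (∑ i ∈ s, f i) z = ∑ i ∈ s, rdot (f i) z := by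
  simp [rdot, Finset.sum_mul, Finset.sum_add_distrib]

theorem qf_eq_sum_rdot {n : ℕ} (a : Matrix (Fin n) (Fin n) ℝ) (L L' : Euc n →L[ℝ] ℂ) :
    qf a L L' = ∑ j, rdot (∑ i, (a i j : ℂ) * L (EuclideanSpace.single i 1))
      (L' (EuclideanSpace.single j 1)) := by
  rw [qf, Finset.sum_comm]
  simp only [rdot_sum_left, rdot_smul_left]

theorem abs_one_sub_norm_sq_le {z : ℂ} (h : ‖z‖ ≤ 1) : |1 - ‖z‖ ^ 2| ≤ 1 := by
  rw [abs_le]; constructor <;> nlinarith [norm_nonneg z]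

theorem WeakSol.weak_of_differentiable {n : ℕ} {c₀ C₀ ε : ℝ}
    {a : Euc n → Matrix (Fin n) (Fin n) ℝ} {w : Euc n → ℝ} {u : Euc n → ℂ}
    (h : WeakSol c₀ C₀ ε a w u) {ρ : ℝ} (hρ : ρ < 1) {ζ : Euc n → ℂ} (hζ : Differentiable ℝ ζ)
    (hs : tsupport ζ ⊆ closedBall 0 ρ) (h3 : MemLp (fderiv ℝ ζ) 2) :
    ∫ x in ball (0 : Euc n) 1, (qf (a x) (fderiv ℝ u x) (fderiv ℝ ζ x) -
      (1 - ‖u x‖ ^ 2) / ε ^ 2 * rdot (u x) (ζ x) * w x) = 0 := by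
  have hB : MeasurableSet (ball (0 : Euc n) 1) := measurableSet_ball
  set b : Fin n → Euc n → ℂ := fun j => (ball (0 : Euc n) 1).indicator
    (fun x => ∑ i, (a x i j : ℂ) * fderiv ℝ u x (EuclideanSpace.single i 1)) with hb
  set c : Euc n → ℂ := (ball (0 : Euc n) 1).indicator
    (fun x => ((-((1 - ‖u x‖ ^ 2) / ε ^ 2 * w x) : ℝ) : ℂ) * u x) with hc
  have hbm : ∀ j, MemLp (b j) 2 := fun j => by
    rw [hb, memLp_indicator_iff_restrict hB]
    refine memLp_finsetSum _ fun i _ => ?_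
    refine MemLp.of_le_mul (c := C₀) h.memLp ?_ ?_
    · refine AEStronglyMeasurable.mul ?_ ?_
      · exact (Complex.continuous_ofReal.comp_continuousOn
          (h.coeff.cont i j)).aestronglyMeasurable hB
      · exact (measurable_fderiv_apply_const ℝ u _).aestronglyMeasurable
    · filter_upwards [ae_restrict_mem hB] with x hx
      rw [norm_mul, Complex.norm_real]
      exact mul_le_mul (h.coeff.bound x hx i j) (norm_single_apply_le _ _) (norm_nonneg _)
        h.coeff.pos'.le
  have hfin : IsFiniteMeasure (volume.restrict (ball (0 : Euc n) 1)) :=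
    ⟨by simpa using measure_ball_lt_top⟩
  have hcm : MemLp c 2 := by
    rw [hc, memLp_indicator_iff_restrict hB]
    refine MemLp.of_bound ?_ (1 / ε ^ 2 * C₀) ?_
    · refine ContinuousOn.aestronglyMeasurable ?_ hB
      have := h.diff.continuousOn
      have hw := h.coeff.w_continuousOn
      refine ContinuousOn.mul (Complex.continuous_ofReal.comp_continuousOn ?_) this
      fun_prop
    · filter_upwards [ae_restrict_mem hB] with x hx
      have e2 : 0 < ε ^ 2 := by have := h.eps_pos; positivity
      have hw0 : |w x| ≤ C₀ := by
        rw [abs_of_pos (h.coeff.pos.trans_le (h.coeff.w_lower x hx))]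
        exact h.coeff.w_upper x hx
      rw [norm_mul, Complex.norm_real, Real.norm_eq_abs, abs_neg, abs_mul, abs_div,
        abs_of_pos e2]
      refine (mul_le_of_le_one_right (by positivity) (h.le_one x hx)).trans ?_
      refine mul_le_mul ?_ hw0 (abs_nonneg _) (by positivity)
      gcongr
      exact abs_one_sub_norm_sq_le (h.le_one x hx)
  have key : ∀ ζ : Euc n → ℂ, ∫ x, ((∑ j, rdot (b j x) (pd ζ j x)) + rdot (c x) (ζ x)) =
      ∫ x in ball (0 : Euc n) 1, (qf (a x) (fderiv ℝ u x) (fderiv ℝ ζ x) -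
      (1 - ‖u x‖ ^ 2) / ε ^ 2 * rdot (u x) (ζ x) * w x) := by
    intro ζ
    rw [← integral_indicator hB]
    congr 1
    ext x
    by_cases hx : x ∈ ball (0 : Euc n) 1
    · simp only [hb, hc, Set.indicator_of_mem hx, rdot_smul_left, qf_eq_sum_rdot, pd]
      ring
    · simp [hb, hc, Set.indicator_of_notMem hx, rdot]
  rw [← key]
  have hcs : HasCompactSupport ζ :=
    HasCompactSupport.of_support_subset_isCompact (isCompact_closedBall 0 ρ)
      ((subset_tsupport _).trans hs)
  refine weak_form_extend hbm hcm hρ (fun ζ hζ hs => ?_) hζ hs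
    (hζ.continuous.memLp_of_hasCompactSupport hcs) fun j => ?_
  · rw [key]; exact h.weak ζ hζ hs
  · refine MemLp.of_le h3 (measurable_fderiv_apply_const ℝ ζ _).aestronglyMeasurable
      (.of_forall fun x => norm_single_apply_le _ _)

/-- The energy density with abstract coefficients. -/
def enDen {n : ℕ} (ε : ℝ) (a : Euc n → Matrix (Fin n) (Fin n) ℝ) (w : Euc n → ℝ) (u : Euc n → ℂ)
    (x : Euc n) : ℝ :=
  qf (a x) (fderiv ℝ u x) (fderiv ℝ u x) / 2 + (1 - ‖u x‖ ^ 2) ^ 2 / (4 * ε ^ 2) * w x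

theorem continuous_rdot : Continuous fun p : ℂ × ℂ => rdot p.1 p.2 := by
  unfold rdot; fun_prop

theorem Coeff.integrableOn_qf {n : ℕ} {c₀ C₀ : ℝ} {a : Euc n → Matrix (Fin n) (Fin n) ℝ}
    {w : Euc n → ℝ} (h : Coeff c₀ C₀ a w) {L L' : Euc n → Euc n →L[ℝ] ℂ}
    (hL : MemLp L 2 (volume.restrict (ball 0 1))) (hL' : MemLp L' 2 (volume.restrict (ball 0 1))) :
    IntegrableOn (fun x => qf (a x) (L x) (L' x)) (ball 0 1) := by
  have hint : IntegrableOn (fun x => C₀ * (‖L x‖ ^ 2 + ‖L' x‖ ^ 2)) (ball 0 1) :=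
    (((memLp_two_iff_integrable_sq_norm hL.1).1 hL).add
      ((memLp_two_iff_integrable_sq_norm hL'.1).1 hL')).const_mul _
  refine hint.mono' ?_ ?_
  · refine Finset.aestronglyMeasurable_fun_sum _ fun i _ =>
      Finset.aestronglyMeasurable_fun_sum _ fun j _ => ?_
    refine ((h.cont i j).aestronglyMeasurable measurableSet_ball).mul ?_
    exact continuous_rdot.comp_aestronglyMeasurable
      (((ContinuousLinearMap.apply ℝ ℂ _).continuous.comp_aestronglyMeasurable hL.1).prodMk
      ((ContinuousLinearMap.apply ℝ ℂ _).continuous.comp_aestronglyMeasurable hL'.1))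
  · filter_upwards [ae_restrict_mem measurableSet_ball] with x hx
    have := h.upper x hx (L x) (L' x)
    have h2 := h.pos'
    rw [Real.norm_eq_abs]
    nlinarith [mul_nonneg h2.le (sq_nonneg (‖L x‖ - ‖L' x‖)), mul_nonneg h2.le (sq_nonneg (‖L x‖)),
      mul_nonneg h2.le (sq_nonneg (‖L' x‖))]

theorem isFiniteMeasure_restrict_unit_ball (n : ℕ) :
    IsFiniteMeasure (volume.restrict (ball (0 : Euc n) 1)) :=
  ⟨by simpa using measure_ball_lt_top⟩

theorem integrableOn_of_continuousOn_bound {n : ℕ} {f : Euc n → ℝ} {C : ℝ}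
    (hf : ContinuousOn f (ball 0 1)) (hC : ∀ x ∈ ball (0 : Euc n) 1, |f x| ≤ C) :
    IntegrableOn f (ball 0 1) := by
  have := isFiniteMeasure_restrict_unit_ball n
  refine (integrable_const C).mono' (hf.aestronglyMeasurable measurableSet_ball) ?_
  filter_upwards [ae_restrict_mem measurableSet_ball] with x hx using hC x hx

theorem Coeff.abs_w_le {n : ℕ} {c₀ C₀ : ℝ} {a : Euc n → Matrix (Fin n) (Fin n) ℝ}
    {w : Euc n → ℝ} (h : Coeff c₀ C₀ a w) {x : Euc n} (hx : x ∈ ball (0 : Euc n) 1) :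
    |w x| ≤ C₀ := by
  rw [abs_of_pos (h.pos.trans_le (h.w_lower x hx))]
  exact h.w_upper x hx

theorem Coeff.integrableOn_potential {n : ℕ} {c₀ C₀ : ℝ} {a : Euc n → Matrix (Fin n) (Fin n) ℝ}
    {w : Euc n → ℝ} (h : Coeff c₀ C₀ a w) {v : Euc n → ℂ} (hv : ContinuousOn v (ball 0 1))
    (hv1 : ∀ x ∈ ball (0 : Euc n) 1, ‖v x‖ ≤ 1) (ε : ℝ) :
    IntegrableOn (fun x => (1 - ‖v x‖ ^ 2) ^ 2 / (4 * ε ^ 2) * w x) (ball 0 1) := by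
  have hw := h.w_continuousOn
  refine integrableOn_of_continuousOn_bound (C := 1 / (4 * ε ^ 2) * C₀) (by fun_prop)
    fun x hx => ?_
  rw [abs_mul, abs_div, abs_of_nonneg (show 0 ≤ 4 * ε ^ 2 by positivity), abs_pow]
  refine mul_le_mul ?_ (h.abs_w_le hx) (abs_nonneg _) (by positivity)
  gcongr
  exact pow_le_one₀ (abs_nonneg _) (abs_one_sub_norm_sq_le (hv1 x hx))

theorem Coeff.integrableOn_enDen {n : ℕ} {c₀ C₀ : ℝ} {a : Euc n → Matrix (Fin n) (Fin n) ℝ}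
    {w : Euc n → ℝ} (h : Coeff c₀ C₀ a w) {v : Euc n → ℂ} (hv : ContinuousOn v (ball 0 1))
    (hv1 : ∀ x ∈ ball (0 : Euc n) 1, ‖v x‖ ≤ 1)
    (hv2 : MemLp (fderiv ℝ v) 2 (volume.restrict (ball 0 1))) (ε : ℝ) :
    IntegrableOn (enDen ε a w v) (ball 0 1) :=
  ((h.integrableOn_qf hv2 hv2).div_const 2).add (h.integrableOn_potential hv hv1 ε)

theorem qf_add_left {n : ℕ} (a : Matrix (Fin n) (Fin n) ℝ) (L₁ L₂ L' : Euc n →L[ℝ] ℂ) :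
    qf a (L₁ + L₂) L' = qf a L₁ L' + qf a L₂ L' := by
  simp only [qf, ← Finset.sum_add_distrib]
  exact Finset.sum_congr rfl fun i _ => Finset.sum_congr rfl fun j _ => by
    simp [rdot]; ring

theorem qf_add_right {n : ℕ} (a : Matrix (Fin n) (Fin n) ℝ) (L L₁ L₂ : Euc n →L[ℝ] ℂ) :
    qf a L (L₁ + L₂) = qf a L L₁ + qf a L L₂ := by
  simp only [qf, ← Finset.sum_add_distrib]
  exact Finset.sum_congr rfl fun i _ => Finset.sum_congr rfl fun j _ => by
    simp [rdot]; ring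

theorem qf_smul_left {n : ℕ} (a : Matrix (Fin n) (Fin n) ℝ) (s : ℝ) (L L' : Euc n →L[ℝ] ℂ) :
    qf a (s • L) L' = s * qf a L L' := by
  simp only [qf, Finset.mul_sum]
  exact Finset.sum_congr rfl fun i _ => Finset.sum_congr rfl fun j _ => by
    simp [rdot]; ring

theorem qf_smul_right {n : ℕ} (a : Matrix (Fin n) (Fin n) ℝ) (s : ℝ) (L L' : Euc n →L[ℝ] ℂ) :
    qf a L (s • L') = s * qf a L L' := by
  simp only [qf, Finset.mul_sum]
  exact Finset.sum_congr rfl fun i _ => Finset.sum_congr rfl fun j _ => by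
    simp [rdot]; ring

theorem qf_comm {n : ℕ} {a : Matrix (Fin n) (Fin n) ℝ} (ha : a.IsSymm) (L L' : Euc n →L[ℝ] ℂ) :
    qf a L L' = qf a L' L := by
  rw [qf, Finset.sum_comm]
  exact Finset.sum_congr rfl fun i _ => Finset.sum_congr rfl fun j _ => by
    rw [ha.apply i j, rdot, rdot]; ring

/-- Convexity of the Dirichlet part. -/
theorem Coeff.qf_sub_le {n : ℕ} {c₀ C₀ : ℝ} {a : Euc n → Matrix (Fin n) (Fin n) ℝ}
    {w : Euc n → ℝ} (h : Coeff c₀ C₀ a w) {x : Euc n} (hx : x ∈ ball (0 : Euc n) 1)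
    (L L' : Euc n →L[ℝ] ℂ) :
    qf (a x) L (L' - L) ≤ qf (a x) L' L' / 2 - qf (a x) L L / 2 := by
  have h0 : 0 ≤ qf (a x) (L' - L) (L' - L) :=
    (mul_nonneg h.pos.le (sq_nonneg _)).trans (h.lower x hx _)
  have e : L' - L = L' + (-1 : ℝ) • L := by module
  have hc := qf_comm (h.symm x hx) L' L
  rw [e] at h0 ⊢
  simp only [qf_add_left, qf_add_right, qf_smul_left, qf_smul_right] at h0 ⊢
  linarith

/-- Semiconvexity of the potential part. -/
theorem potential_sub_le (z z' : ℂ) {ε : ℝ} (hε : 0 < ε) :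
    -((1 - ‖z‖ ^ 2) / ε ^ 2 * rdot z (z' - z)) ≤
      (1 - ‖z'‖ ^ 2) ^ 2 / (4 * ε ^ 2) - (1 - ‖z‖ ^ 2) ^ 2 / (4 * ε ^ 2) +
        1 / (2 * ε ^ 2) * ‖z' - z‖ ^ 2 := by
  have e1 : ‖z'‖ ^ 2 = ‖z‖ ^ 2 + 2 * rdot z (z' - z) + ‖z' - z‖ ^ 2 := by
    simp only [Complex.sq_norm, Complex.normSq_apply, rdot, Complex.sub_re, Complex.sub_im]; ring
  have h1 : 0 ≤ ‖z‖ ^ 2 * ‖z' - z‖ ^ 2 := by positivity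
  have e2 : 0 < ε ^ 2 := by positivity
  have key : -(4 * (1 - ‖z‖ ^ 2) * rdot z (z' - z)) ≤ (1 - ‖z'‖ ^ 2) ^ 2 - (1 - ‖z‖ ^ 2) ^ 2 +
      2 * ‖z' - z‖ ^ 2 := by
    rw [e1]
    nlinarith [sq_nonneg (2 * rdot z (z' - z) + ‖z' - z‖ ^ 2)]
  have := div_le_div_of_nonneg_right key (show 0 ≤ 4 * ε ^ 2 by positivity)
  calc _ = -(4 * (1 - ‖z‖ ^ 2) * rdot z (z' - z)) / (4 * ε ^ 2) := by field_simp
    _ ≤ _ := this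
    _ = _ := by field_simp; ring

theorem WeakSol.energy_le {n : ℕ} {c₀ C₀ ε : ℝ}
    {a : Euc n → Matrix (Fin n) (Fin n) ℝ} {w : Euc n → ℝ} {u : Euc n → ℂ}
    (h : WeakSol c₀ C₀ ε a w u) {ρ : ℝ} (hρ : ρ < 1) {v : Euc n → ℂ}
    (hv : DifferentiableOn ℝ v (ball 0 1)) (hv1 : ∀ x ∈ ball (0 : Euc n) 1, ‖v x‖ ≤ 1)
    (hv2 : MemLp (fderiv ℝ v) 2 (volume.restrict (ball 0 1)))
    (hvu : ∀ x, x ∉ closedBall (0 : Euc n) ρ → v x = u x) :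
    ∫ x in ball (0 : Euc n) 1, enDen ε a w u x ≤ (∫ x in ball (0 : Euc n) 1, enDen ε a w v x) +
      C₀ / (2 * ε ^ 2) * ∫ x in ball (0 : Euc n) 1, ‖v x - u x‖ ^ 2 := by
  have hε := h.eps_pos
  have hda : ∀ {f : Euc n → ℂ}, DifferentiableOn ℝ f (ball 0 1) → ∀ x ∈ ball (0 : Euc n) 1,
      DifferentiableAt ℝ f x := fun hf x hx => hf.differentiableAt (isOpen_ball.mem_nhds hx)
  have h0 : ∀ x, x ∉ closedBall (0 : Euc n) ρ → (v - u) =ᶠ[nhds x] 0 := fun x hx => by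
    filter_upwards [isClosed_closedBall.isOpen_compl.mem_nhds hx] with y hy
    simp [hvu y hy]
  have hball : closedBall (0 : Euc n) ρ ⊆ ball 0 1 := closedBall_subset_ball hρ
  have hζ : Differentiable ℝ (v - u) := fun x => by
    by_cases hx : x ∈ closedBall (0 : Euc n) ρ
    · exact (hda hv x (hball hx)).sub (hda h.diff x (hball hx))
    · exact (differentiableAt_const 0).congr_of_eventuallyEq (h0 x hx)
  have hs : tsupport (v - u) ⊆ closedBall 0 ρ :=
    closure_minimal (fun x hx => by
      by_contra hx'
      exact hx (by simp [hvu x hx'])) isClosed_closedBall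
  have hfd : fderiv ℝ (v - u) = (ball (0 : Euc n) 1).indicator (fderiv ℝ v - fderiv ℝ u) := by
    ext1 x
    by_cases hx : x ∈ ball (0 : Euc n) 1
    · rw [Set.indicator_of_mem hx]; exact fderiv_sub (hda hv x hx) (hda h.diff x hx)
    · rw [Set.indicator_of_notMem hx, (h0 x fun h => hx (hball h)).fderiv_eq]
      exact congrFun (fderiv_fun_const (0 : ℂ)) x
  have h3 : MemLp (fderiv ℝ (v - u)) 2 := by
    rw [hfd]
    exact (memLp_indicator_iff_restrict measurableSet_ball).2 (hv2.sub h.memLp)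
  have hwk := h.weak_of_differentiable hρ hζ hs h3
  have i1 := h.coeff.integrableOn_enDen hv.continuousOn hv1 hv2 ε
  have i2 := h.coeff.integrableOn_enDen h.diff.continuousOn h.le_one h.memLp ε
  have i3 : IntegrableOn (fun x => ‖v x - u x‖ ^ 2) (ball 0 1) := by
    have := hv.continuousOn
    have := h.diff.continuousOn
    refine integrableOn_of_continuousOn_bound (C := 2 ^ 2) (by fun_prop) fun x hx => ?_
    rw [abs_of_nonneg (by positivity)]
    gcongr
    exact (norm_sub_le _ _).trans (by linarith [hv1 x hx, h.le_one x hx])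
  have i4 : IntegrableOn (fun x => qf (a x) (fderiv ℝ u x) (fderiv ℝ (v - u) x) -
      (1 - ‖u x‖ ^ 2) / ε ^ 2 * rdot (u x) ((v - u) x) * w x) (ball 0 1) := by
    refine (h.coeff.integrableOn_qf h.memLp (h3.restrict _)).sub ?_
    have := hv.continuousOn
    have hu := h.diff.continuousOn
    have hw := h.coeff.w_continuousOn
    have hr : ContinuousOn (fun x => rdot (u x) ((v - u) x)) (ball (0 : Euc n) 1) :=
      continuous_rdot.comp_continuousOn (hu.prodMk hζ.continuous.continuousOn)
    refine integrableOn_of_continuousOn_bound (C := 1 / ε ^ 2 * (1 * 2) * C₀) (by fun_prop)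
      fun x hx => ?_
    rw [abs_mul, abs_mul, abs_div, abs_of_pos (show 0 < ε ^ 2 by positivity)]
    gcongr
    · exact abs_one_sub_norm_sq_le (h.le_one x hx)
    · refine (abs_rdot_le _ _).trans (mul_le_mul (h.le_one x hx) ?_ (norm_nonneg _) zero_le_one)
      exact (norm_sub_le _ _).trans (by linarith [hv1 x hx, h.le_one x hx])
    · exact h.coeff.abs_w_le hx
  have hmono : ∫ x in ball (0 : Euc n) 1, (qf (a x) (fderiv ℝ u x) (fderiv ℝ (v - u) x) -
      (1 - ‖u x‖ ^ 2) / ε ^ 2 * rdot (u x) ((v - u) x) * w x) ≤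
      ∫ x in ball (0 : Euc n) 1, ((enDen ε a w v x - enDen ε a w u x) +
        C₀ / (2 * ε ^ 2) * ‖v x - u x‖ ^ 2) := by
    refine setIntegral_mono_on i4 ((i1.sub i2).add (i3.const_mul _)) measurableSet_ball
      fun x hx => ?_
    have e : fderiv ℝ (v - u) x = fderiv ℝ v x - fderiv ℝ u x := by
      rw [hfd, Set.indicator_of_mem hx]; rfl
    have k1 := h.coeff.qf_sub_le hx (fderiv ℝ u x) (fderiv ℝ v x)
    have k2 := potential_sub_le (u x) (v x) hε
    have hw0 : 0 ≤ w x := h.coeff.pos.le.trans (h.coeff.w_lower x hx)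
    have k3 := mul_le_mul_of_nonneg_right k2 hw0
    have k4 : 1 / (2 * ε ^ 2) * ‖v x - u x‖ ^ 2 * w x ≤ C₀ / (2 * ε ^ 2) * ‖v x - u x‖ ^ 2 :=
      calc _ ≤ 1 / (2 * ε ^ 2) * ‖v x - u x‖ ^ 2 * C₀ := by
            gcongr; exact h.coeff.w_upper x hx
        _ = _ := by ring
    rw [e]
    simp only [enDen, Pi.sub_apply]
    linarith
  have i5 : IntegrableOn (fun x => enDen ε a w v x - enDen ε a w u x) (ball 0 1) := i1.sub i2
  rw [hwk, integral_add i5 (i3.const_mul _), integral_sub i1 i2, integral_const_mul] at hmono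
  linarith

/-- The trace of an endomorphism of Euclidean space. -/
def trE {n : ℕ} (M : Euc n →L[ℝ] Euc n) : ℝ := ∑ i, M (EuclideanSpace.single i 1) i

open Topology in
theorem hasFDerivAt_det_one_sub {n : ℕ} :
    HasFDerivAt (fun m : Fin n → Fin n → ℝ => (1 - Matrix.of m).det)
      (-∑ i, (ContinuousLinearMap.proj i).comp
        (ContinuousLinearMap.proj (R := ℝ) (φ := fun _ : Fin n => Fin n → ℝ) i)) 0 := by
  have hd : Differentiable ℝ fun m : Fin n → Fin n → ℝ => (1 - Matrix.of m).det := by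
    have h1 : ContDiff ℝ 1 fun m : Fin n → Fin n → ℝ => (1 - Matrix.of m).det := by
      simp only [Matrix.det_apply', Matrix.sub_apply, Matrix.of_apply]
      exact ContDiff.sum fun σ _ => contDiff_const.mul (contDiff_prod fun i _ => by fun_prop)
    exact h1.differentiable one_ne_zero
  refine (hd 0).hasFDerivAt.congr_fderiv ?_
  ext m
  have h1 : HasDerivAt (fun t : ℝ => (1 - Matrix.of (t • m)).det)
      (fderiv ℝ (fun m : Fin n → Fin n → ℝ => (1 - Matrix.of m).det) 0 m) 0 := by
    have h2 : HasDerivAt (fun t : ℝ => t • m) m 0 := by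
      simpa using (hasDerivAt_id (0 : ℝ)).smul_const m
    have h3 := (hd 0).hasFDerivAt
    rw [show (0 : Fin n → Fin n → ℝ) = (0 : ℝ) • m by simp] at h3
    have h6 := h3.comp_hasDerivAt (0 : ℝ) h2
    rw [zero_smul] at h6
    exact h6
  have h4 : ∀ t : ℝ, (1 - Matrix.of (t • m)).det = 1 + (-Matrix.of m).trace * t +
      Polynomial.eval t (1 + (Polynomial.X : Polynomial ℝ) •
        (-Matrix.of m).map Polynomial.C).det.divX.divX * t ^ 2 := fun t => by
    rw [← Matrix.det_one_add_smul]
    congr 1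
    ext i j
    simp [sub_eq_add_neg]
  set q := (1 + (Polynomial.X : Polynomial ℝ) • (-Matrix.of m).map Polynomial.C).det.divX.divX
  have h5 : HasDerivAt (fun t : ℝ => (1 - Matrix.of (t • m)).det) ((-Matrix.of m).trace) 0 := by
    simp only [h4]
    have := (((hasDerivAt_id (0 : ℝ)).const_mul ((-Matrix.of m).trace)).const_add 1).add
      ((q.hasDerivAt 0).mul ((hasDerivAt_id (0 : ℝ)).pow 2))
    exact this.congr_deriv (by simp)
  rw [h1.unique h5]
  simp [Matrix.trace]

open Topology Asymptotics in
/-- First order expansion of the Jacobian determinant at the identity. -/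
theorem exists_det_one_sub_expansion (n : ℕ) {η : ℝ} (hη : 0 < η) :
    ∃ δ > 0, ∀ M : Euc n →L[ℝ] Euc n, ‖M‖ ≤ δ →
      |(1 - M).det - (1 - trE M)| ≤ η * ‖M‖ := by
  have h := (hasFDerivAt_det_one_sub (n := n)).isLittleO.bound hη
  obtain ⟨δ, hδ, hb⟩ := Metric.eventually_nhds_iff_ball.1 h
  refine ⟨δ / 2, by positivity, fun M hM => ?_⟩
  set m : Fin n → Fin n → ℝ := fun i j => M (EuclideanSpace.single j 1) i with hm
  have hmn : ‖m‖ ≤ ‖M‖ := by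
    refine (pi_norm_le_iff_of_nonneg (norm_nonneg _)).2 fun i =>
      (pi_norm_le_iff_of_nonneg (norm_nonneg _)).2 fun j => ?_
    refine (PiLp.norm_apply_le (M (EuclideanSpace.single j 1)) i).trans ?_
    simpa using M.le_opNorm (EuclideanSpace.single j (1 : ℝ))
  have h1 := hb m (by rw [mem_ball_zero_iff]; linarith)
  have hdet : (1 - M).det = (1 - Matrix.of m).det := by
    rw [ContinuousLinearMap.det, ← LinearMap.det_toMatrix (EuclideanSpace.basisFun (Fin n) ℝ).toBasis]
    congr 1
    ext i j
    simp [LinearMap.toMatrix_apply, hm, Matrix.one_apply]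
  rw [hdet]
  simp only [sub_zero, Real.norm_eq_abs] at h1
  have h2 : (-∑ i, (ContinuousLinearMap.proj i).comp
        (ContinuousLinearMap.proj (R := ℝ) (φ := fun _ : Fin n => Fin n → ℝ) i)) m = -trE M := by
    simp [trE, hm]
  rw [h2] at h1
  have h3 : (1 - Matrix.of (0 : Fin n → Fin n → ℝ)).det = 1 := by simp
  rw [h3] at h1
  calc _ = |(1 - Matrix.of m).det - 1 - -trE M| := by congr 1; ring
    _ ≤ η * ‖m‖ := h1
    _ ≤ _ := by gcongr

open NNReal in
theorem exists_homeomorph_sub_smul {n : ℕ} {X : Euc n → Euc n} {K : ℝ≥0} (hX : LipschitzWith K X)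
    {t : ℝ} (ht : 0 ≤ t) (htK : t * K ≤ 1 / 2) :
    ∃ Ψ : Euc n ≃ₜ Euc n, ∀ x, Ψ x = x - t • X x := by
  have ha : ApproximatesLinearOn (fun x => x - t • X x)
      ((ContinuousLinearEquiv.refl ℝ (Euc n) : Euc n ≃L[ℝ] Euc n) : Euc n →L[ℝ] Euc n)
      Set.univ (1 / 2) := by
    refine fun x _ y _ => ?_
    have e : x - t • X x - (y - t • X y) -
        ((ContinuousLinearEquiv.refl ℝ (Euc n) : Euc n ≃L[ℝ] Euc n) : Euc n →L[ℝ] Euc n) (x - y) =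
        -(t • (X x - X y)) := by
      simp only [ContinuousLinearEquiv.coe_refl, ContinuousLinearMap.coe_id', id_eq]
      module
    rw [e, norm_neg, norm_smul, Real.norm_of_nonneg ht]
    calc t * ‖X x - X y‖ ≤ t * (K * ‖x - y‖) := by
          gcongr; simpa [dist_eq_norm] using hX.dist_le_mul x y
      _ = t * K * ‖x - y‖ := by ring
      _ ≤ 1 / 2 * ‖x - y‖ := by gcongr
      _ = _ := by norm_num
  have hc : Subsingleton (Euc n) ∨ (1 / 2 : ℝ≥0) <
      ‖((ContinuousLinearEquiv.refl ℝ (Euc n)).symm : Euc n →L[ℝ] Euc n)‖₊⁻¹ := by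
    rcases subsingleton_or_nontrivial (Euc n) with h | h
    · exact .inl h
    · right
      have : ‖((ContinuousLinearEquiv.refl ℝ (Euc n)).symm : Euc n →L[ℝ] Euc n)‖₊ = 1 := by
        ext; exact ContinuousLinearMap.norm_id
      rw [this, inv_one]
      exact NNReal.half_lt_self one_ne_zero
  exact ⟨ha.toHomeomorph _ hc, fun x => rfl⟩

theorem Homeomorph.symm_eq_self_of_forall_notMem {E : Type*} [TopologicalSpace E] (Ψ : E ≃ₜ E)
    {s : Set E} (h : ∀ x, x ∉ s → Ψ x = x) {x : E} (hx : x ∉ s) : Ψ.symm x = x := by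
  rw [Homeomorph.symm_apply_eq, h x hx]

theorem Homeomorph.mem_of_forall_notMem {E : Type*} [TopologicalSpace E] (Ψ : E ≃ₜ E)
    {s t : Set E} (hst : s ⊆ t) (h : ∀ x, x ∉ s → Ψ x = x) {x : E} (hx : x ∈ t) : Ψ x ∈ t := by
  by_contra hx'
  have h1 : Ψ (Ψ x) = Ψ x := h _ fun h => hx' (hst h)
  rw [Ψ.injective h1] at hx'
  exact hx' hx

theorem Homeomorph.image_eq_of_forall_notMem {E : Type*} [TopologicalSpace E] (Ψ : E ≃ₜ E)
    {s t : Set E} (hst : s ⊆ t) (h : ∀ x, x ∉ s → Ψ x = x) : Ψ '' t = t := by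
  refine Set.Subset.antisymm ?_ fun y hy => ?_
  · rintro _ ⟨x, hx, rfl⟩
    exact Ψ.mem_of_forall_notMem hst h hx
  · refine ⟨Ψ.symm y, Ψ.symm.mem_of_forall_notMem hst
      (fun x hx => Ψ.symm_eq_self_of_forall_notMem h hx) hy, by simp⟩

/-- Neumann series to second order. -/
theorem exists_equiv_one_sub {n : ℕ} {M : Euc n →L[ℝ] Euc n} (hM : ‖M‖ ≤ 1 / 2) :
    ∃ e : Euc n ≃L[ℝ] Euc n, (e : Euc n →L[ℝ] Euc n) = 1 - M ∧
      ‖(e.symm : Euc n →L[ℝ] Euc n)‖ ≤ 2 ∧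
      ‖(e.symm : Euc n →L[ℝ] Euc n) - 1 - M‖ ≤ 2 * ‖M‖ ^ 2 := by
  set U := Units.oneSub M (by linarith) with hU
  set e := ContinuousLinearEquiv.unitsEquiv ℝ (Euc n) U with he
  have h1 : (e : Euc n →L[ℝ] Euc n) = 1 - M := rfl
  set N := (e.symm : Euc n →L[ℝ] Euc n) with hN
  have h2 : N * (1 - M) = 1 := by
    rw [← h1]; ext x : 1; simp [hN]
  have h3 : N = 1 + N * M := by
    rw [mul_sub, mul_one] at h2
    rw [← h2]; abel
  have h4 : ‖N‖ ≤ 2 := by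
    have a1 : ‖N‖ ≤ ‖(1 : Euc n →L[ℝ] Euc n)‖ + ‖N * M‖ := by
      conv_lhs => rw [h3]
      exact norm_add_le _ _
    have a2 : ‖(1 : Euc n →L[ℝ] Euc n)‖ ≤ 1 := ContinuousLinearMap.norm_id_le
    have a3 : ‖N * M‖ ≤ ‖N‖ * (1 / 2) := (norm_mul_le _ _).trans (by gcongr)
    linarith
  refine ⟨e, h1, h4, ?_⟩
  have h5 : N - 1 - M = N * M * M := by
    have : N * M = M + N * M * M := by
      conv_lhs => rw [h3]
      rw [add_mul, one_mul]
    rw [sub_sub, sub_eq_iff_eq_add]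
    conv_lhs => rw [h3, this]
    abel
  change ‖N - 1 - M‖ ≤ _
  rw [h5]
  calc _ ≤ ‖N‖ * ‖M‖ * ‖M‖ := (norm_mul_le _ _).trans (by gcongr; exact norm_mul_le _ _)
    _ ≤ 2 * ‖M‖ * ‖M‖ := by gcongr
    _ = _ := by ring

open ENNReal in
theorem enorm_sub_sq_le_lintegral {f f' : ℝ → ℂ} (hf : ∀ s ∈ Set.Icc (0 : ℝ) 1,
    HasDerivAt f (f' s) s) (hf' : Measurable f') :
    ‖f 1 - f 0‖ₑ ^ 2 ≤ ∫⁻ s in Set.Ioc (0 : ℝ) 1, ‖f' s‖ₑ ^ 2 := by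
  have hP : IsProbabilityMeasure (volume.restrict (Set.Ioc (0 : ℝ) 1)) := ⟨by simp⟩
  have e2 : eLpNorm f' 2 (volume.restrict (Set.Ioc (0 : ℝ) 1)) ^ 2 =
      ∫⁻ s in Set.Ioc (0 : ℝ) 1, ‖f' s‖ₑ ^ 2 := by
    simpa using eLpNorm_nnreal_pow_eq_lintegral (f := f') (p := 2)
      (μ := volume.restrict (Set.Ioc (0 : ℝ) 1)) two_ne_zero
  rw [← e2]
  rcases eq_or_ne (eLpNorm f' 2 (volume.restrict (Set.Ioc (0 : ℝ) 1))) ⊤ with h | h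
  · simp [h]
  · have hm : MemLp f' 2 (volume.restrict (Set.Ioc (0 : ℝ) 1)) :=
      ⟨hf'.aestronglyMeasurable, h.lt_top⟩
    have hi : IntervalIntegrable f' volume 0 1 :=
      (intervalIntegrable_iff_integrableOn_Ioc_of_le zero_le_one).2 (hm.integrable (by norm_num))
    rw [← intervalIntegral.integral_eq_sub_of_hasDerivAt (by simpa using hf) hi,
      intervalIntegral.integral_of_le zero_le_one]
    gcongr
    refine (enorm_integral_le_lintegral_enorm _).trans ?_
    rw [← eLpNorm_one_eq_lintegral_enorm]
    exact eLpNorm_le_eLpNorm_of_exponent_le (by norm_num) hf'.aestronglyMeasurable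

open NNReal in
/-- A `C¹` vector field supported in a ball, with `C¹` bound `K`. -/
structure IsVF {n : ℕ} (ρ : ℝ) (K : ℝ≥0) (X : Euc n → Euc n) : Prop where
  lt_one : ρ < 1
  contDiff : ContDiff ℝ 1 X
  lip : LipschitzWith K X
  norm_le : ∀ x, ‖X x‖ ≤ K
  zero : ∀ x, x ∉ closedBall (0 : Euc n) ρ → X x = 0

theorem abs_trE_le {n : ℕ} (M : Euc n →L[ℝ] Euc n) : |trE M| ≤ n * ‖M‖ := by
  rw [trE]
  refine (Finset.abs_sum_le_sum_abs _ _).trans ((Finset.sum_le_card_nsmul _ _ ‖M‖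
    fun i _ => ?_).trans_eq (by simp))
  refine (PiLp.norm_apply_le (M (EuclideanSpace.single i 1)) i).trans ?_
  simpa using M.le_opNorm (EuclideanSpace.single i (1 : ℝ))

theorem trE_smul {n : ℕ} (t : ℝ) (M : Euc n →L[ℝ] Euc n) : trE (t • M) = t * trE M := by
  simp [trE, Finset.mul_sum]

section
open NNReal ENNReal
variable {n : ℕ} {ρ : ℝ} {K : ℝ≥0} {X : Euc n → Euc n}

theorem IsVF.norm_fderiv_le (h : IsVF ρ K X) (x : Euc n) : ‖fderiv ℝ X x‖ ≤ K :=
  norm_fderiv_le_of_lipschitz ℝ h.lip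

theorem ENNReal.one_le_two_mul_ofReal_abs {d : ℝ} (h : 1 / 2 ≤ d) :
    1 ≤ 2 * ENNReal.ofReal |d| := by
  rw [show (2 : ℝ≥0∞) = ENNReal.ofReal 2 by simp, ← ENNReal.ofReal_mul (by norm_num),
    ENNReal.one_le_ofReal, abs_of_pos (by linarith)]
  linarith

theorem ENNReal.ofReal_abs_le_two {d : ℝ} (h : 1 / 2 ≤ d) (h' : d ≤ 2) :
    ENNReal.ofReal |d| ≤ 2 := by
  rw [show (2 : ℝ≥0∞) = ENNReal.ofReal 2 by simp, abs_of_pos (by linarith)]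
  exact ENNReal.ofReal_le_ofReal h'

theorem exists_small_time (n : ℕ) (K : ℝ≥0) : ∃ t₀ : ℝ, 0 < t₀ ∧ ∀ t : ℝ, 0 ≤ t → t ≤ t₀ →
    t * K ≤ 1 / 2 ∧ ∀ M : Euc n →L[ℝ] Euc n, ‖M‖ ≤ K →
      1 / 2 ≤ (1 - t • M).det ∧ (1 - t • M).det ≤ 2 := by
  obtain ⟨δ, hδ, hd⟩ := exists_det_one_sub_expansion n one_pos
  have hK : (0 : ℝ) < K + 1 := by positivity
  refine ⟨min δ (1 / (2 * (n + 1))) / (K + 1), by positivity, fun t ht0 ht => ?_⟩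
  rw [le_div_iff₀ hK] at ht
  have h1 : t * K ≤ t * (K + 1) := by nlinarith
  have h2 : t * K ≤ δ := h1.trans (ht.trans (min_le_left _ _))
  have h3 : t * K ≤ 1 / (2 * (n + 1)) := h1.trans (ht.trans (min_le_right _ _))
  have h3' : (n + 1) * (t * K) ≤ 1 / 2 := by
    calc (n + 1 : ℝ) * (t * K) ≤ (n + 1) * (1 / (2 * (n + 1))) := by gcongr
      _ = 1 / 2 := by field_simp
  have h4 : 0 ≤ t * K := by positivity
  have h5 : 0 ≤ n * (t * K) := by positivity
  refine ⟨by linarith, fun M hM => ?_⟩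
  have hM' : ‖t • M‖ ≤ t * K := by
    rw [norm_smul, Real.norm_of_nonneg ht0]; gcongr
  have h6 := hd (t • M) (hM'.trans h2)
  have h7 := abs_trE_le (t • M)
  have h8 : n * ‖t • M‖ ≤ n * (t * K) := by gcongr
  rw [abs_le] at h6 h7
  constructor <;> linarith

theorem IsVF.hasFDerivAt_sub_smul (h : IsVF ρ K X) (t : ℝ) (x : Euc n) :
    HasFDerivAt (fun x => x - t • X x) (1 - t • fderiv ℝ X x) x :=
  (hasFDerivAt_id x).sub
    (((h.contDiff.differentiable one_ne_zero x).hasFDerivAt).const_smul t)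

theorem IsVF.hasFDerivAt_homeo (h : IsVF ρ K X) {t : ℝ} {Ψ : Euc n ≃ₜ Euc n}
    (hΨ : ∀ x, Ψ x = x - t • X x) (x : Euc n) :
    HasFDerivAt Ψ (1 - t • fderiv ℝ X x) x := by
  rw [show (Ψ : Euc n → Euc n) = fun x => x - t • X x from funext hΨ]
  exact h.hasFDerivAt_sub_smul t x

theorem IsVF.homeo_eq (h : IsVF ρ K X) {t : ℝ} {Ψ : Euc n ≃ₜ Euc n}
    (hΨ : ∀ x, Ψ x = x - t • X x) (x : Euc n) (hx : x ∉ closedBall (0 : Euc n) ρ) : Ψ x = x := by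
  simp [hΨ, h.zero x hx]

theorem IsVF.image_ball (h : IsVF ρ K X) {t : ℝ} {Ψ : Euc n ≃ₜ Euc n}
    (hΨ : ∀ x, Ψ x = x - t • X x) : Ψ '' ball 0 1 = ball 0 1 :=
  Ψ.image_eq_of_forall_notMem (closedBall_subset_ball h.lt_one) (h.homeo_eq hΨ)

theorem IsVF.mapsTo_ball (h : IsVF ρ K X) {t : ℝ} {Ψ : Euc n ≃ₜ Euc n}
    (hΨ : ∀ x, Ψ x = x - t • X x) {x : Euc n} (hx : x ∈ ball (0 : Euc n) 1) :
    Ψ x ∈ ball (0 : Euc n) 1 := by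
  rw [← h.image_ball hΨ]; exact ⟨x, hx, rfl⟩

theorem IsVF.lintegral_comp_le (h : IsVF ρ K X) {t : ℝ} (htK : t * K ≤ 1 / 2) (ht : 0 ≤ t)
    (hdet : ∀ M : Euc n →L[ℝ] Euc n, ‖M‖ ≤ K → 1 / 2 ≤ (1 - t • M).det)
    (F : Euc n → ℝ≥0∞) :
    ∫⁻ x in ball (0 : Euc n) 1, F (x - t • X x) ≤ 2 * ∫⁻ x in ball (0 : Euc n) 1, F x := by
  obtain ⟨Ψ, hΨ⟩ := exists_homeomorph_sub_smul h.lip ht htK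
  conv_rhs => rw [← h.image_ball hΨ]
  rw [lintegral_image_eq_lintegral_abs_det_fderiv_mul volume measurableSet_ball
    (fun x _ => (h.hasFDerivAt_homeo hΨ x).hasFDerivWithinAt) Ψ.injective.injOn,
    ← lintegral_const_mul' _ _ (by simp)]
  refine lintegral_mono fun x => ?_
  have h1 := hdet _ (h.norm_fderiv_le x)
  rw [← hΨ, ← mul_assoc]
  exact le_mul_of_one_le_left' (ENNReal.one_le_two_mul_ofReal_abs h1)

/-- The `L²` distance between `u` and its inner variation is of first order. -/
theorem IsVF.lintegral_sub_sq_le (h : IsVF ρ K X) {u : Euc n → ℂ}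
    (hu : DifferentiableOn ℝ u (ball 0 1)) {t₀ : ℝ}
    (ht₀ : ∀ t : ℝ, 0 ≤ t → t ≤ t₀ → t * K ≤ 1 / 2 ∧ ∀ M : Euc n →L[ℝ] Euc n, ‖M‖ ≤ K →
      1 / 2 ≤ (1 - t • M).det ∧ (1 - t • M).det ≤ 2) {t : ℝ} (ht : 0 ≤ t) (htt : t ≤ t₀)
    {Ψ : Euc n ≃ₜ Euc n} (hΨ : ∀ x, Ψ x = x - t • X x) :
    ∫⁻ x in ball (0 : Euc n) 1, ‖u (Ψ.symm x) - u x‖ₑ ^ 2 ≤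
      ENNReal.ofReal (4 * (t * K) ^ 2) * ∫⁻ x in ball (0 : Euc n) 1, ‖fderiv ℝ u x‖ₑ ^ 2 := by
  have hst : ∀ s ∈ Set.Icc (0 : ℝ) 1, 0 ≤ s * t ∧ s * t ≤ t₀ := fun s hs =>
    ⟨mul_nonneg hs.1 ht, (mul_le_of_le_one_left ht hs.2).trans htt⟩
  have hpt : ∀ x ∈ ball (0 : Euc n) 1, ‖u x - u (Ψ x)‖ₑ ^ 2 ≤
      ∫⁻ s in Set.Ioc (0 : ℝ) 1, ENNReal.ofReal ((t * K) ^ 2) *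
        ‖fderiv ℝ u (x - (s * t) • X x)‖ₑ ^ 2 := by
    intro x hx
    have h1 : ∀ s ∈ Set.Icc (0 : ℝ) 1, HasDerivAt (fun s : ℝ => u (x - (s * t) • X x))
        (fderiv ℝ u (x - (s * t) • X x) (-(t • X x))) s := by
      intro s hs
      obtain ⟨Φ, hΦ⟩ := exists_homeomorph_sub_smul h.lip (hst s hs).1
        (ht₀ _ (hst s hs).1 (hst s hs).2).1
      have hy := h.mapsTo_ball hΦ hx
      rw [hΦ] at hy
      have hd : HasDerivAt (fun s : ℝ => x - (s * t) • X x) (-(t • X x)) s := by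
        have := ((((hasDerivAt_id s).mul_const t).smul_const (X x)).const_sub x)
        simpa using this
      exact (hu.differentiableAt (isOpen_ball.mem_nhds hy)).hasFDerivAt.comp_hasDerivAt s hd
    have h2 : Measurable fun s : ℝ => fderiv ℝ u (x - (s * t) • X x) (-(t • X x)) :=
      (measurable_fderiv_apply_const ℝ u _).comp (by fun_prop)
    have h3 := enorm_sub_sq_le_lintegral h1 h2
    simp only [one_mul, zero_mul, zero_smul, sub_zero, ← hΨ] at h3
    rw [← enorm_neg, neg_sub]
    refine h3.trans (lintegral_mono fun s => ?_)
    have h4 : ‖fderiv ℝ u (x - (s * t) • X x) (-(t • X x))‖ ≤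
        (t * K) * ‖fderiv ℝ u (x - (s * t) • X x)‖ := by
      refine (ContinuousLinearMap.le_opNorm _ _).trans ?_
      rw [norm_neg, norm_smul, Real.norm_of_nonneg ht, mul_comm]
      gcongr
      exact h.norm_le x
    rw [ENNReal.ofReal_pow (by positivity), ← mul_pow]
    gcongr
    rw [← ofReal_norm, ← ofReal_norm, ← ENNReal.ofReal_mul (by positivity)]
    exact ENNReal.ofReal_le_ofReal h4
  conv_lhs => rw [← h.image_ball hΨ]
  rw [lintegral_image_eq_lintegral_abs_det_fderiv_mul volume measurableSet_ball
    (fun x _ => (h.hasFDerivAt_homeo hΨ x).hasFDerivWithinAt) Ψ.injective.injOn]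
  simp only [Homeomorph.symm_apply_apply]
  have hmeas : Measurable (Function.uncurry fun (x : Euc n) (s : ℝ) =>
      ENNReal.ofReal ((t * K) ^ 2) * ‖fderiv ℝ u (x - (s * t) • X x)‖ₑ ^ 2) := by
    have hc : Continuous fun p : Euc n × ℝ => p.1 - (p.2 * t) • X p.1 := by
      have := h.contDiff.continuous
      fun_prop
    exact ((((measurable_fderiv ℝ u).comp hc.measurable).enorm).pow_const 2).const_mul _
  calc ∫⁻ x in ball (0 : Euc n) 1, ENNReal.ofReal |(1 - t • fderiv ℝ X x).det| *
        ‖u x - u (Ψ x)‖ₑ ^ 2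
      ≤ ∫⁻ x in ball (0 : Euc n) 1, 2 * ∫⁻ s in Set.Ioc (0 : ℝ) 1,
          ENNReal.ofReal ((t * K) ^ 2) * ‖fderiv ℝ u (x - (s * t) • X x)‖ₑ ^ 2 := by
        refine setLIntegral_mono' measurableSet_ball fun x hx => ?_
        have h1 := (ht₀ t ht htt).2 _ (h.norm_fderiv_le x)
        exact mul_le_mul' (ENNReal.ofReal_abs_le_two h1.1 h1.2) (hpt x hx)
    _ = 2 * ∫⁻ s in Set.Ioc (0 : ℝ) 1, ENNReal.ofReal ((t * K) ^ 2) *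
          ∫⁻ x in ball (0 : Euc n) 1, ‖fderiv ℝ u (x - (s * t) • X x)‖ₑ ^ 2 := by
        rw [lintegral_const_mul' _ _ (by simp), lintegral_lintegral_swap hmeas.aemeasurable]
        simp_rw [lintegral_const_mul' _ _ ENNReal.ofReal_ne_top]
    _ ≤ 2 * ∫⁻ s in Set.Ioc (0 : ℝ) 1, ENNReal.ofReal ((t * K) ^ 2) *
          (2 * ∫⁻ x in ball (0 : Euc n) 1, ‖fderiv ℝ u x‖ₑ ^ 2) := by
        gcongr 2 * ?_
        refine setLIntegral_mono' measurableSet_Ioc fun s hs => ?_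
        gcongr
        have hs' := hst s ⟨hs.1.le, hs.2⟩
        exact h.lintegral_comp_le (ht₀ _ hs'.1 hs'.2).1 hs'.1
          (fun M hM => ((ht₀ _ hs'.1 hs'.2).2 M hM).1) fun y => ‖fderiv ℝ u y‖ₑ ^ 2
    _ = _ := by
        rw [lintegral_const]
        simp only [Measure.restrict_apply_univ, Real.volume_Ioc, sub_zero, ENNReal.ofReal_one,
          mul_one]
        rw [ENNReal.ofReal_mul (by norm_num), show ENNReal.ofReal 4 = 2 * 2 by norm_num]
        ring

end

section
open NNReal ENNReal
variable {n : ℕ} {ρ c₀ C₀ ε : ℝ} {K : ℝ≥0} {X : Euc n → Euc n}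
  {a : Euc n → Matrix (Fin n) (Fin n) ℝ} {w : Euc n → ℝ} {u : Euc n → ℂ}

/-- The density of the first inner variation, with an error for varying coefficients. -/
def firstVar (C₀ ε : ℝ) (a : Euc n → Matrix (Fin n) (Fin n) ℝ) (w : Euc n → ℝ) (u : Euc n → ℂ)
    (X : Euc n → Euc n) (x : Euc n) : ℝ :=
  qf (a x) (fderiv ℝ u x) ((fderiv ℝ u x).comp (fderiv ℝ X x)) -
    trE (fderiv ℝ X x) * (qf (a x) (fderiv ℝ u x) (fderiv ℝ u x) / 2) +
    C₀ / 2 * ‖X x‖ * ‖fderiv ℝ u x‖ ^ 2 +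
    (1 - ‖u x‖ ^ 2) ^ 2 / (4 * ε ^ 2) * (C₀ * ‖X x‖ - trE (fderiv ℝ X x) * w x)

theorem Coeff.qf_add_add_le {C₀ c₀ : ℝ} (h : Coeff c₀ C₀ a w) {x : Euc n}
    (hx : x ∈ ball (0 : Euc n) 1) {k t : ℝ} (ht : 0 ≤ t) (htk : t * k ≤ 1 / 2) (hk : 0 ≤ k)
    {L : Euc n →L[ℝ] ℂ} {M E : Euc n →L[ℝ] Euc n} (hM : ‖M‖ ≤ k) (hE : ‖E‖ ≤ 2 * (t * k) ^ 2) :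
    qf (a x) (L.comp (1 + t • M + E)) (L.comp (1 + t • M + E)) ≤
      qf (a x) L L + 2 * t * qf (a x) L (L.comp M) + 8 * C₀ * (t * k) ^ 2 * ‖L‖ ^ 2 := by
  have e : L.comp (1 + t • M + E) = L + (t • L.comp M + L.comp E) := by
    ext v; simp [add_assoc]
  set A := t • L.comp M + L.comp E with hA
  have hs := mul_nonneg ht hk
  have hLM : ‖L.comp M‖ ≤ k * ‖L‖ :=
    (L.opNorm_comp_le M).trans (by rw [mul_comm]; gcongr)
  have hLE : ‖L.comp E‖ ≤ 2 * (t * k) ^ 2 * ‖L‖ :=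
    (L.opNorm_comp_le E).trans (by rw [mul_comm]; gcongr)
  have hAn : ‖A‖ ≤ 2 * (t * k) * ‖L‖ := by
    refine (norm_add_le _ _).trans ?_
    rw [norm_smul, Real.norm_of_nonneg ht]
    have h1 : t * ‖L.comp M‖ ≤ t * (k * ‖L‖) := by gcongr
    have h2 : (t * k) ^ 2 * ‖L‖ ≤ 1 / 2 * (t * k) * ‖L‖ := by
      gcongr; nlinarith
    nlinarith
  have h1 := le_of_abs_le (h.upper x hx A A)
  have h2 := le_of_abs_le (h.upper x hx L (L.comp E))
  have h3 : ‖A‖ * ‖A‖ ≤ (2 * (t * k) * ‖L‖) * (2 * (t * k) * ‖L‖) := by gcongr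
  have h4 : ‖L‖ * ‖L.comp E‖ ≤ ‖L‖ * (2 * (t * k) ^ 2 * ‖L‖) := by gcongr
  have h5 : C₀ * (‖A‖ * ‖A‖) ≤ C₀ * ((2 * (t * k) * ‖L‖) * (2 * (t * k) * ‖L‖)) :=
    mul_le_mul_of_nonneg_left h3 h.pos'.le
  have h6 : C₀ * (‖L‖ * ‖L.comp E‖) ≤ C₀ * (‖L‖ * (2 * (t * k) ^ 2 * ‖L‖)) :=
    mul_le_mul_of_nonneg_left h4 h.pos'.le
  have e1 : qf (a x) (L + A) (L + A) = qf (a x) L L + 2 * qf (a x) L A + qf (a x) A A := by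
    rw [qf_add_left _ L A, qf_add_right _ L L A, qf_add_right _ A L A,
      qf_comm (h.symm x hx) A L]
    ring
  rw [e, e1]
  have e2 : qf (a x) L A = t * qf (a x) L (L.comp M) + qf (a x) L (L.comp E) := by
    rw [hA, qf_add_right, qf_smul_right]
  rw [e2]
  linarith

theorem scalar_varied_density_le {C t k η d N X l P q q₁ qy qN wx wy T lN : ℝ} (hC : 0 < C)
    (hN : 0 ≤ N) (ht : 0 ≤ t)
    (hk : 0 ≤ k) (hη1 : η ≤ 1) (hη : 0 ≤ η) (hX : X ≤ k) (hX0 : 0 ≤ X) (hP : 0 ≤ P)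
    (hd : 0 ≤ d) (hd2 : d ≤ 2) (hde : |d - (1 - t * T)| ≤ η * (t * k)) (hT : |T| ≤ N * k)
    (h1 : qN ≤ q + 2 * t * q₁ + 8 * C * (t * k) ^ 2 * l)
    (h2 : qy - qN ≤ C * (t * X) * lN) (h3 : wy - wx ≤ C * (t * X)) (hl : 0 ≤ l)
    (hLN : lN ≤ (1 + 6 * (t * k)) * l) (hq : |q| ≤ C * l) (hw : |wx| ≤ C)
    (hq₁ : |q₁| ≤ C * (l * k)) :
    d * (qy / 2 + P * wy) ≤ (q / 2 + P * wx) +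
      t * (q₁ - T * (q / 2) + C / 2 * X * l + P * (C * X - T * wx)) +
      t * (η * (k * C) + t * (C * k ^ 2 * (2 * N + 18))) * (l + P) := by
  have hs := mul_nonneg ht hk
  have h4 : C * (t * X) * lN ≤ C * (t * X) * l + 6 * C * (t * k) ^ 2 * l := by
    calc C * (t * X) * lN ≤ C * (t * X) * ((1 + 6 * (t * k)) * l) := by gcongr
      _ = C * (t * X) * l + 6 * C * (t * k) * l * (t * X) := by ring
      _ ≤ C * (t * X) * l + 6 * C * (t * k) * l * (t * k) := by gcongr
      _ = _ := by ring
  obtain ⟨S0, hS0⟩ : ∃ S0, S0 = q / 2 + P * wx := ⟨_, rfl⟩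
  obtain ⟨S1, hS1⟩ : ∃ S1, S1 = q₁ + C / 2 * X * l + P * (C * X) := ⟨_, rfl⟩
  obtain ⟨G, hG⟩ : ∃ G, G = l + P := ⟨_, rfl⟩
  have hG0 : 0 ≤ G := by rw [hG]; positivity
  have hS : qy / 2 + P * wy ≤ S0 + t * S1 + 7 * C * (t * k) ^ 2 * l := by
    have : P * (wy - wx) ≤ P * (C * (t * X)) := by gcongr
    rw [hS0, hS1]
    linarith
  have hS0le : |S0| ≤ C * G := by
    have a3 := mul_le_mul_of_nonneg_left hw hP
    have a4 : 0 ≤ C * l := by positivity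
    rw [hS0, hG]
    refine (abs_add_le _ _).trans ?_
    rw [abs_div, abs_mul, abs_of_nonneg hP, abs_two]
    linarith
  have hS1le : |S1| ≤ 2 * C * k * G := by
    have a3 : C / 2 * X * l ≤ C / 2 * k * l := by gcongr
    have a4 : P * (C * X) ≤ P * (C * k) := by gcongr
    have a5 : 0 ≤ C / 2 * X * l := by positivity
    have a6 : 0 ≤ P * (C * X) := by positivity
    have a7 : 0 ≤ C * k * l := by positivity
    have a8 : 0 ≤ C * k * P := by positivity
    rw [abs_le] at hq₁ ⊢
    rw [hS1, hG]
    constructor <;> linarith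
  obtain ⟨e, he⟩ : ∃ e, e = d - (1 - t * T) := ⟨_, rfl⟩
  rw [← he] at hde
  have hd1 : |d - 1| ≤ (N + 1) * (t * k) := by
    have : d - 1 = e - t * T := by rw [he]; ring
    rw [this]
    refine (abs_sub _ _).trans ?_
    rw [abs_mul, abs_of_nonneg ht]
    have a1 : t * |T| ≤ t * (N * k) := by gcongr
    have a2 : η * (t * k) ≤ 1 * (t * k) := by gcongr
    linarith
  have r1 : e * S0 ≤ η * (t * k) * (C * G) :=
    (le_abs_self _).trans (by rw [abs_mul]; gcongr)
  have r2 : t * ((d - 1) * S1) ≤ t * ((N + 1) * (t * k) * (2 * C * k * G)) := by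
    refine mul_le_mul_of_nonneg_left ?_ ht
    exact (le_abs_self _).trans (by rw [abs_mul]; gcongr)
  have r3 : d * (7 * C * (t * k) ^ 2 * l) ≤ 2 * (7 * C * (t * k) ^ 2 * G) := by
    have : l ≤ G := by rw [hG]; linarith
    gcongr
  have r4 : d * (qy / 2 + P * wy) ≤ d * (S0 + t * S1 + 7 * C * (t * k) ^ 2 * l) :=
    mul_le_mul_of_nonneg_left hS hd
  have e5 : d * (S0 + t * S1 + 7 * C * (t * k) ^ 2 * l) =
      S0 + t * (S1 - T * S0) + e * S0 + t * ((d - 1) * S1) +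
        d * (7 * C * (t * k) ^ 2 * l) := by rw [he]; ring
  have e6 : S1 - T * S0 = q₁ - T * (q / 2) + C / 2 * X * l + P * (C * X - T * wx) := by
    rw [hS1, hS0]; ring
  rw [e6] at e5
  have e7 : 0 ≤ C * (t * k) ^ 2 * G := by positivity
  rw [← hS0, ← hG]
  linarith

theorem Coeff.varied_density_le {C₀ c₀ : ℝ} (h : Coeff c₀ C₀ a w) {x y X : Euc n}
    (hx : x ∈ ball (0 : Euc n) 1) (hy : y ∈ ball (0 : Euc n) 1)
    {k t η P d : ℝ} (ht : 0 ≤ t) (htk : t * k ≤ 1 / 2) (hk : 0 ≤ k) (hη1 : η ≤ 1) (hη : 0 ≤ η)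
    {L : Euc n →L[ℝ] ℂ} {M N : Euc n →L[ℝ] Euc n} (hX : ‖X‖ ≤ k) (hyx : y = x - t • X)
    (hM : ‖M‖ ≤ k) (hE : ‖N - 1 - t • M‖ ≤ 2 * ‖t • M‖ ^ 2)
    (hP : 0 ≤ P) (hd : 0 ≤ d) (hd2 : d ≤ 2) (hde : |d - (1 - trE (t • M))| ≤ η * ‖t • M‖) :
    d * (qf (a y) (L.comp N) (L.comp N) / 2 + P * w y) ≤
      (qf (a x) L L / 2 + P * w x) +
      t * (qf (a x) L (L.comp M) - trE M * (qf (a x) L L / 2) + C₀ / 2 * ‖X‖ * ‖L‖ ^ 2 +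
        P * (C₀ * ‖X‖ - trE M * w x)) +
      t * (η * (k * C₀) + t * (C₀ * k ^ 2 * (2 * n + 18))) * (‖L‖ ^ 2 + P) := by
  have hC := h.pos'
  have htM : ‖t • M‖ ≤ t * k := by rw [norm_smul, Real.norm_of_nonneg ht]; gcongr
  set E := N - 1 - t • M with hEdef
  have hN : N = 1 + t • M + E := by rw [hEdef]; abel
  have hE' : ‖E‖ ≤ 2 * (t * k) ^ 2 := hE.trans (by gcongr)
  have h1 := h.qf_add_add_le hx ht htk hk (L := L) hM hE'
  rw [← hN] at h1
  have hXt : ‖y - x‖ = t * ‖X‖ := by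
    rw [hyx, sub_sub_cancel_left, norm_neg, norm_smul, Real.norm_of_nonneg ht]
  have h2 := le_of_abs_le (h.lip y hy x hx (L.comp N))
  have h3 := le_of_abs_le (h.w_lip y hy x hx)
  rw [hXt] at h2 h3
  have hs := mul_nonneg ht hk
  have hNn : ‖N‖ ≤ 1 + 2 * (t * k) := by
    rw [hN]
    refine (norm_add_le _ _).trans ?_
    have := norm_add_le (1 : Euc n →L[ℝ] Euc n) (t • M)
    have h1' : ‖(1 : Euc n →L[ℝ] Euc n)‖ ≤ 1 := ContinuousLinearMap.norm_id_le
    have h2' : (t * k) * (t * k) ≤ 1 / 2 * (t * k) := by gcongr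
    linarith
  have hLN : ‖L.comp N‖ ^ 2 ≤ (1 + 6 * (t * k)) * ‖L‖ ^ 2 := by
    have : ‖L.comp N‖ ≤ (1 + 2 * (t * k)) * ‖L‖ :=
      (L.opNorm_comp_le N).trans (by rw [mul_comm]; gcongr)
    calc ‖L.comp N‖ ^ 2 ≤ ((1 + 2 * (t * k)) * ‖L‖) ^ 2 := by gcongr
      _ = (1 + 2 * (t * k)) ^ 2 * ‖L‖ ^ 2 := by ring
      _ ≤ _ := by gcongr; nlinarith
  refine scalar_varied_density_le hC (Nat.cast_nonneg n) ht hk hη1 hη hX (norm_nonneg _) hP hd hd2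
    (by rw [← trE_smul]; exact hde.trans (by gcongr)) ((abs_trE_le M).trans (by gcongr)) h1 h2 h3
    (sq_nonneg _) hLN ((h.upper x hx L L).trans_eq (by ring)) (h.abs_w_le hx)
    ((h.upper x hx L (L.comp M)).trans ?_)
  rw [mul_assoc, pow_two, mul_assoc ‖L‖]
  gcongr
  exact (L.opNorm_comp_le M).trans (by gcongr)

end

section
open NNReal ENNReal
variable {n : ℕ} {ρ c₀ C₀ ε : ℝ} {K : ℝ≥0} {X : Euc n → Euc n}
  {a : Euc n → Matrix (Fin n) (Fin n) ℝ} {w : Euc n → ℝ} {u : Euc n → ℂ}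

theorem IsVF.hasFDerivAt_comp_symm (h : IsVF ρ K X) {t : ℝ} {Ψ : Euc n ≃ₜ Euc n}
    (hΨ : ∀ x, Ψ x = x - t • X x) (hu : DifferentiableOn ℝ u (ball 0 1)) {x : Euc n}
    (hx : x ∈ ball (0 : Euc n) 1) {e : Euc n ≃L[ℝ] Euc n}
    (he : (e : Euc n →L[ℝ] Euc n) = 1 - t • fderiv ℝ X x) :
    HasFDerivAt (fun y => u (Ψ.symm y))
      ((fderiv ℝ u x).comp (e.symm : Euc n →L[ℝ] Euc n)) (Ψ x) := by
  have h1 : HasFDerivAt Ψ (e : Euc n →L[ℝ] Euc n) x := he ▸ h.hasFDerivAt_homeo hΨ x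
  have h2 : HasFDerivAt Ψ.symm (e.symm : Euc n →L[ℝ] Euc n) (Ψ x) :=
    OpenPartialHomeomorph.hasFDerivAt_symm Ψ.toOpenPartialHomeomorph (by simp)
      (by simpa using h1)
  have h3 : HasFDerivAt u (fderiv ℝ u x) (Ψ.symm (Ψ x)) := by
    rw [Ψ.symm_apply_apply]
    exact (hu.differentiableAt (isOpen_ball.mem_nhds hx)).hasFDerivAt
  exact h3.comp (Ψ x) h2

theorem WeakSol.integrableOn_sq (h : WeakSol c₀ C₀ ε a w u) :
    IntegrableOn (fun x => ‖fderiv ℝ u x‖ ^ 2) (ball 0 1) :=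
  (memLp_two_iff_integrable_sq_norm h.memLp.1).1 h.memLp

theorem WeakSol.integrableOn_pot (h : WeakSol c₀ C₀ ε a w u) :
    IntegrableOn (fun x => (1 - ‖u x‖ ^ 2) ^ 2 / (4 * ε ^ 2)) (ball 0 1) := by
  have hu := h.diff.continuousOn
  refine integrableOn_of_continuousOn_bound (C := 1 / (4 * ε ^ 2)) (by fun_prop) fun x hx => ?_
  rw [abs_div, abs_of_nonneg (show 0 ≤ 4 * ε ^ 2 by positivity), abs_pow]
  gcongr
  exact pow_le_one₀ (abs_nonneg _) (abs_one_sub_norm_sq_le (h.le_one x hx))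

theorem WeakSol.integrableOn_firstVar (h : WeakSol c₀ C₀ ε a w u) (hX : IsVF ρ K X) :
    IntegrableOn (firstVar C₀ ε a w u X) (ball 0 1) := by
  have hf : Continuous (fderiv ℝ X) := hX.contDiff.continuous_fderiv one_ne_zero
  have hXc := hX.contDiff.continuous
  have htr : Continuous fun x => trE (fderiv ℝ X x) := by unfold trE; fun_prop
  have htrb : ∀ x, ‖trE (fderiv ℝ X x)‖ ≤ n * K := fun x =>
    (abs_trE_le _).trans (by gcongr; exact hX.norm_fderiv_le x)
  have hLM : MemLp (fun x => (fderiv ℝ u x).comp (fderiv ℝ X x)) 2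
      (volume.restrict (ball 0 1)) := by
    refine MemLp.of_le_mul (c := K) h.memLp ?_ (.of_forall fun x => ?_)
    · exact (isBoundedBilinearMap_comp (𝕜 := ℝ) (E := Euc n) (F := Euc n)
        (G := ℂ)).continuous.comp_aestronglyMeasurable
        (h.memLp.1.prodMk hf.aestronglyMeasurable)
    · refine ((fderiv ℝ u x).opNorm_comp_le _).trans ?_
      rw [mul_comm]; gcongr; exact hX.norm_fderiv_le x
  have hw := h.coeff.w_continuousOn
  refine (((h.coeff.integrableOn_qf h.memLp hLM).sub ?_).add ?_).add ?_
  · exact ((h.coeff.integrableOn_qf h.memLp h.memLp).div_const 2).bdd_mul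
      htr.aestronglyMeasurable (.of_forall htrb)
  · refine h.integrableOn_sq.bdd_mul (c := C₀ / 2 * K) (by fun_prop) (.of_forall fun x => ?_)
    rw [Real.norm_of_nonneg (by have := h.coeff.pos'; positivity)]
    have := h.coeff.pos'
    gcongr
    exact hX.norm_le x
  · refine h.integrableOn_pot.mul_bdd (c := C₀ * K + n * K * C₀) ?_ ?_
    · exact ContinuousOn.aestronglyMeasurable (by have := htr.continuousOn (s := ball 0 1); fun_prop)
        measurableSet_ball
    · filter_upwards [ae_restrict_mem measurableSet_ball] with x hx
      refine (norm_sub_le _ _).trans ?_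
      have := h.coeff.pos'
      rw [Real.norm_of_nonneg (by positivity), norm_mul]
      gcongr
      · exact hX.norm_le x
      · exact htrb x
      · exact h.coeff.abs_w_le hx

/-- The inner variation inequality. -/
theorem WeakSol.integral_firstVar_nonneg (h : WeakSol c₀ C₀ ε a w u) (hX : IsVF ρ K X) :
    0 ≤ ∫ x in ball (0 : Euc n) 1, firstVar C₀ ε a w u X x := by
  have hC := h.coeff.pos'
  have hε := h.eps_pos
  obtain ⟨t₁, ht₁, ht₁'⟩ := exists_small_time n K
  set G : Euc n → ℝ := fun x => ‖fderiv ℝ u x‖ ^ 2 + (1 - ‖u x‖ ^ 2) ^ 2 / (4 * ε ^ 2) with hG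
  have hGi : IntegrableOn G (ball 0 1) := h.integrableOn_sq.add h.integrableOn_pot
  set J := ∫ x in ball (0 : Euc n) 1, ‖fderiv ℝ u x‖ ^ 2 with hJ
  set R := ∫ x in ball (0 : Euc n) 1, firstVar C₀ ε a w u X x with hR
  have main : ∀ η : ℝ, 0 < η → η ≤ 1 → ∃ δ > 0, ∀ t, 0 < t → t ≤ δ →
      0 ≤ R + (η * (K * C₀) + t * (C₀ * K ^ 2 * (2 * n + 18))) *
        (∫ x in ball (0 : Euc n) 1, G x) + t * (C₀ / (2 * ε ^ 2) * (4 * K ^ 2) * J) := by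
    intro η hη hη1
    obtain ⟨δ, hδ, hdet⟩ := exists_det_one_sub_expansion n hη
    refine ⟨min t₁ (δ / (K + 1)), by positivity, fun t ht htδ => ?_⟩
    have htt := htδ.trans (min_le_left _ _)
    have htδ' : t * K ≤ δ := by
      have := htδ.trans (min_le_right _ _)
      rw [le_div_iff₀ (by positivity)] at this
      nlinarith
    obtain ⟨htK, hd⟩ := ht₁' t ht.le htt
    obtain ⟨Ψ, hΨ⟩ := exists_homeomorph_sub_smul hX.lip ht.le htK
    have htM : ∀ x, ‖t • fderiv ℝ X x‖ ≤ t * K := fun x => by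
      rw [norm_smul, Real.norm_of_nonneg ht.le]; gcongr; exact hX.norm_fderiv_le x
    choose e he he2 heE using fun x => exists_equiv_one_sub ((htM x).trans htK)
    set v : Euc n → ℂ := fun y => u (Ψ.symm y) with hv
    have hvd : ∀ x ∈ ball (0 : Euc n) 1, HasFDerivAt v
        ((fderiv ℝ u x).comp ((e x).symm : Euc n →L[ℝ] Euc n)) (Ψ x) := fun x hx =>
      hX.hasFDerivAt_comp_symm hΨ h.diff hx (he x)
    have hsymm : ∀ y ∈ ball (0 : Euc n) 1, Ψ.symm y ∈ ball (0 : Euc n) 1 := by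
      intro y hy
      rw [← hX.image_ball hΨ] at hy
      obtain ⟨x, hx, rfl⟩ := hy
      simpa using hx
    have hvD : DifferentiableOn ℝ v (ball 0 1) := fun y hy => by
      have := (hvd _ (hsymm y hy)).differentiableAt
      rw [Ψ.apply_symm_apply] at this
      exact this.differentiableWithinAt
    have hv1 : ∀ x ∈ ball (0 : Euc n) 1, ‖v x‖ ≤ 1 := fun y hy => h.le_one _ (hsymm y hy)
    have hvm : AEStronglyMeasurable (fderiv ℝ v) (volume.restrict (ball 0 1)) :=
      (measurable_fderiv ℝ v).aestronglyMeasurable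
    have hΨd : ∀ x ∈ ball (0 : Euc n) 1, HasFDerivWithinAt Ψ (1 - t • fderiv ℝ X x)
        (ball 0 1) x := fun x _ => (hX.hasFDerivAt_homeo hΨ x).hasFDerivWithinAt
    have hdx : ∀ x, 1 / 2 ≤ (1 - t • fderiv ℝ X x).det ∧ (1 - t • fderiv ℝ X x).det ≤ 2 :=
      fun x => hd _ (hX.norm_fderiv_le x)
    have hdetm : Continuous fun x => (1 - t • fderiv ℝ X x).det := by
      have hf : Continuous (fderiv ℝ X) := hX.contDiff.continuous_fderiv one_ne_zero
      exact ContinuousLinearMap.continuous_det.comp (by fun_prop)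
    have hv2 : MemLp (fderiv ℝ v) 2 (volume.restrict (ball 0 1)) := by
      rw [memLp_two_iff_integrable_sq_norm hvm]
      change IntegrableOn _ _ _
      rw [← hX.image_ball hΨ, integrableOn_image_iff_integrableOn_abs_det_fderiv_smul volume
        measurableSet_ball hΨd Ψ.injective.injOn]
      refine Integrable.mono' (h.integrableOn_sq.const_mul 8) ?_ ?_
      · refine AEStronglyMeasurable.smul hdetm.abs.aestronglyMeasurable ?_
        exact (((measurable_fderiv ℝ v).norm.pow_const 2).comp
          Ψ.measurable).aestronglyMeasurable
      · filter_upwards [ae_restrict_mem measurableSet_ball] with x hx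
        have hb : ‖fderiv ℝ v (Ψ x)‖ ≤ 2 * ‖fderiv ℝ u x‖ := by
          rw [(hvd x hx).fderiv]
          refine ((fderiv ℝ u x).opNorm_comp_le _).trans ?_
          rw [mul_comm]; gcongr; exact he2 x
        rw [norm_smul, Real.norm_eq_abs, abs_abs, abs_of_pos (by linarith [(hdx x).1]),
          Real.norm_of_nonneg (by positivity)]
        calc _ ≤ 2 * (2 * ‖fderiv ℝ u x‖) ^ 2 := by
              gcongr; exact (hdx x).2
          _ = _ := by ring
    have hen := h.energy_le hX.lt_one hvD hv1 hv2 fun x hx => by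
      rw [hv]; simp only
      rw [Ψ.symm_eq_self_of_forall_notMem (hX.homeo_eq hΨ) hx]
    have hdiff : ∫ x in ball (0 : Euc n) 1, ‖v x - u x‖ ^ 2 ≤ 4 * (t * K) ^ 2 * J := by
      have h1 := hX.lintegral_sub_sq_le h.diff ht₁' ht.le htt hΨ
      have h2 : ∀ f : Euc n → ℝ, ∀ x, 0 ≤ f x ^ 2 := fun f x => sq_nonneg _
      have hcv : ContinuousOn (fun x => ‖v x - u x‖ ^ 2) (ball 0 1) := by
        have := h.diff.continuousOn
        have := hvD.continuousOn
        fun_prop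
      rw [integral_eq_lintegral_of_nonneg_ae (.of_forall fun x => sq_nonneg _)
        (hcv.aestronglyMeasurable measurableSet_ball)]
      refine ENNReal.toReal_le_of_le_ofReal (by positivity) ?_
      rw [ENNReal.ofReal_mul (by positivity), hJ, ofReal_integral_eq_lintegral_ofReal
        h.integrableOn_sq (.of_forall fun x => sq_nonneg _)]
      simpa only [ENNReal.ofReal_pow (norm_nonneg _), ofReal_norm] using h1
    have hcv : ∫ x in ball (0 : Euc n) 1, enDen ε a w v x =
        ∫ x in ball (0 : Euc n) 1, |(1 - t • fderiv ℝ X x).det| • enDen ε a w v (Ψ x) := by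
      conv_lhs => rw [← hX.image_ball hΨ]
      exact integral_image_eq_integral_abs_det_fderiv_smul volume measurableSet_ball hΨd
        Ψ.injective.injOn _
    have hi := h.coeff.integrableOn_enDen h.diff.continuousOn h.le_one h.memLp ε
    have hle : ∫ x in ball (0 : Euc n) 1, |(1 - t • fderiv ℝ X x).det| • enDen ε a w v (Ψ x) ≤
        ∫ x in ball (0 : Euc n) 1, (enDen ε a w u x + t * firstVar C₀ ε a w u X x +
          t * (η * (K * C₀) + t * (C₀ * K ^ 2 * (2 * n + 18))) * G x) := by
      refine setIntegral_mono_on ?_ ?_ measurableSet_ball fun x hx => ?_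
      · rw [← integrableOn_image_iff_integrableOn_abs_det_fderiv_smul volume
          measurableSet_ball hΨd Ψ.injective.injOn, hX.image_ball hΨ]
        exact h.coeff.integrableOn_enDen hvD.continuousOn hv1 hv2 ε
      · exact (hi.add ((h.integrableOn_firstVar hX).const_mul _)).add (hGi.const_mul _)
      · have hvx : v (Ψ x) = u x := by simp [hv]
        rw [enDen, (hvd x hx).fderiv, hvx, smul_eq_mul,
          abs_of_pos (by linarith [(hdx x).1])]
        refine h.coeff.varied_density_le hx (hX.mapsTo_ball hΨ hx) ht.le htK K.2 hη1 hη.le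
          (hX.norm_le x) (hΨ x) (hX.norm_fderiv_le x) (heE x) (by positivity)
          (by linarith [(hdx x).1]) (hdx x).2 (hdet _ ((htM x).trans htδ'))
    rw [integral_add (f := fun x => enDen ε a w u x + t * firstVar C₀ ε a w u X x)
        (hi.add ((h.integrableOn_firstVar hX).const_mul _)) (hGi.const_mul _),
      integral_add hi ((h.integrableOn_firstVar hX).const_mul _), integral_const_mul,
      integral_const_mul, ← hcv] at hle
    have h3 : C₀ / (2 * ε ^ 2) * (∫ x in ball (0 : Euc n) 1, ‖v x - u x‖ ^ 2) ≤
        C₀ / (2 * ε ^ 2) * (4 * (t * K) ^ 2 * J) := by gcongr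
    rw [← hR] at hle
    refine nonneg_of_mul_nonneg_right (b := _) (a := t) ?_ ht
    nlinarith
  set I := ∫ x in ball (0 : Euc n) 1, G x with hI
  have step : ∀ η : ℝ, 0 < η → η ≤ 1 → 0 ≤ R + η * (K * C₀) * I := by
    intro η hη hη1
    obtain ⟨δ, hδ, hm⟩ := main η hη hη1
    have hc : Filter.Tendsto (fun t : ℝ => R + (η * (K * C₀) +
        t * (C₀ * K ^ 2 * (2 * n + 18))) * I + t * (C₀ / (2 * ε ^ 2) * (4 * K ^ 2) * J))
        (nhdsWithin 0 (Set.Ioi 0)) (nhds (R + (η * (K * C₀) +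
        0 * (C₀ * K ^ 2 * (2 * n + 18))) * I + 0 * (C₀ / (2 * ε ^ 2) * (4 * K ^ 2) * J))) := by
      refine (Continuous.tendsto ?_ 0).mono_left nhdsWithin_le_nhds
      fun_prop
    have := ge_of_tendsto hc (by
      filter_upwards [Ioc_mem_nhdsGT hδ] with t ht using hm t ht.1 ht.2)
    simpa using this
  have hc : Filter.Tendsto (fun η : ℝ => R + η * (K * C₀) * I)
      (nhdsWithin 0 (Set.Ioi 0)) (nhds (R + 0 * (K * C₀) * I)) := by
    refine (Continuous.tendsto ?_ 0).mono_left nhdsWithin_le_nhds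
    fun_prop
  have := ge_of_tendsto hc (by
    filter_upwards [Ioc_mem_nhdsGT one_pos] with t ht using step t ht.1 ht.2)
  simpa using this

end

section
variable {n : ℕ} {c₀ C₀ ε : ℝ} {a : Euc n → Matrix (Fin n) (Fin n) ℝ} {w : Euc n → ℝ}

/-- The rank one endomorphism `v ↦ ⟨x, v⟩ x`. -/
def rankOneSelf (x : Euc n) : Euc n →L[ℝ] Euc n := (innerSL ℝ x).smulRight x

theorem rankOneSelf_apply (x v : Euc n) : rankOneSelf x v = inner ℝ x v • x := rfl

theorem norm_rankOneSelf_le (x : Euc n) : ‖rankOneSelf x‖ ≤ ‖x‖ ^ 2 := by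
  rw [rankOneSelf, ContinuousLinearMap.norm_smulRight_apply, innerSL_apply_norm, pow_two]

theorem trE_add (M N : Euc n →L[ℝ] Euc n) : trE (M + N) = trE M + trE N := by
  simp [trE, Finset.sum_add_distrib]

theorem trE_radial (f θ : ℝ) (x : Euc n) :
    trE (f • (1 : Euc n →L[ℝ] Euc n) + θ • rankOneSelf x) = n * f + θ * ‖x‖ ^ 2 := by
  rw [trE_add, trE_smul, trE_smul, EuclideanSpace.norm_sq_eq]
  simp [trE, rankOneSelf_apply, EuclideanSpace.inner_single_right, pow_two, mul_comm]

theorem qf_rankOneSelf {a : Matrix (Fin n) (Fin n) ℝ} {w : ℝ} {x y : Euc n}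
    (hy : ∀ i, w * y i = ∑ j, a i j * x j) (L : Euc n →L[ℝ] ℂ) :
    qf a L (L.comp (rankOneSelf x)) = w * rdot (L y) (L x) := by
  have e1 : w * rdot (L y) (L x) = rdot (L (w • y)) (L x) := by simp [rdot]; ring
  rw [e1, eq_sum_single (w • y), map_sum, rdot_sum_left, qf]
  refine Finset.sum_congr rfl fun i _ => ?_
  rw [map_smul, PiLp.smul_apply, smul_eq_mul, hy i, Complex.real_smul, rdot_smul_left,
    Finset.sum_mul]
  refine Finset.sum_congr rfl fun j _ => ?_
  simp [rankOneSelf_apply, EuclideanSpace.inner_single_right, rdot]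
  ring

theorem qf_comp_radial (a : Matrix (Fin n) (Fin n) ℝ) (L : Euc n →L[ℝ] ℂ) (f θ : ℝ) (x : Euc n) :
    qf a L (L.comp (f • (1 : Euc n →L[ℝ] Euc n) + θ • rankOneSelf x)) =
      f * qf a L L + θ * qf a L (L.comp (rankOneSelf x)) := by
  have : L.comp (f • (1 : Euc n →L[ℝ] Euc n) + θ • rankOneSelf x) =
      f • L + θ • L.comp (rankOneSelf x) := by ext v; simp
  rw [this, qf_add_right, qf_smul_right, qf_smul_right]

theorem radial_scalar_bound {c C p K A q r f θ Q V e l P w : ℝ} (hc : 0 < c) (hC : 0 < C)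
    (hp : 1 ≤ p) (hK : 0 < K) (hA : 0 < A) (hq : 0 < q) (hr : 0 ≤ r) (hrq : r ≤ q)
    (hKq : K * q ≤ 1) (hf : f = A * (1 + K * q))
    (hθ : θ = -(A / q ^ 2 * (p + K * (p - 1) * q)))
    (hl : 0 ≤ l) (hQ : c * l ≤ Q) (hV : 0 ≤ V) (he : |e| ≤ C * (1 + C) * r ^ 3 * l)
    (hP : 0 ≤ P) (hw : c ≤ w) (hw' : w ≤ C)
    (hK1 : 2 * p * C ^ 2 * (1 + C) + C ≤ K * c / 2) (hK2 : 2 * C ≤ K * c) :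
    f * Q + θ * (w * (V - e)) - ((p + 2) * f + θ * r ^ 2) * (Q / 2) + C / 2 * (f * r) * l +
      P * (C * (f * r) - ((p + 2) * f + θ * r ^ 2) * w) ≤ -(c * A * (V / q ^ 2 + P)) := by
  have hwpos : 0 < w := hc.trans_le hw
  have hp1 : 0 ≤ p - 1 := by linarith
  have hf1 : f ≤ 2 * A := by rw [hf]; nlinarith
  have hf0 : A ≤ f := by rw [hf]; nlinarith [mul_nonneg hA.le (mul_nonneg hK.le hq.le)]
  have hfpos : 0 < f := hA.trans_le hf0
  have hrr : r ^ 2 ≤ q ^ 2 := by gcongr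
  have hσ : r ^ 2 / q ^ 2 ≤ 1 := div_le_one_of_le₀ hrr (by positivity)
  have hB : 0 ≤ p + K * (p - 1) * q := by positivity
  have hB2 : p + K * (p - 1) * q ≤ 2 * p := by nlinarith [mul_le_mul_of_nonneg_right hKq hp1]
  have hB1 : 1 ≤ p + K * (p - 1) * q := by
    have : 0 ≤ K * (p - 1) * q := by positivity
    linarith
  have hθr : -(A * (p + K * (p - 1) * q)) ≤ θ * r ^ 2 := by
    have : θ * r ^ 2 = -(A * (p + K * (p - 1) * q) * (r ^ 2 / q ^ 2)) := by
      rw [hθ]; field_simp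
    rw [this, neg_le_neg_iff]
    exact mul_le_of_le_one_right (by positivity) hσ
  have hdiv : A * K * q ≤ p * f + θ * r ^ 2 := by
    rw [hf]; linarith
  have t1 : A * K * q * (c * l) ≤ (p * f + θ * r ^ 2) * Q := by
    have a1 : 0 ≤ A * K * q := by positivity
    have a2 : 0 ≤ c * l := by positivity
    exact mul_le_mul hdiv hQ a2 (a1.trans hdiv)
  have t2 : θ * (w * V) ≤ -(c * A * (V / q ^ 2)) := by
    have e1 : θ * (w * V) = -(A * (V / q ^ 2) * ((p + K * (p - 1) * q) * w)) := by
      rw [hθ]; field_simp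
    have e2 : c ≤ (p + K * (p - 1) * q) * w := by nlinarith
    rw [e1, neg_le_neg_iff]
    calc c * A * (V / q ^ 2) = A * (V / q ^ 2) * c := by ring
      _ ≤ _ := by gcongr
  have t3 : -(θ * (w * e)) ≤ A * q * l * (2 * p * C ^ 2 * (1 + C)) := by
    have e1 : -(θ * (w * e)) = A / q ^ 2 * (p + K * (p - 1) * q) * w * e := by rw [hθ]; ring
    rw [e1]
    calc A / q ^ 2 * (p + K * (p - 1) * q) * w * e
        ≤ A / q ^ 2 * (p + K * (p - 1) * q) * w * (C * (1 + C) * r ^ 3 * l) := by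
          gcongr
          exact (le_abs_self e).trans he
      _ ≤ A / q ^ 2 * (2 * p) * C * (C * (1 + C) * q ^ 3 * l) := by gcongr
      _ = _ := by field_simp
  have t4 : C / 2 * (f * r) * l ≤ A * q * l * C := by
    calc C / 2 * (f * r) * l ≤ C / 2 * (2 * A * q) * l := by gcongr
      _ = _ := by ring
  have t5 : A * q * l * (2 * p * C ^ 2 * (1 + C) + C) ≤ A * q * l * (K * c / 2) := by gcongr
  have t6 : C * (f * r) - ((p + 2) * f + θ * r ^ 2) * w ≤ -(c * A) := by
    have a1 : A * (1 + K * q) ≤ (p + 2) * f + θ * r ^ 2 := by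
      have : 0 ≤ A * K * q := by positivity
      linarith
    have a2 : A * (1 + K * q) * c ≤ ((p + 2) * f + θ * r ^ 2) * w := by
      have : 0 ≤ A * (1 + K * q) := by positivity
      exact mul_le_mul a1 hw hc.le (this.trans a1)
    have a3 : C * (f * r) ≤ C * (2 * A * q) := by gcongr
    have a4 : A * q * (2 * C) ≤ A * q * (K * c) := by gcongr
    linarith
  have t7 := mul_le_mul_of_nonneg_left t6 hP
  linarith

theorem Coeff.radial_pointwise_le (h : Coeff c₀ C₀ a w) {x y X : Euc n}
    (hx : x ∈ ball (0 : Euc n) 1) (hy : ∀ i, w x * y i = ∑ j, a x i j * x j)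
    (hyx : ‖y - x‖ ≤ C₀ * ‖x‖ ^ 2) {p K A q f θ P : ℝ} (hpn : (n : ℝ) = p + 2)
    (hp : 1 ≤ p) (hK : 0 < K) (hA : 0 < A) (hq : 0 < q) (hrq : ‖x‖ ≤ q)
    (hKq : K * q ≤ 1) (hf : f = A * (1 + K * q))
    (hθ : θ = -(A / q ^ 2 * (p + K * (p - 1) * q))) (hP : 0 ≤ P)
    (hK1 : 2 * p * C₀ ^ 2 * (1 + C₀) + C₀ ≤ K * c₀ / 2) (hK2 : 2 * C₀ ≤ K * c₀)
    {M : Euc n →L[ℝ] Euc n} (hM : M = f • 1 + θ • rankOneSelf x) (hX : X = f • x)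
    (L : Euc n →L[ℝ] ℂ) :
    qf (a x) L (L.comp M) - trE M * (qf (a x) L L / 2) + C₀ / 2 * ‖X‖ * ‖L‖ ^ 2 +
        P * (C₀ * ‖X‖ - trE M * w x) ≤ -(c₀ * A * (‖L y‖ ^ 2 / q ^ 2 + P)) := by
  have hC := h.pos'
  have hf0 : 0 ≤ f := by rw [hf]; positivity
  have hXn : ‖X‖ = f * ‖x‖ := by rw [hX, norm_smul, Real.norm_of_nonneg hf0]
  have e1 : rdot (L y) (L x) = ‖L y‖ ^ 2 - rdot (L y) (L (y - x)) := by
    simp only [map_sub, rdot, Complex.sq_norm, Complex.normSq_apply, Complex.sub_re,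
      Complex.sub_im]
    ring
  rw [hXn, hM, trE_radial, qf_comp_radial, qf_rankOneSelf hy, hpn, e1]
  refine radial_scalar_bound h.pos hC hp hK hA hq (norm_nonneg x) hrq hKq hf hθ (sq_nonneg _)
    (h.lower x hx L) (sq_nonneg _) ((abs_rdot_le _ _).trans ?_) hP (h.w_lower x hx)
    (h.w_upper x hx) hK1 hK2
  have hx1 : ‖x‖ ≤ 1 := (mem_ball_zero_iff.1 hx).le
  have hyn : ‖y‖ ≤ (1 + C₀) * ‖x‖ := by
    have := norm_le_norm_add_norm_sub x y
    rw [norm_sub_rev] at this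
    have h2 : C₀ * ‖x‖ ^ 2 ≤ C₀ * ‖x‖ := by
      rw [pow_two]; exact mul_le_mul_of_nonneg_left
        (mul_le_of_le_one_left (norm_nonneg _) hx1) hC.le
    linarith
  calc ‖L y‖ * ‖L (y - x)‖ ≤ (‖L‖ * ‖y‖) * (‖L‖ * ‖y - x‖) := by
        gcongr <;> exact L.le_opNorm _
    _ ≤ (‖L‖ * ((1 + C₀) * ‖x‖)) * (‖L‖ * (C₀ * ‖x‖ ^ 2)) := by gcongr
    _ = _ := by ring

end

section
variable {n : ℕ}

/-- The reciprocal of the regularised radius `√(|x|² + s²)`. -/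
def invRad (s : ℝ) (x : Euc n) : ℝ := (Real.sqrt (‖x‖ ^ 2 + s ^ 2))⁻¹

theorem invRad_pos {s : ℝ} (hs : 0 < s) (x : Euc n) : 0 < invRad s x := by
  rw [invRad]; positivity

theorem continuous_invRad {s : ℝ} (hs : 0 < s) : Continuous (invRad s : Euc n → ℝ) := by
  unfold invRad
  refine Continuous.inv₀ (by fun_prop) fun x => ?_
  positivity

theorem invRad_le (s : ℝ) (x : Euc n) {m : ℝ} (hm : 0 < m)
    (h : m ^ 2 ≤ ‖x‖ ^ 2 + s ^ 2) : invRad s x ≤ m⁻¹ := by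
  rw [invRad]
  gcongr
  exact Real.le_sqrt_of_sq_le h

theorem contDiff_invRad {s : ℝ} (hs : 0 < s) : ContDiff ℝ 1 (invRad s : Euc n → ℝ) := by
  unfold invRad
  refine ContDiff.inv (ContDiff.sqrt ?_ fun x => ?_) fun x => ?_
  · exact (contDiff_norm_sq ℝ).add contDiff_const
  · positivity
  · positivity

theorem hasFDerivAt_invRad {s : ℝ} (hs : 0 < s) (x : Euc n) :
    HasFDerivAt (invRad s) ((-(invRad s x) ^ 3) • innerSL ℝ x) x := by
  have h1 : HasFDerivAt (fun x : Euc n => ‖x‖ ^ 2 + s ^ 2) (2 • innerSL ℝ x) x :=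
    (hasStrictFDerivAt_norm_sq x).hasFDerivAt.add_const _
  have hpos : 0 < ‖x‖ ^ 2 + s ^ 2 := by positivity
  have h2 := (h1.sqrt hpos.ne')
  have h3 : HasFDerivAt (invRad s) _ x :=
    (hasDerivAt_inv (Real.sqrt_pos.2 hpos).ne').comp_hasFDerivAt x h2
  refine h3.congr_fderiv ?_
  ext v
  simp [invRad]
  field_simp

/-- The profile of the radial multiplier. -/
def profile (k : ℕ) (K s : ℝ) (x : Euc n) : ℝ :=
  invRad s x ^ (k + 1) + K * invRad s x ^ k

/-- The radial derivative of the profile, divided by the radius. -/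
def profileSlope (k : ℕ) (K s : ℝ) (x : Euc n) : ℝ :=
  -((k + 1) * invRad s x ^ (k + 3) + K * (k * invRad s x ^ (k + 2)))

theorem contDiff_profile (k : ℕ) (K : ℝ) {s : ℝ} (hs : 0 < s) :
    ContDiff ℝ 1 (profile k K s : Euc n → ℝ) := by
  have := contDiff_invRad (n := n) hs
  unfold profile
  fun_prop

theorem hasFDerivAt_profile (k : ℕ) (K : ℝ) {s : ℝ} (hs : 0 < s) (x : Euc n) :
    HasFDerivAt (profile k K s) (profileSlope k K s x • innerSL ℝ x) x := by
  have h := hasFDerivAt_invRad hs x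
  have h2 : HasFDerivAt (profile k K s) _ x := (h.pow (k + 1)).add ((h.pow k).const_mul K)
  refine h2.congr_fderiv ?_
  ext v
  rcases k with _ | k
  · simp [profileSlope]
  · simp [profileSlope]; ring

theorem hasFDerivAt_profile_smul (k : ℕ) (K : ℝ) {s : ℝ} (hs : 0 < s) (x : Euc n) :
    HasFDerivAt (fun x : Euc n => profile k K s x • x)
      (profile k K s x • 1 + profileSlope k K s x • rankOneSelf x) x := by
  have h := (hasFDerivAt_profile k K hs x).smul (hasFDerivAt_id x)
  refine h.congr_fderiv ?_
  ext v
  simp [rankOneSelf_apply, smul_smul]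

theorem profile_nonneg (k : ℕ) {K s : ℝ} (hK : 0 ≤ K) (hs : 0 < s) (x : Euc n) :
    0 ≤ profile k K s x := by
  have := invRad_pos hs x
  unfold profile; positivity

theorem profile_bounds (k : ℕ) {K s m : ℝ} (hK : 0 ≤ K) (hs : 0 < s) (hm : 0 < m) (hm1 : m ≤ 1)
    {x : Euc n} (hx : x ∈ ball (0 : Euc n) 1) (h : m ^ 2 ≤ ‖x‖ ^ 2 + s ^ 2) :
    ‖profile k K s x • x‖ ≤ (k + 1) * (1 + K) * m⁻¹ ^ (k + 3) ∧
    ‖profile k K s x • (1 : Euc n →L[ℝ] Euc n) + profileSlope k K s x • rankOneSelf x‖ ≤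
      2 * ((k + 1) * (1 + K) * m⁻¹ ^ (k + 3)) := by
  have hx1 : ‖x‖ ≤ 1 := (mem_ball_zero_iff.1 hx).le
  have h0 := invRad_pos hs x
  have h1 := invRad_le s x hm h
  have h2 : 1 ≤ m⁻¹ := (one_le_inv₀ hm).2 hm1
  have hb : ∀ j, j ≤ k + 3 → invRad s x ^ j ≤ m⁻¹ ^ (k + 3) := fun j hj =>
    (pow_le_pow_left₀ h0.le h1 j).trans (pow_le_pow_right₀ h2 hj)
  have hB : 0 ≤ m⁻¹ ^ (k + 3) := by positivity
  have hf : |profile k K s x| ≤ (k + 1) * (1 + K) * m⁻¹ ^ (k + 3) := by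
    rw [abs_of_nonneg (profile_nonneg k hK hs x), profile]
    calc _ ≤ m⁻¹ ^ (k + 3) + K * m⁻¹ ^ (k + 3) := by
          gcongr <;> exact hb _ (by lia)
      _ = 1 * (1 + K) * m⁻¹ ^ (k + 3) := by ring
      _ ≤ _ := by gcongr; linarith [Nat.cast_nonneg (α := ℝ) k]
  have hθ : |profileSlope k K s x| ≤ (k + 1) * (1 + K) * m⁻¹ ^ (k + 3) := by
    rw [profileSlope, abs_neg, abs_of_nonneg (by positivity)]
    calc _ ≤ (k + 1) * m⁻¹ ^ (k + 3) + K * (k * m⁻¹ ^ (k + 3)) := by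
          gcongr
          exact hb _ (by lia)
      _ ≤ _ := by nlinarith [mul_nonneg hK hB]
  constructor
  · rw [norm_smul, Real.norm_eq_abs]
    exact (mul_le_of_le_one_right (abs_nonneg _) hx1).trans hf
  · refine (norm_add_le _ _).trans ?_
    rw [norm_smul, norm_smul, two_mul, Real.norm_eq_abs, Real.norm_eq_abs]
    refine add_le_add ((mul_le_of_le_one_right (abs_nonneg _)
      ContinuousLinearMap.norm_id_le).trans hf)
      ((mul_le_of_le_one_right (abs_nonneg _) ?_).trans hθ)
    exact (norm_rankOneSelf_le x).trans (pow_le_one₀ (norm_nonneg _) hx1)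

open NNReal in
theorem exists_isVF_of_hasCompactSupport {X : Euc n → Euc n} (hX : ContDiff ℝ 1 X) {ρ : ℝ}
    (hρ : ρ < 1) (h0 : ∀ x, x ∉ closedBall (0 : Euc n) ρ → X x = 0) : ∃ K : ℝ≥0, IsVF ρ K X := by
  have hc : HasCompactSupport X :=
    HasCompactSupport.intro (isCompact_closedBall 0 ρ) fun x hx => h0 x hx
  obtain ⟨K₁, hK₁⟩ := hX.lipschitzWith_of_hasCompactSupport hc one_ne_zero
  obtain ⟨K₂, hK₂⟩ := hX.continuous.bounded_above_of_compact_support hc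
  refine ⟨max K₁ K₂.toNNReal, hρ, hX, hK₁.weaken (le_max_left _ _), fun x => ?_, h0⟩
  exact (hK₂ x).trans ((Real.le_coe_toNNReal K₂).trans (by exact_mod_cast le_max_right _ _))

end

section
open NNReal
variable {n : ℕ} {c₀ C₀ ε : ℝ} {a : Euc n → Matrix (Fin n) (Fin n) ℝ} {w : Euc n → ℝ}
  {u : Euc n → ℂ}

theorem Coeff.firstVar_le (h : Coeff c₀ C₀ a w) {X : Euc n → Euc n} {x : Euc n}
    (hx : x ∈ ball (0 : Euc n) 1) {B : ℝ} (hX : ‖X x‖ ≤ B) (hDX : ‖fderiv ℝ X x‖ ≤ B) :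
    firstVar C₀ ε a w u X x ≤
      B * C₀ * (n + 2) * (‖fderiv ℝ u x‖ ^ 2 + (1 - ‖u x‖ ^ 2) ^ 2 / (4 * ε ^ 2)) := by
  have hB : 0 ≤ B := (norm_nonneg _).trans hX
  have hC := h.pos'.le
  have hn : (0 : ℝ) ≤ n := n.cast_nonneg
  have hT : |trE (fderiv ℝ X x)| ≤ n * B := (abs_trE_le _).trans (by gcongr)
  have hP : 0 ≤ (1 - ‖u x‖ ^ 2) ^ 2 / (4 * ε ^ 2) := by positivity
  have h1 : qf (a x) (fderiv ℝ u x) ((fderiv ℝ u x).comp (fderiv ℝ X x)) ≤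
      B * C₀ * ‖fderiv ℝ u x‖ ^ 2 := by
    refine (le_of_abs_le (h.upper x hx _ _)).trans ?_
    calc _ ≤ C₀ * ‖fderiv ℝ u x‖ * (‖fderiv ℝ u x‖ * B) := by
          gcongr; exact ((fderiv ℝ u x).opNorm_comp_le _).trans (by gcongr)
      _ = _ := by ring
  have h2 : -(trE (fderiv ℝ X x) * (qf (a x) (fderiv ℝ u x) (fderiv ℝ u x) / 2)) ≤
      n * B * (C₀ * ‖fderiv ℝ u x‖ ^ 2 / 2) := by
    refine (neg_le_abs _).trans ?_
    rw [abs_mul, abs_div, abs_two]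
    have := h.upper x hx (fderiv ℝ u x) (fderiv ℝ u x)
    rw [mul_assoc, ← pow_two] at this
    gcongr
  have h3 : C₀ / 2 * ‖X x‖ * ‖fderiv ℝ u x‖ ^ 2 ≤ C₀ / 2 * B * ‖fderiv ℝ u x‖ ^ 2 := by gcongr
  have h4 : C₀ * ‖X x‖ - trE (fderiv ℝ X x) * w x ≤ C₀ * B + n * B * C₀ := by
    have : -(trE (fderiv ℝ X x) * w x) ≤ n * B * C₀ := by
      refine (neg_le_abs _).trans ?_
      rw [abs_mul]
      exact mul_le_mul hT (h.abs_w_le hx) (abs_nonneg _) (by positivity)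
    have : C₀ * ‖X x‖ ≤ C₀ * B := by gcongr
    linarith
  have h5 := mul_le_mul_of_nonneg_left h4 hP
  rw [firstVar]
  have e1 : 0 ≤ B * C₀ * ((n : ℝ) + 1) * ‖fderiv ℝ u x‖ ^ 2 := by positivity
  have e2 : 0 ≤ B * C₀ * ((1 - ‖u x‖ ^ 2) ^ 2 / (4 * ε ^ 2)) := by positivity
  linarith

/-- The integrand controlled by the monotonicity argument. -/
def radialDensity (k : ℕ) (s ε : ℝ) (u : Euc n → ℂ) (y : Euc n → Euc n) (x : Euc n) : ℝ :=
  invRad s x ^ (k + 1) * (‖fderiv ℝ u x (y x)‖ ^ 2 * invRad s x ^ 2 +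
    (1 - ‖u x‖ ^ 2) ^ 2 / (4 * ε ^ 2))

theorem radialDensity_le (k : ℕ) (hC : 0 ≤ C₀) {s m : ℝ} (hs : 0 < s) (hm : 0 < m) (hm1 : m ≤ 1)
    {y : Euc n → Euc n} {x : Euc n}
    (hx : x ∈ ball (0 : Euc n) 1) (hyx : ‖y x - x‖ ≤ C₀ * ‖x‖ ^ 2)
    (h : m ^ 2 ≤ ‖x‖ ^ 2 + s ^ 2) :
    radialDensity k s ε u y x ≤ m⁻¹ ^ (k + 3) * (1 + C₀) ^ 2 *
      (‖fderiv ℝ u x‖ ^ 2 + (1 - ‖u x‖ ^ 2) ^ 2 / (4 * ε ^ 2)) := by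
  have hx1 : ‖x‖ ≤ 1 := (mem_ball_zero_iff.1 hx).le
  have h0 := invRad_pos hs x
  have h1 := invRad_le s x hm h
  have h2 : 1 ≤ m⁻¹ := (one_le_inv₀ hm).2 hm1
  have hP : 0 ≤ (1 - ‖u x‖ ^ 2) ^ 2 / (4 * ε ^ 2) := by positivity
  have hy : ‖y x‖ ≤ 1 + C₀ := by
    have := norm_le_norm_add_norm_sub x (y x)
    rw [norm_sub_rev] at this
    have h2 : C₀ * ‖x‖ ^ 2 ≤ C₀ := mul_le_of_le_one_right hC (pow_le_one₀ (norm_nonneg _) hx1)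
    linarith
  have h3 : ‖fderiv ℝ u x (y x)‖ ≤ ‖fderiv ℝ u x‖ * (1 + C₀) :=
    ((fderiv ℝ u x).le_opNorm _).trans (by gcongr)
  have h4 : 1 ≤ (1 + C₀) ^ 2 := one_le_pow₀ (by linarith)
  have h5 : 1 ≤ m⁻¹ ^ 2 := one_le_pow₀ h2
  calc radialDensity k s ε u y x ≤ m⁻¹ ^ (k + 1) * ((‖fderiv ℝ u x‖ * (1 + C₀)) ^ 2 * m⁻¹ ^ 2 +
        m⁻¹ ^ 2 * (1 + C₀) ^ 2 * ((1 - ‖u x‖ ^ 2) ^ 2 / (4 * ε ^ 2))) := by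
        rw [radialDensity]
        gcongr
        exact le_mul_of_one_le_left hP (one_le_mul_of_one_le_of_one_le h5 h4)
    _ = _ := by ring

theorem radialDensity_nonneg (k : ℕ) {s : ℝ} (hs : 0 < s) (y : Euc n → Euc n) (x : Euc n) :
    0 ≤ radialDensity k s ε u y x := by
  have := invRad_pos hs x
  rw [radialDensity]; positivity

theorem Coeff.continuousOn_of_eq (h : Coeff c₀ C₀ a w) {y : Euc n → Euc n}
    (hy : ∀ x ∈ ball (0 : Euc n) 1, ∀ i, w x * y x i = ∑ j, a x i j * x j) :
    ContinuousOn y (ball 0 1) := by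
  have hw := h.w_continuousOn
  have hpos : ∀ x ∈ ball (0 : Euc n) 1, w x ≠ 0 := fun x hx =>
    (h.pos.trans_le (h.w_lower x hx)).ne'
  have h1 : ContinuousOn
      (fun x : Euc n => (WithLp.toLp 2 fun i => (w x)⁻¹ * ∑ j, a x i j * x j : Euc n))
      (ball 0 1) := by
    refine (PiLp.continuous_toLp 2 _).comp_continuousOn (continuousOn_pi.2 fun i => ?_)
    refine (hw.inv₀ hpos).mul (continuousOn_finsetSum _ fun j _ => (h.cont i j).mul ?_)
    fun_prop
  refine h1.congr fun x hx => ?_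
  ext i
  simp only [← hy x hx i]
  field_simp [hpos x hx]

theorem WeakSol.integrableOn_radialDensity (h : WeakSol c₀ C₀ ε a w u) {y : Euc n → Euc n}
    (hy : ∀ x ∈ ball (0 : Euc n) 1, ∀ i, w x * y x i = ∑ j, a x i j * x j)
    (hyx : ∀ x ∈ ball (0 : Euc n) 1, ‖y x - x‖ ≤ C₀ * ‖x‖ ^ 2) (k : ℕ) {s : ℝ} (hs : 0 < s)
    (hs1 : s ≤ 1) : IntegrableOn (radialDensity k s ε u y) (ball 0 1) := by
  have hyc := h.coeff.continuousOn_of_eq hy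
  refine ((h.integrableOn_sq.add h.integrableOn_pot).const_mul
    (s⁻¹ ^ (k + 3) * (1 + C₀) ^ 2)).mono' ?_ ?_
  · have h1 : AEStronglyMeasurable (fun x => fderiv ℝ u x (y x)) (volume.restrict (ball 0 1)) :=
      isBoundedBilinearMap_apply.continuous.comp_aestronglyMeasurable
        (h.memLp.1.prodMk (hyc.aestronglyMeasurable measurableSet_ball))
    have h2 := (continuous_invRad (n := n) hs).aestronglyMeasurable
      (μ := volume.restrict (ball 0 1))
    exact (h2.pow _).mul (((h1.norm.pow 2).mul (h2.pow 2)).add h.integrableOn_pot.1)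
  · filter_upwards [ae_restrict_mem measurableSet_ball] with x hx
    rw [Real.norm_of_nonneg (radialDensity_nonneg k hs y x)]
    exact radialDensity_le k h.coeff.pos'.le hs hs hs1 hx (hyx x hx)
      (le_add_of_nonneg_left (sq_nonneg _))

theorem WeakSol.integral_add_le (h : WeakSol c₀ C₀ ε a w u) :
    ∫ x in ball (0 : Euc n) 1, (‖fderiv ℝ u x‖ ^ 2 + (1 - ‖u x‖ ^ 2) ^ 2 / (4 * ε ^ 2)) ≤
      2 / c₀ * ∫ x in ball (0 : Euc n) 1, enDen ε a w u x := by
  have hc := h.coeff.pos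
  rw [← integral_const_mul]
  refine setIntegral_mono_on (h.integrableOn_sq.add h.integrableOn_pot)
    ((h.coeff.integrableOn_enDen h.diff.continuousOn h.le_one h.memLp ε).const_mul _)
    measurableSet_ball fun x hx => ?_
  have h1 := h.coeff.lower x hx (fderiv ℝ u x)
  have h2 := h.coeff.w_lower x hx
  have hP : 0 ≤ (1 - ‖u x‖ ^ 2) ^ 2 / (4 * ε ^ 2) := by positivity
  have h3 := mul_le_mul_of_nonneg_left h2 hP
  have h4 := mul_nonneg hP hc.le
  rw [enDen, div_mul_eq_mul_div, le_div_iff₀ hc]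
  linarith

end

section
open NNReal
variable {n : ℕ} {c₀ C₀ ε : ℝ} {a : Euc n → Matrix (Fin n) (Fin n) ℝ} {w : Euc n → ℝ}
  {u : Euc n → ℂ}

theorem Coeff.firstVar_radial_le (h : Coeff c₀ C₀ a w) {k : ℕ} (hn : n = k + 3) {K s : ℝ}
    (hK : 0 < K) (hs : 0 < s) (hK1 : 2 * (k + 1) * C₀ ^ 2 * (1 + C₀) + C₀ ≤ K * c₀ / 2)
    (hK2 : 2 * C₀ ≤ K * c₀) {y : Euc n → Euc n} {x : Euc n} (hx : x ∈ ball (0 : Euc n) 1)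
    (hy : ∀ i, w x * y x i = ∑ j, a x i j * x j) (hyx : ‖y x - x‖ ≤ C₀ * ‖x‖ ^ 2)
    (hKx : ‖x‖ ^ 2 + s ^ 2 ≤ (K⁻¹) ^ 2) {X : Euc n → Euc n}
    (hX : X =ᶠ[nhds x] fun x => profile k K s x • x) :
    firstVar C₀ ε a w u X x ≤ -(c₀ * radialDensity k s ε u y x) := by
  have hq : 0 < Real.sqrt (‖x‖ ^ 2 + s ^ 2) := by positivity
  have hi : invRad s x = (Real.sqrt (‖x‖ ^ 2 + s ^ 2))⁻¹ := rfl
  have ht : invRad s x * Real.sqrt (‖x‖ ^ 2 + s ^ 2) = 1 := by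
    rw [hi]; exact inv_mul_cancel₀ hq.ne'
  have hKq : K * Real.sqrt (‖x‖ ^ 2 + s ^ 2) ≤ 1 := by
    have : Real.sqrt (‖x‖ ^ 2 + s ^ 2) ≤ K⁻¹ := Real.sqrt_le_iff.2 ⟨by positivity, hKx⟩
    calc _ ≤ K * K⁻¹ := by gcongr
      _ = 1 := mul_inv_cancel₀ hK.ne'
  have hD : fderiv ℝ X x = profile k K s x • 1 + profileSlope k K s x • rankOneSelf x := by
    rw [hX.fderiv_eq]
    exact (hasFDerivAt_profile_smul k K hs x).fderiv
  refine (h.radial_pointwise_le (p := k + 1) (K := K) (A := invRad s x ^ (k + 1))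
    (q := Real.sqrt (‖x‖ ^ 2 + s ^ 2)) (f := profile k K s x) (θ := profileSlope k K s x)
    (P := (1 - ‖u x‖ ^ 2) ^ 2 / (4 * ε ^ 2)) hx hy hyx (by rw [hn]; push_cast; ring)
    (by linarith [k.cast_nonneg (α := ℝ)]) hK (by have := invRad_pos hs x; positivity) hq
    (Real.le_sqrt_of_sq_le (le_add_of_nonneg_right (sq_nonneg s))) hKq ?_ ?_ (by positivity)
    hK1 hK2 hD hX.self_of_nhds (fderiv ℝ u x)).trans_eq ?_
  · rw [profile]
    linear_combination (-K * invRad s x ^ k) * ht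
  · rw [profileSlope, div_eq_mul_inv, ← inv_pow, ← hi]
    linear_combination (K * k * invRad s x ^ (k + 2)) * ht
  · rw [radialDensity, div_eq_mul_inv, ← inv_pow, ← hi]; ring

/-- A monotonicity estimate: radial derivatives and the potential are controlled by the energy,
with the singular weight `|x|^{2-n}` regularised at scale `s`. -/
theorem exists_integral_radialDensity_le {k : ℕ} (hn : n = k + 3) (hc : 0 < c₀) (hC : 0 < C₀) :
    ∃ C : ℝ, 0 < C ∧ ∀ (ε : ℝ) (a : Euc n → Matrix (Fin n) (Fin n) ℝ) (w : Euc n → ℝ)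
      (u : Euc n → ℂ) (y : Euc n → Euc n) (s : ℝ), WeakSol c₀ C₀ ε a w u →
      (∀ x ∈ ball (0 : Euc n) 1, ∀ i, w x * y x i = ∑ j, a x i j * x j) →
      (∀ x ∈ ball (0 : Euc n) 1, ‖y x - x‖ ≤ C₀ * ‖x‖ ^ 2) → 0 < s → s ≤ 1 →
      ∫ x in ball (0 : Euc n) 1, radialDensity k s ε u y x ≤
        C * ∫ x in ball (0 : Euc n) 1, enDen ε a w u x := by
  obtain ⟨K, hK⟩ : ∃ K : ℝ, K = 2 + (4 * (k + 1) * C₀ ^ 2 * (1 + C₀) + 2 * C₀) / c₀ := ⟨_, rfl⟩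
  have hKc : K * c₀ = 2 * c₀ + (4 * (k + 1) * C₀ ^ 2 * (1 + C₀) + 2 * C₀) := by
    rw [hK]; field_simp
  have hnn : 0 ≤ (k + 1) * C₀ ^ 2 * (1 + C₀) := by positivity
  have hK1 : 2 * (k + 1) * C₀ ^ 2 * (1 + C₀) + C₀ ≤ K * c₀ / 2 := by rw [hKc]; linarith
  have hK2 : 2 * C₀ ≤ K * c₀ := by rw [hKc]; linarith
  have hK2' : 2 ≤ K := by rw [hK]; exact le_add_of_nonneg_right (by positivity)
  have hK0 : 0 < K := by linarith
  obtain ⟨m, hm⟩ : ∃ m : ℝ, m = K⁻¹ / 2 := ⟨_, rfl⟩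
  have hm0 : 0 < m := by rw [hm]; positivity
  have hm1 : 2 * m < 1 := by
    have := inv_anti₀ two_pos hK2'
    rw [hm]; linarith
  let χ : ContDiffBump (0 : Euc n) := ⟨m, 2 * m, hm0, by linarith⟩
  have hχ1 : ContDiff ℝ 1 χ := χ.contDiff
  obtain ⟨D, hD⟩ := (hχ1.continuous_fderiv one_ne_zero).bounded_above_of_compact_support
    (χ.hasCompactSupport.fderiv (𝕜 := ℝ))
  have hD0 : 0 ≤ D := (norm_nonneg _).trans (hD 0)
  obtain ⟨b, hb⟩ : ∃ b : ℝ, b = (k + 1) * (1 + K) * m⁻¹ ^ (k + 3) := ⟨_, rfl⟩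
  have hb0 : 0 ≤ b := by rw [hb]; positivity
  obtain ⟨C₁, hC₁⟩ : ∃ C₁ : ℝ, C₁ = (2 + D) * b * C₀ * (n + 2) +
    c₀ * (m⁻¹ ^ (k + 3) * (1 + C₀) ^ 2) := ⟨_, rfl⟩
  have hC₁a : 0 ≤ (2 + D) * b * C₀ * ((n : ℝ) + 2) := by positivity
  have hC₁b : 0 < c₀ * (m⁻¹ ^ (k + 3) * (1 + C₀) ^ 2) := by positivity
  have hC₁0 : 0 < C₁ := by rw [hC₁]; linarith
  refine ⟨C₁ / c₀ * (2 / c₀), by positivity, fun ε a w u y s h hy hyx hs hs1 => ?_⟩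
  have hI := h.integrableOn_radialDensity hy hyx k hs hs1
  have hG := h.integrableOn_sq.add h.integrableOn_pot
  suffices H : c₀ * ∫ x in ball (0 : Euc n) 1, radialDensity k s ε u y x ≤
      C₁ * ∫ x in ball (0 : Euc n) 1,
        (‖fderiv ℝ u x‖ ^ 2 + (1 - ‖u x‖ ^ 2) ^ 2 / (4 * ε ^ 2)) by
    have h2 := mul_le_mul_of_nonneg_left h.integral_add_le hC₁0.le
    rw [mul_assoc, div_mul_eq_mul_div, le_div_iff₀ hc, mul_comm]
    exact H.trans h2
  have hfar : ∀ x ∈ ball (0 : Euc n) 1, m ^ 2 ≤ ‖x‖ ^ 2 + s ^ 2 →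
      c₀ * radialDensity k s ε u y x ≤ c₀ * (m⁻¹ ^ (k + 3) * (1 + C₀) ^ 2) *
        (‖fderiv ℝ u x‖ ^ 2 + (1 - ‖u x‖ ^ 2) ^ 2 / (4 * ε ^ 2)) := fun x hx hxm => by
    rw [mul_assoc]
    exact mul_le_mul_of_nonneg_left
      (radialDensity_le k hC.le hs hm0 (by linarith) hx (hyx x hx) hxm) hc.le
  have hG0 : ∀ x, 0 ≤ ‖fderiv ℝ u x‖ ^ 2 + (1 - ‖u x‖ ^ 2) ^ 2 / (4 * ε ^ 2) := fun x => by
    positivity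
  rcases lt_or_ge m s with hsm | hsm
  · rw [← integral_const_mul, ← integral_const_mul]
    refine setIntegral_mono_on (hI.const_mul _) (hG.const_mul _) measurableSet_ball fun x hx => ?_
    refine (hfar x hx ?_).trans (mul_le_mul_of_nonneg_right (by rw [hC₁]; linarith) (hG0 x))
    nlinarith [sq_nonneg ‖x‖]
  · set Y : Euc n → Euc n := fun x => profile k K s x • x with hYdef
    have hY : ContDiff ℝ 1 Y := (contDiff_profile k K hs).smul contDiff_id
    set X : Euc n → Euc n := fun x => χ x • Y x with hXdef
    have hXz : ∀ x, x ∉ closedBall (0 : Euc n) (2 * m) → X x = 0 := fun x hx => by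
      rw [mem_closedBall, not_le] at hx
      rw [hXdef]
      simp only [χ.zero_of_le_dist hx.le, zero_smul]
    obtain ⟨KX, hVF⟩ := exists_isVF_of_hasCompactSupport (hχ1.smul hY) hm1 hXz
    have h0 := h.integral_firstVar_nonneg hVF
    have hle : ∀ x ∈ ball (0 : Euc n) 1, firstVar C₀ ε a w u X x ≤
        C₁ * (‖fderiv ℝ u x‖ ^ 2 + (1 - ‖u x‖ ^ 2) ^ 2 / (4 * ε ^ 2)) -
          c₀ * radialDensity k s ε u y x := fun x hx => by
      rcases lt_or_ge ‖x‖ m with hxm | hxm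
      · have hXY : X =ᶠ[nhds x] fun x => profile k K s x • x := by
          filter_upwards [χ.eventuallyEq_one_of_mem_ball (mem_ball_zero_iff.2 hxm)] with z hz
          simp [hXdef, hYdef, hz]
        have h1 : ‖x‖ ^ 2 + s ^ 2 ≤ K⁻¹ ^ 2 := by
          rw [show K⁻¹ = 2 * m by rw [hm]; ring]
          nlinarith [norm_nonneg x]
        have := h.coeff.firstVar_radial_le (ε := ε) (u := u) hn hK0 hs hK1 hK2 hx (hy x hx)
          (hyx x hx) h1 hXY
        have := mul_nonneg hC₁0.le (hG0 x)
        linarith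
      · have hxs : m ^ 2 ≤ ‖x‖ ^ 2 + s ^ 2 := by nlinarith [sq_nonneg s]
        obtain ⟨hb1, hb2⟩ := profile_bounds k hK0.le hs hm0 (by linarith) hx hxs
        rw [← hb] at hb1 hb2
        have hχa : ‖χ x‖ ≤ 1 := by
          rw [Real.norm_of_nonneg χ.nonneg]; exact χ.le_one
        have hX1 : ‖X x‖ ≤ (2 + D) * b := by
          rw [hXdef]
          simp only [norm_smul]
          have : ‖χ x‖ * ‖Y x‖ ≤ 1 * b := by
            rw [hYdef]
            exact mul_le_mul hχa hb1 (norm_nonneg _) zero_le_one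
          linarith [mul_nonneg hD0 hb0]
        have hX2 : ‖fderiv ℝ X x‖ ≤ (2 + D) * b := by
          have e1 : HasFDerivAt X _ x :=
            ((hχ1.differentiable one_ne_zero x).hasFDerivAt).smul (hasFDerivAt_profile_smul k K hs x)
          rw [e1.fderiv]
          refine (norm_add_le _ _).trans ?_
          rw [norm_smul]
          have e2 : ‖(fderiv ℝ χ x).smulRight (profile k K s x • x)‖ ≤ D * b := by
            rw [ContinuousLinearMap.norm_smulRight_apply]
            exact mul_le_mul (hD x) hb1 (norm_nonneg _) hD0
          have e3 := mul_le_mul hχa hb2 (norm_nonneg _) zero_le_one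
          linarith
        have h1 := h.coeff.firstVar_le (ε := ε) (u := u) hx hX1 hX2
        have h2 := hfar x hx hxs
        rw [hC₁, add_mul]
        linarith
    have h1 := setIntegral_mono_on (h.integrableOn_firstVar hVF)
      ((hG.const_mul C₁).sub (hI.const_mul c₀)) measurableSet_ball hle
    have h2 := integral_sub (hG.const_mul C₁) (hI.const_mul c₀)
    simp only [Pi.add_apply, Pi.sub_apply, integral_const_mul] at h1 h2
    linarith

end

section
open ENNReal
variable {n : ℕ}

theorem lintegral_Ioi_inv_pow_le (k : ℕ) {c : ℝ} (hc : 0 < c) :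
    ∫⁻ r in Set.Ioi c, ENNReal.ofReal (r⁻¹ ^ (k + 2)) ≤ ENNReal.ofReal (c⁻¹ ^ (k + 1)) := by
  have hk : -((k : ℝ) + 2) < -1 := by linarith [k.cast_nonneg (α := ℝ)]
  have e : ∀ r ∈ Set.Ioi c, r⁻¹ ^ (k + 2) = r ^ (-((k : ℝ) + 2)) := fun r hr => by
    have hr0 : 0 < r := hc.trans hr
    rw [Real.rpow_neg hr0.le, inv_pow, ← Real.rpow_natCast]
    push_cast; rfl
  rw [setLIntegral_congr_fun measurableSet_Ioi fun r hr => by rw [e r hr],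
    ← ofReal_integral_eq_lintegral_ofReal (integrableOn_Ioi_rpow_of_lt hk hc)
      ((ae_restrict_mem measurableSet_Ioi).mono fun r hr =>
        Real.rpow_nonneg (hc.trans hr).le _), integral_Ioi_rpow_of_lt hk hc]
  refine ENNReal.ofReal_le_ofReal ?_
  have h1 : c ^ (-((k : ℝ) + 2) + 1) = c⁻¹ ^ (k + 1) := by
    rw [show -((k : ℝ) + 2) + 1 = -((k + 1 : ℕ) : ℝ) by push_cast; ring, Real.rpow_neg hc.le,
      inv_pow, Real.rpow_natCast]
  rw [h1, show -((k : ℝ) + 2) + 1 = -((k : ℝ) + 1) by ring, neg_div_neg_eq]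
  exact div_le_self (by positivity) (by linarith [k.cast_nonneg (α := ℝ)])

theorem inv_norm_le_two_mul_invRad {s : ℝ} (hs : 0 < s) {x : Euc n} {r : ℝ} (h1 : s ≤ r)
    (h2 : ‖x‖ ≤ r) : r⁻¹ ≤ 2 * invRad s x := by
  have hr : 0 < r := hs.trans_le h1
  have : Real.sqrt (‖x‖ ^ 2 + s ^ 2) ≤ 2 * r :=
    Real.sqrt_le_iff.2 ⟨by positivity, by nlinarith [norm_nonneg x]⟩
  have h3 : (2 * r)⁻¹ ≤ invRad s x := by
    rw [invRad]; exact inv_anti₀ (by positivity) this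
  rw [mul_inv] at h3
  linarith

theorem measurable_indicator_lt {h : Euc n → ℝ≥0∞} (hh : Measurable h) :
    Measurable (Function.uncurry fun (r : ℝ) (x : Euc n) => (ball (0 : Euc n) r).indicator h x) := by
  have hm : Measurable ({p : ℝ × Euc n | ‖p.2‖ < p.1}.indicator fun p => h p.2) :=
    (hh.comp measurable_snd).indicator (measurableSet_lt (by fun_prop) (by fun_prop))
  convert hm using 1
  ext ⟨r, x⟩
  simp [Set.indicator]

theorem lintegral_ball_le (k : ℕ) {s : ℝ} (hs : 0 < s) {h : Euc n → ℝ≥0∞} (hh : Measurable h) :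
    ∫⁻ r in Set.Ioi s, ENNReal.ofReal (r⁻¹ ^ (k + 2)) * ∫⁻ x in ball (0 : Euc n) r, h x ≤
      ∫⁻ x, ENNReal.ofReal ((2 * invRad s x) ^ (k + 1)) * h x := by
  have hm := measurable_indicator_lt hh
  have hp : Measurable fun r : ℝ => ENNReal.ofReal (r⁻¹ ^ (k + 2)) := by fun_prop
  calc _ = ∫⁻ r in Set.Ioi s, ∫⁻ x, ENNReal.ofReal (r⁻¹ ^ (k + 2)) *
        (ball (0 : Euc n) r).indicator h x := by
        refine lintegral_congr fun r => ?_
        rw [lintegral_const_mul _ (hh.indicator measurableSet_ball),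
          lintegral_indicator measurableSet_ball]
    _ = ∫⁻ x, ∫⁻ r in Set.Ioi s, ENNReal.ofReal (r⁻¹ ^ (k + 2)) *
        (ball (0 : Euc n) r).indicator h x :=
      lintegral_lintegral_swap ((hp.comp measurable_fst).mul hm).aemeasurable
    _ ≤ _ := by
      refine lintegral_mono fun x => ?_
      have hc : 0 < max s ‖x‖ := lt_max_of_lt_left hs
      calc _ ≤ ∫⁻ r in Set.Ioi s, (Set.Ioi (max s ‖x‖)).indicator
              (fun r => ENNReal.ofReal (r⁻¹ ^ (k + 2)) * h x) r := by
            refine setLIntegral_mono' measurableSet_Ioi fun r hr => ?_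
            by_cases hx : ‖x‖ < r
            · rw [Set.indicator_of_mem (Set.mem_Ioi.2 (max_lt hr hx))]
              gcongr
              exact Set.indicator_le_self _ _ _
            · rw [Set.indicator_of_notMem (by simpa using hx)]
              simp
        _ ≤ ∫⁻ r, (Set.Ioi (max s ‖x‖)).indicator
              (fun r => ENNReal.ofReal (r⁻¹ ^ (k + 2)) * h x) r := setLIntegral_le_lintegral _ _
        _ = (∫⁻ r in Set.Ioi (max s ‖x‖), ENNReal.ofReal (r⁻¹ ^ (k + 2))) * h x := by
            rw [lintegral_indicator measurableSet_Ioi, lintegral_mul_const _ hp]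
        _ ≤ _ := by
            gcongr
            refine (lintegral_Ioi_inv_pow_le k hc).trans (ENNReal.ofReal_le_ofReal ?_)
            exact pow_le_pow_left₀ (by positivity)
              (inv_norm_le_two_mul_invRad hs (le_max_left _ _) (le_max_right _ _)) _

theorem ofReal_integral_le_lintegral {α : Type*} [MeasurableSpace α] {μ : Measure α} {f : α → ℝ}
    (hf : 0 ≤ f) : ENNReal.ofReal (∫ x, f x ∂μ) ≤ ∫⁻ x, ENNReal.ofReal (f x) ∂μ := by
  refine (Real.ofReal_le_enorm _).trans ((enorm_integral_le_lintegral_enorm _).trans_eq ?_)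
  exact lintegral_congr fun x => Real.enorm_of_nonneg (hf x)

theorem lintegral_Ioo_inv {s R : ℝ} (hs : 0 < s) (hR : s < R) {T : ℝ} (hT : 0 ≤ T) :
    ∫⁻ r in Set.Ioo s R, ENNReal.ofReal (T * r⁻¹) = ENNReal.ofReal (T * Real.log (R / s)) := by
  have hi : IntegrableOn (fun r : ℝ => r⁻¹) (Set.Ioo s R) := by
    have hc : ContinuousOn (fun r : ℝ => r⁻¹) (Set.Icc s R) := fun r hr =>
      (continuousAt_inv₀ (hs.trans_le hr.1).ne').continuousWithinAt
    exact hc.integrableOn_Icc.mono_set Set.Ioo_subset_Icc_self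
  rw [← ofReal_integral_eq_lintegral_ofReal (hi.const_mul T)
    ((ae_restrict_mem measurableSet_Ioo).mono fun r hr =>
      mul_nonneg hT (inv_nonneg.2 (hs.trans hr.1).le)), integral_const_mul,
    ← integral_Ioc_eq_integral_Ioo, ← intervalIntegral.integral_of_le hR.le,
    integral_inv_of_pos hs (hs.trans hR)]

/-- Selection of a radius at which the boundary and bulk terms are both controlled, by averaging
over a logarithmic scale. -/
theorem exists_good_radius {k : ℕ} (hn : n = k + 3) :
    ∃ D : ℝ, 0 < D ∧ ∀ (H₁ H₂ : Euc n → ℝ) (s R M : ℝ), Measurable H₁ → Measurable H₂ →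
      0 ≤ H₁ → 0 ≤ H₂ → 0 < s → s < R → 0 ≤ M →
      ∫⁻ x, ENNReal.ofReal (invRad s x ^ (k + 1) * (H₁ x * invRad s x ^ 2 + H₂ x)) ≤
        ENNReal.ofReal M →
      ∃ r, s < r ∧ r < R ∧
        r⁻¹ ^ k * ∫ x in sphere (0 : Euc n) r, H₁ x / ‖x‖ ^ 2 ∂(μH[(n : ℝ) - 1]) +
          r⁻¹ ^ (k + 1) * ∫ x in ball (0 : Euc n) r, 2 * H₂ x ≤ D / Real.log (R / s) * M := by
  obtain ⟨CH, hCH, hHaus⟩ := exists_hausdorffMeasure_le_volume n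
  set D : ℝ≥0∞ := CH * 2 ^ (k + 3) + 2 ^ (k + 2) with hDdef
  have hDtop : D ≠ ⊤ := by finiteness
  have hD0 : 0 < D.toReal := ENNReal.toReal_pos (by simp [hDdef]) hDtop
  refine ⟨D.toReal, hD0, fun H₁ H₂ s R M hm₁ hm₂ h₁ h₂ hs hR hM hle => ?_⟩
  have hlog : 0 < Real.log (R / s) := Real.log_pos ((one_lt_div hs).2 hR)
  by_contra! hcon
  set T : ℝ := D.toReal / Real.log (R / s) * M with hTdef
  have hT : 0 ≤ T := by positivity
  have hmi : Measurable (invRad s : Euc n → ℝ) := (continuous_invRad hs).measurable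
  set F : Euc n → ℝ≥0∞ := {x : Euc n | s ≤ ‖x‖}.indicator
    fun x => ENNReal.ofReal (‖x‖⁻¹ ^ (k + 3) * H₁ x) with hFdef
  have hF : Measurable F := Measurable.indicator (by fun_prop)
    (measurableSet_le measurable_const (by fun_prop))
  have hn1 : (0 : ℝ) < (n : ℝ) - 1 := by
    rw [hn]; push_cast; linarith [k.cast_nonneg (α := ℝ)]
  obtain ⟨Φ, hΦm, hΦ1, hΦ2⟩ := exists_measurable_slice_majorant_lintegral
    (X := Euc n) (f := fun x => ‖x‖) lipschitzWith_one_norm hn1 hF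
  rw [sub_add_cancel] at hΦ2
  set h : Euc n → ℝ≥0∞ := fun x => ENNReal.ofReal (2 * H₂ x) with hhdef
  have hh : Measurable h := by fun_prop
  set A : ℝ → ℝ≥0∞ := fun r => ENNReal.ofReal (r⁻¹ ^ (k + 2)) * ∫⁻ x in ball (0 : Euc n) r, h x
    with hAdef
  have hAm : Measurable A := by
    refine Measurable.mul (by fun_prop) ?_
    have := (measurable_indicator_lt hh).lintegral_prod_right' (ν := (volume : Measure (Euc n)))
    simpa only [Function.uncurry, lintegral_indicator measurableSet_ball] using this
  have hbig : ∀ r ∈ Set.Ioo s R, ENNReal.ofReal (T * r⁻¹) < Φ r + A r := fun r hr => by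
    have hr0 : 0 < r := hs.trans hr.1
    have h3 := hcon r hr.1 hr.2
    have h4 : T * r⁻¹ < r⁻¹ ^ (k + 1) * ∫ x in sphere (0 : Euc n) r, H₁ x / ‖x‖ ^ 2 ∂(μH[(n : ℝ) - 1]) +
          r⁻¹ ^ (k + 2) * ∫ x in ball (0 : Euc n) r, 2 * H₂ x := by
      have := mul_lt_mul_of_pos_right h3 (inv_pos.2 hr0)
      refine this.trans_eq ?_
      ring
    refine ((ENNReal.ofReal_lt_ofReal_iff ((mul_nonneg hT (inv_nonneg.2 hr0.le)).trans_lt h4)).2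
      h4).trans_le (ENNReal.ofReal_add_le.trans (add_le_add ?_ ?_))
    · rw [← integral_const_mul]
      refine (ofReal_integral_le_lintegral fun x => ?_).trans (le_trans ?_ (hΦ1 r))
      · have := h₁ x
        simp only [Pi.zero_apply] at this ⊢
        positivity
      · rw [show (fun x : Euc n => ‖x‖) ⁻¹' {r} = sphere 0 r by ext; simp]
        refine setLIntegral_mono' isClosed_sphere.measurableSet fun x hx => ?_
        rw [mem_sphere_zero_iff_norm] at hx
        rw [hFdef, Set.indicator_of_mem (by rw [Set.mem_ofPred_eq, hx]; exact hr.1.le), hx]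
        refine (congrArg ENNReal.ofReal ?_).le
        rw [div_eq_mul_inv, ← inv_pow]; ring
    · rw [hAdef]
      simp only
      rw [ENNReal.ofReal_mul (by positivity)]
      gcongr
      exact ofReal_integral_le_lintegral fun x => mul_nonneg zero_le_two (h₂ x)
  have hlt : ENNReal.ofReal (T * Real.log (R / s)) < ∫⁻ r in Set.Ioo s R, (Φ r + A r) := by
    rw [← lintegral_Ioo_inv hs hR hT]
    refine setLIntegral_strict_mono measurableSet_Ioo (by simpa using hR) (hΦm.add hAm) ?_
      (ae_of_all _ hbig)
    rw [lintegral_Ioo_inv hs hR hT]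
    exact ENNReal.ofReal_ne_top
  refine absurd hlt (not_lt.2 ?_)
  have hTD : ENNReal.ofReal (T * Real.log (R / s)) = D * ENNReal.ofReal M := by
    rw [hTdef, show D.toReal / Real.log (R / s) * M * Real.log (R / s) = D.toReal * M by
      field_simp, ENNReal.ofReal_mul hD0.le, ENNReal.ofReal_toReal hDtop]
  have hFle : ∫⁻ x, F x ∂(μH[(n : ℝ)]) ≤ CH * (2 ^ (k + 3) * ENNReal.ofReal M) := by
    refine (lintegral_mono' hHaus le_rfl).trans ?_
    rw [lintegral_smul_measure, smul_eq_mul]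
    gcongr
    refine le_trans ?_ (mul_le_mul_right hle _)
    rw [← lintegral_const_mul _ (by fun_prop)]
    refine lintegral_mono fun x => ?_
    have hi := invRad_pos hs x
    have hx1 : 0 ≤ H₁ x := h₁ x
    have hx2 : 0 ≤ H₂ x := h₂ x
    rw [← ENNReal.ofReal_ofNat 2, ← ENNReal.ofReal_pow zero_le_two,
      ← ENNReal.ofReal_mul (by positivity)]
    by_cases hx : s ≤ ‖x‖
    · rw [hFdef, Set.indicator_of_mem (by exact hx)]
      refine ENNReal.ofReal_le_ofReal ?_
      calc _ ≤ (2 * invRad s x) ^ (k + 3) * H₁ x := by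
            gcongr
            exact inv_norm_le_two_mul_invRad hs hx le_rfl
        _ = 2 ^ (k + 3) * (invRad s x ^ (k + 1) * (H₁ x * invRad s x ^ 2 + 0)) := by ring
        _ ≤ _ := by gcongr
    · rw [hFdef, Set.indicator_of_notMem (by exact hx)]
      positivity
  have hAle : ∫⁻ r in Set.Ioo s R, A r ≤ 2 ^ (k + 2) * ENNReal.ofReal M := by
    refine (lintegral_mono_set Set.Ioo_subset_Ioi_self).trans ((lintegral_ball_le k hs hh).trans ?_)
    refine le_trans ?_ (mul_le_mul_right hle _)
    rw [← lintegral_const_mul _ (by fun_prop)]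
    refine lintegral_mono fun x => ?_
    have hi := invRad_pos hs x
    have hx1 : 0 ≤ H₁ x := h₁ x
    have hx2 : 0 ≤ H₂ x := h₂ x
    rw [← ENNReal.ofReal_ofNat 2, ← ENNReal.ofReal_pow zero_le_two,
      ← ENNReal.ofReal_mul (by positivity), ← ENNReal.ofReal_mul (by positivity)]
    refine ENNReal.ofReal_le_ofReal ?_
    calc _ = 2 ^ (k + 2) * (invRad s x ^ (k + 1) * (0 + H₂ x)) := by ring
      _ ≤ _ := by gcongr; positivity
  rw [lintegral_add_left hΦm, hTD, hDdef, add_mul, mul_assoc]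
  exact add_le_add ((setLIntegral_le_lintegral _ _).trans (hΦ2.trans hFle)) hAle

end

section
variable {n : ℕ} {c₀ C₀ ε : ℝ} {g : Euc n → Matrix (Fin n) (Fin n) ℝ} {u : Euc n → ℂ}

theorem enDen_sqrtDet (ε : ℝ) (g : Euc n → Matrix (Fin n) (Fin n) ℝ) (u : Euc n → ℂ) (x : Euc n) :
    enDen ε (fun x => sqrtDet g x • (g x)⁻¹) (sqrtDet g) u x = eDen g ε u x * sqrtDet g x := by
  rw [enDen, eDen, qf_smul, gradSq_eq_qf]; ring

theorem IsGLSol.weakSol (hε : 0 < ε)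
    (hco : Coeff c₀ C₀ (fun x => sqrtDet g x • (g x)⁻¹) (sqrtDet g)) (h : IsGLSol n g ε u) :
    WeakSol c₀ C₀ ε (fun x => sqrtDet g x • (g x)⁻¹) (sqrtDet g) u where
  coeff := hco
  eps_pos := hε
  diff := h.1
  le_one := h.2.1
  memLp := by
    have hm : AEStronglyMeasurable (fderiv ℝ u) (volume.restrict (ball 0 1)) :=
      (measurable_fderiv ℝ u).aestronglyMeasurable
    refine (memLp_two_iff_integrable_sq_norm hm).2 ((h.2.2.1.const_mul (2 / c₀)).mono'
      (hm.norm.pow 2) ?_)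
    filter_upwards [ae_restrict_mem measurableSet_ball] with x hx
    have hc := hco.pos
    rw [Real.norm_of_nonneg (sq_nonneg _), ← enDen_sqrtDet, enDen, div_mul_eq_mul_div,
      le_div_iff₀ hc]
    have h1 := hco.lower x hx (fderiv ℝ u x)
    have h2 : 0 ≤ (1 - ‖u x‖ ^ 2) ^ 2 / (4 * ε ^ 2) * sqrtDet g x :=
      mul_nonneg (by positivity) (Real.sqrt_nonneg _)
    linarith
  weak := fun ζ hζ hs => by
    rw [← h.2.2.2 ζ hζ hs]
    refine integral_congr_ae (ae_of_all _ fun x => ?_)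
    simp only [qf_smul]
    rw [qf]
    simp only [pd]
    ring

theorem norm_mul_radD (x : Euc n) (hs : (g x).IsSymm) :
    (‖x‖ : ℂ) * radD g u x = fderiv ℝ u x (WithLp.toLp 2 ((g x)⁻¹.mulVec x)) := by
  have hs' : ((g x)⁻¹).IsSymm := hs.inv
  rw [eq_sum_single (WithLp.toLp 2 ((g x)⁻¹.mulVec x) : Euc n), map_sum, radD, Finset.sum_comm,
    Finset.mul_sum]
  refine Finset.sum_congr rfl fun j _ => ?_
  rw [map_smul, Complex.real_smul, ← Finset.sum_mul, ← mul_assoc, pd, ← Complex.ofReal_sum,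
    ← Complex.ofReal_mul]
  congr 2
  simp only [Matrix.mulVec, dotProduct, Finset.mul_sum]
  refine Finset.sum_congr rfl fun i _ => ?_
  rw [hs'.apply j i]
  rcases eq_or_ne x 0 with rfl | hx
  · simp
  · have := norm_ne_zero_iff.2 hx
    field_simp

theorem measurable_indicator_of_continuousOn {β : Type*} [TopologicalSpace β] [MeasurableSpace β]
    [BorelSpace β] [Zero β] {f : Euc n → β} (hf : ContinuousOn f (ball 0 1)) :
    Measurable ((ball (0 : Euc n) 1).indicator f) := by
  classical
  rw [← Set.piecewise_eq_indicator]
  exact hf.measurable_piecewise continuousOn_const measurableSet_ball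

theorem measurable_fderiv_apply (u : Euc n → ℂ) {y : Euc n → Euc n} (hy : Measurable y) :
    Measurable fun x => fderiv ℝ u x (y x) := by
  have e : (fun x => fderiv ℝ u x (y x)) =
      fun x => ∑ j, y x j • fderiv ℝ u x (EuclideanSpace.single j 1) := by
    ext x
    conv_lhs => rw [eq_sum_single (y x)]
    simp
  rw [e]
  refine Finset.measurable_sum _ fun j _ => ?_
  exact (((EuclideanSpace.proj (𝕜 := ℝ) j).continuous.measurable).comp hy).smul
    (measurable_fderiv_apply_const ℝ u _)

end

/-- Courant–Lebesgue type lemma, selecting a good radius `r ∈ (ε^{1/2}, ε^{1/4})`. -/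
theorem stmt5 (n : ℕ) (hn : 3 ≤ n) (lam Lam : ℝ) (hlam : 0 < lam) (hLam : 0 < Lam) :
    ∃ C : ℝ, 0 < C ∧
      ∀ (g : Euc n → Matrix (Fin n) (Fin n) ℝ) (ε : ℝ) (u : Euc n → ℂ),
        0 < ε → ε < 1 → MemM n lam Lam g → IsGLSol n g ε u →
        ∃ r : ℝ, Real.sqrt ε < r ∧ r < ε ^ ((1 : ℝ) / 4) ∧
          r ^ ((3 : ℝ) - n) *
              (∫ x in sphere (0 : Euc n) r, ‖radD g u x‖ ^ 2 * sqrtDet g x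
                ∂(μH[(n : ℝ) - 1]))
            + r ^ ((2 : ℝ) - n) *
              (∫ x in ball (0 : Euc n) r, (1 - ‖u x‖ ^ 2) ^ 2 / (2 * ε ^ 2) * sqrtDet g x)
          ≤ (C / (-Real.log ε)) * ∫ x in ball (0 : Euc n) 1, eDen g ε u x * sqrtDet g x := by
  obtain ⟨k, hk⟩ : ∃ k, n = k + 3 := ⟨n - 3, by lia⟩
  obtain ⟨c₀, C₀, hc₀, hC₀, hcoeff⟩ := exists_coeff n hlam hLam
  obtain ⟨C₁, hC₁, hmono⟩ := exists_integral_radialDensity_le hk hc₀ hC₀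
  obtain ⟨D, hD, hgood⟩ := exists_good_radius hk
  refine ⟨4 * D * C₀ * C₁, by positivity, fun g ε u hε hε1 hg hu => ?_⟩
  obtain ⟨hco, hyx⟩ := hcoeff g hg
  have hsol := hu.weakSol hε hco
  set y : Euc n → Euc n := fun x => WithLp.toLp 2 ((g x)⁻¹.mulVec x) with hydef
  set E : ℝ := ∫ x in ball (0 : Euc n) 1, eDen g ε u x * sqrtDet g x with hE
  have hs : 0 < Real.sqrt ε := Real.sqrt_pos.2 hε
  have hs1 : Real.sqrt ε ≤ 1 := Real.sqrt_le_one.2 hε1.le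
  have hlogε : Real.log ε < 0 := Real.log_neg hε hε1
  have hsR : Real.sqrt ε < ε ^ ((1 : ℝ) / 4) := by
    rw [Real.sqrt_eq_rpow]
    exact Real.rpow_lt_rpow_of_exponent_gt hε hε1 (by norm_num)
  have hlog : Real.log (ε ^ ((1 : ℝ) / 4) / Real.sqrt ε) = -Real.log ε / 4 := by
    rw [Real.log_div (by positivity) hs.ne', Real.log_rpow hε, Real.log_sqrt hε.le]
    ring
  have hy : ∀ x ∈ ball (0 : Euc n) 1, ∀ i,
      sqrtDet g x * y x i = ∑ j, (sqrtDet g x • (g x)⁻¹) i j * x j := fun x _ i => by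
    simp [hydef, Matrix.mulVec, dotProduct, Finset.mul_sum, mul_assoc]
  have hrad := hmono ε _ _ u y (Real.sqrt ε) hsol hy hyx hs hs1
  simp only [enDen_sqrtDet] at hrad
  have hE0 : 0 ≤ C₁ * E :=
    (setIntegral_nonneg measurableSet_ball fun x _ => radialDensity_nonneg k hs y x).trans hrad
  have hyc := hco.continuousOn_of_eq hy
  have hwc := hco.w_continuousOn
  have huc := hu.1.continuousOn
  have hw0 : ∀ x, 0 ≤ (ball (0 : Euc n) 1).indicator (sqrtDet g) x := fun x =>
    Set.indicator_nonneg (fun x _ => Real.sqrt_nonneg _) x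
  obtain ⟨H₁, hH₁⟩ : ∃ H₁ : Euc n → ℝ, H₁ = fun x =>
      ‖fderiv ℝ u x ((ball (0 : Euc n) 1).indicator y x)‖ ^ 2 *
        (ball (0 : Euc n) 1).indicator (sqrtDet g) x := ⟨_, rfl⟩
  obtain ⟨H₂, hH₂⟩ : ∃ H₂ : Euc n → ℝ, H₂ = (ball (0 : Euc n) 1).indicator fun x =>
      (1 - ‖u x‖ ^ 2) ^ 2 / (4 * ε ^ 2) * sqrtDet g x := ⟨_, rfl⟩
  have hm₁ : Measurable H₁ := by
    rw [hH₁]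
    exact ((measurable_fderiv_apply u (measurable_indicator_of_continuousOn hyc)).norm.pow_const
      2).mul (measurable_indicator_of_continuousOn hwc)
  have hm₂ : Measurable H₂ := by
    rw [hH₂]
    exact measurable_indicator_of_continuousOn (by fun_prop)
  have h₁ : 0 ≤ H₁ := fun x => by
    rw [hH₁]; exact mul_nonneg (sq_nonneg _) (hw0 x)
  have h₂ : 0 ≤ H₂ := fun x => by
    rw [hH₂]
    exact Set.indicator_nonneg (fun x _ => mul_nonneg (by positivity) (Real.sqrt_nonneg _)) x
  have hint := hsol.integrableOn_radialDensity hy hyx k hs hs1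
  have hle : ∫⁻ x, ENNReal.ofReal (invRad (Real.sqrt ε) x ^ (k + 1) *
      (H₁ x * invRad (Real.sqrt ε) x ^ 2 + H₂ x)) ≤ ENNReal.ofReal (C₀ * (C₁ * E)) := by
    refine le_trans ?_ (ENNReal.ofReal_le_ofReal (mul_le_mul_of_nonneg_left hrad hC₀.le))
    rw [← integral_const_mul, ofReal_integral_eq_lintegral_ofReal (hint.const_mul C₀)
      (ae_of_all _ fun x => mul_nonneg hC₀.le (radialDensity_nonneg k hs y x)),
      ← lintegral_indicator measurableSet_ball]
    refine lintegral_mono fun x => ?_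
    by_cases hx : x ∈ ball (0 : Euc n) 1
    · rw [Set.indicator_of_mem hx]
      refine ENNReal.ofReal_le_ofReal ?_
      simp only [hH₁, hH₂, Set.indicator_of_mem hx]
      have hi := invRad_pos hs x
      calc _ = sqrtDet g x * radialDensity k (Real.sqrt ε) ε u y x := by
            rw [radialDensity]; ring
        _ ≤ _ := mul_le_mul_of_nonneg_right (hco.w_upper x hx) (radialDensity_nonneg k hs y x)
    · simp [hH₁, hH₂, Set.indicator_of_notMem hx]
  obtain ⟨r, hr1, hr2, hr⟩ := hgood H₁ H₂ _ _ _ hm₁ hm₂ h₁ h₂ hs hsR (by positivity) hle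
  have hr0 : 0 < r := hs.trans hr1
  have hrlt : r < 1 := hr2.trans (Real.rpow_lt_one hε.le hε1 (by norm_num))
  refine ⟨r, hr1, hr2, ?_⟩
  have e1 : r ^ ((3 : ℝ) - n) = r⁻¹ ^ k := by
    rw [hk, show (3 : ℝ) - (k + 3 : ℕ) = -(k : ℝ) by push_cast; ring, Real.rpow_neg hr0.le,
      inv_pow, Real.rpow_natCast]
  have e2 : r ^ ((2 : ℝ) - n) = r⁻¹ ^ (k + 1) := by
    rw [hk, show (2 : ℝ) - (k + 3 : ℕ) = -((k + 1 : ℕ) : ℝ) by push_cast; ring,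
      Real.rpow_neg hr0.le, inv_pow, Real.rpow_natCast]
  have e3 : ∫ x in sphere (0 : Euc n) r, ‖radD g u x‖ ^ 2 * sqrtDet g x ∂(μH[(n : ℝ) - 1]) =
      ∫ x in sphere (0 : Euc n) r, H₁ x / ‖x‖ ^ 2 ∂(μH[(n : ℝ) - 1]) := by
    refine setIntegral_congr_fun isClosed_sphere.measurableSet fun x hx => ?_
    have hxr : ‖x‖ = r := mem_sphere_zero_iff_norm.1 hx
    have hxb : x ∈ ball (0 : Euc n) 1 := by rw [mem_ball_zero_iff, hxr]; exact hrlt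
    simp only [hH₁, Set.indicator_of_mem hxb]
    rw [hydef]
    simp only
    rw [← norm_mul_radD x (hg.2.1 x hxb).1, norm_mul, Complex.norm_real, norm_norm, hxr]
    field_simp
  have e4 : ∫ x in ball (0 : Euc n) r, (1 - ‖u x‖ ^ 2) ^ 2 / (2 * ε ^ 2) * sqrtDet g x =
      ∫ x in ball (0 : Euc n) r, 2 * H₂ x := by
    refine setIntegral_congr_fun measurableSet_ball fun x hx => ?_
    simp only [hH₂, Set.indicator_of_mem (ball_subset_ball hrlt.le hx)]
    ring
  rw [e1, e2, e3, e4]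
  refine hr.trans_eq ?_
  rw [hlog]
  field_simp
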